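/- Fix a small ε > 0 and let G be a 2-form on ℝ^{3+1} satisfying the Bianchi identity, with J = δG (J_μ = ∂^νG_{μν}) and J̸ = (J_{e₁}, J_{e₂}). Then there is a constant C depending only on R, γ₀, ε such that: (interior) for all 0 ≤ τ₁ < τ₂ and v₀ ≥ (τ₂+R)/2, I^{−1−ε}_0[G](𝒟_{τ₁}^{τ₂}) + ∫_{τ₁}^{τ₂}∫_{Σ_τ}(ρ² + σ²)/(1+r) dx dτ + E[G](H̲_{v₀}^{τ₁,τ₂}) + E[G](Σ_{τ₂}) ≤ C( E[G](Σ_{τ₁}) + I^{1+ε}_0[|J_L| + |J̸|](𝒟_{τ₁}^{τ₂}) + ∬_{𝒟_{τ₁}^{τ₂}} |J_{L̲}||ρ| dx dt ); and (exterior) for all τ₂ ≤ τ₁ ≤ 0, I^{−1−ε}_0[G](𝒟_{τ₁}^{τ₂}) + E[G](H̲_{−τ₂*}^{τ₁*}) + E[G](H_{τ₁*}^{−τ₂*}) ≤ C( E[G](B_{R−τ₁}^{R−τ₂}) + I^{1+ε}_0[|J_L| + |J̸|](𝒟_{τ₁}^{τ₂}) + ∬_{𝒟_{τ₁}^{τ₂}}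 |J_{L̲}||ρ| dx dt ). -/

import Mathlib

/-!  Common setup: Minkowski space ℝ^{3+1}, null frame, Maxwell–Klein–Gordon objects. -/

noncomputable section

open MeasureTheory ENNReal Set Metric

/-- spacetime points of ℝ^{3+1} -/
abbrev V : Type := Fin 4 → ℝ
/-- spatial points -/
abbrev E3 : Type := EuclideanSpace ℝ (Fin 3)

namespace MKG

def oR (x : ℝ) : ℝ≥0∞ := ENNReal.ofReal x

/-! ## Coordinates -/
def tC (p : V) : ℝ := p 0
def rad (p : V) : ℝ := Real.sqrt (∑ i : Fin 3, (p i.succ) ^ 2)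
def uC (p : V) : ℝ := (tC p - rad p) / 2
def vC (p : V) : ℝ := (tC p + rad p) / 2
def rplus (p : V) : ℝ := 1 + rad p
def uplus (p : V) : ℝ := 1 + |uC p|
def taupl (τ : ℝ) : ℝ := 1 + |τ|
/-- Minkowski metric diag(-1,1,1,1) (diagonal entries). -/
def eta : Fin 4 → ℝ := fun μ => if μ = 0 then -1 else 1

/-- spacetime point from time and space -/
def stp (t : ℝ) (x : E3) : V := ![t, x 0, x 1, x 2]
/-- spacetime point from time, radius and angle -/
def pt (t r : ℝ) (ω : E3) : V := ![t, r * ω 0, r * ω 1, r * ω 2]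

/-! ## Derivatives, connection, curvature -/
def pd (μ : Fin 4) (f : V → ℝ) (p : V) : ℝ := fderiv ℝ f p (Pi.single μ 1)
def pdC (μ : Fin 4) (f : V → ℂ) (p : V) : ℂ := fderiv ℝ f p (Pi.single μ 1)

/-- covariant derivative D_μ = ∂_μ + i A_μ -/
def covD (A : V → Fin 4 → ℝ) (μ : Fin 4) (φ : V → ℂ) (p : V) : ℂ :=
  pdC μ φ p + Complex.I * (A p μ) * φ p
/-- second covariant derivative D_μ D_ν φ -/
def covD2 (A : V → Fin 4 → ℝ) (μ ν : Fin 4) (φ : V → ℂ) (p : V) : ℂ :=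
  pdC μ (covD A ν φ) p + Complex.I * (A p μ) * covD A ν φ p
/-- covariant wave operator □_A = D^μ D_μ -/
def boxA (A : V → Fin 4 → ℝ) (φ : V → ℂ) (p : V) : ℂ :=
  ∑ μ, (eta μ : ℂ) * covD2 A μ μ φ p
/-- curvature 2-form F = dA -/
def curv (A : V → Fin 4 → ℝ) (p : V) (μ ν : Fin 4) : ℝ :=
  pd μ (fun q => A q ν) p - pd ν (fun q => A q μ) p

/-- (δG)_ν = ∂^μ G_{μν} (divergence over the first index) -/
def divFst (G : V → Fin 4 → Fin 4 → ℝ) (p : V) (ν : Fin 4) : ℝ :=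
  ∑ μ, eta μ * pd μ (fun q => G q μ ν) p
/-- J_μ = ∂^ν G_{μν} (divergence over the second index) -/
def divSnd (G : V → Fin 4 → Fin 4 → ℝ) (p : V) (μ : Fin 4) : ℝ :=
  ∑ ν, eta ν * pd ν (fun q => G q μ ν) p

/-! ## Null frame and null decompositions -/
/-- outgoing null vector L = ∂_t + ∂_r -/
def Lv (p : V) : V := ![1, p 1 / rad p, p 2 / rad p, p 3 / rad p]
/-- incoming null vector L̲ = ∂_t − ∂_r -/
def Lbv (p : V) : V := ![1, -(p 1 / rad p), -(p 2 / rad p), -(p 3 / rad p)]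
/-- radial vector ∂_r -/
def rv (p : V) : V := ![0, p 1 / rad p, p 2 / rad p, p 3 / rad p]
/-- tangential projection frame P_j = ∂_j − ω_j ∂_r (spanning the spheres'
tangent space; for any covector ξ one has Σ_j ξ(P_j)² = |ξ restricted to the sphere|²). -/
def Pv (p : V) (j : Fin 3) : V :=
  fun μ => if μ = 0 then 0 else
    (if μ = j.succ then 1 else 0) - p j.succ * p μ / rad p ^ 2

/-- evaluation of a 2-form on two vectors -/
def ap2 (G : V → Fin 4 → Fin 4 → ℝ) (X Y : V) (p : V) : ℝ := ∑ μ, ∑ ν, X μ * Y ν * G p μ ν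
/-- evaluation of a 1-form on a vector -/
def ap1 (J : V → Fin 4 → ℝ) (X : V) (p : V) : ℝ := ∑ μ, X μ * J p μ

/-- |α|² = Σ_i F(L,e_i)² -/
def alphaSq (G : V → Fin 4 → Fin 4 → ℝ) (p : V) : ℝ := ∑ j : Fin 3, (ap2 G (Lv p) (Pv p j) p) ^ 2
/-- |α̲|² = Σ_i F(L̲,e_i)² -/
def abarSq (G : V → Fin 4 → Fin 4 → ℝ) (p : V) : ℝ := ∑ j : Fin 3, (ap2 G (Lbv p) (Pv p j) p) ^ 2
/-- ρ = ½ F(L̲,L) -/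
def rhoC (G : V → Fin 4 → Fin 4 → ℝ) (p : V) : ℝ := (1 / 2) * ap2 G (Lbv p) (Lv p) p
/-- σ² = F(e₁,e₂)² -/
def sigmaSq (G : V → Fin 4 → Fin 4 → ℝ) (p : V) : ℝ :=
  (1 / 2) * ∑ j : Fin 3, ∑ k : Fin 3, (ap2 G (Pv p j) (Pv p k) p) ^ 2
/-- |F|², the sum of the squares of all (independent) components -/
def fSq (G : V → Fin 4 → Fin 4 → ℝ) (p : V) : ℝ := (1 / 2) * ∑ μ, ∑ ν, (G p μ ν) ^ 2
/-- squared angular part |J̸|² of a 1-form -/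
def JslashSq (J : V → Fin 4 → ℝ) (p : V) : ℝ := ∑ j : Fin 3, (ap1 J (Pv p j) p) ^ 2

/-! ## Scalar field: null derivatives and energy densities -/
/-- directional covariant derivative -/
def dirD (A : V → Fin 4 → ℝ) (X : V) (φ : V → ℂ) (p : V) : ℂ :=
  ∑ μ, (X μ : ℂ) * covD A μ φ p
/-- the weighted field ψ = rφ -/
def psi (φ : V → ℂ) (p : V) : ℂ := (rad p : ℂ) * φ p
def eDL (A : V → Fin 4 → ℝ) (φ : V → ℂ) (p : V) : ℝ := ‖dirD A (Lv p) φ p‖ ^ 2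
def eDLb (A : V → Fin 4 → ℝ) (φ : V → ℂ) (p : V) : ℝ := ‖dirD A (Lbv p) φ p‖ ^ 2
/-- |D̸φ|² -/
def eDslash (A : V → Fin 4 → ℝ) (φ : V → ℂ) (p : V) : ℝ :=
  ∑ j : Fin 3, ‖dirD A (Pv p j) φ p‖ ^ 2
/-- |Dφ|² -/
def eD (A : V → Fin 4 → ℝ) (φ : V → ℂ) (p : V) : ℝ := ∑ μ, ‖covD A μ φ p‖ ^ 2
/-- |D̄φ|² = |Dφ|² + r₊^{-2}|φ|² -/
def eDbar (A : V → Fin 4 → ℝ) (φ : V → ℂ) (p : V) : ℝ := eD A φ p + ‖φ p‖ ^ 2 / rplus p ^ 2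
/-- the covariant angular Laplacian D̸² -/
def covLapSph (A : V → Fin 4 → ℝ) (φ : V → ℂ) (p : V) : ℂ :=
  ∑ j : Fin 3, dirD A (Pv p j) (fun q => dirD A (Pv q j) φ q) p

/-- the current J_μ[φ] = Im(φ · conj(D_μ φ)) -/
def Jsf (A : V → Fin 4 → ℝ) (φ : V → ℂ) (p : V) (μ : Fin 4) : ℝ :=
  (φ p * (starRingEnd ℂ) (covD A μ φ p)).im
/-- X^μ F_{μν} J^ν[φ] -/
def FJcontr (G : V → Fin 4 → Fin 4 → ℝ) (A : V → Fin 4 → ℝ) (φ : V → ℂ)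
    (X : V → V) (p : V) : ℝ :=
  ∑ ν, (∑ μ, X p μ * G p μ ν) * (eta ν * Jsf A φ p ν)

/-! ## Integrals over spheres, null hypersurfaces and regions -/
/-- integral over the unit sphere (2-dimensional Hausdorff measure) -/
def sphLInt (f : E3 → ℝ≥0∞) : ℝ≥0∞ := ∫⁻ ω in sphere (0 : E3) 1, f ω ∂ μH[2]
/-- sphere integral of a density on the sphere of radius r at time t -/
def sphI (f : V → ℝ) (t r : ℝ) : ℝ≥0∞ := sphLInt (fun ω => oR (f (pt t r ω)))
/-- ∫_{H_u ∩ {v ≥ v₀}} f dv dω -/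
def lIntH (u v0 : ℝ) (f : V → ℝ) : ℝ≥0∞ := ∫⁻ v in Ici v0, sphI f (u + v) (v - u)
/-- ∫_{H_u ∩ {v₀ ≤ v ≤ v₁}} f dv dω -/
def lIntHseg (u v0 v1 : ℝ) (f : V → ℝ) : ℝ≥0∞ := ∫⁻ v in Icc v0 v1, sphI f (u + v) (v - u)
/-- ∫_{H̲_v ∩ {u₀ ≤ u ≤ u₁}} f du dω -/
def lIntHb (v u0 u1 : ℝ) (f : V → ℝ) : ℝ≥0∞ := ∫⁻ u in Icc u0 u1, sphI f (u + v) (v - u)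
/-- integral over the ball {|x| ≤ R'} at time t -/
def lIntBall (t R' : ℝ) (f : V → ℝ) : ℝ≥0∞ := ∫⁻ x in closedBall (0 : E3) R', oR (f (stp t x))
/-- integral over the annulus {r₀ ≤ |x| ≤ r₁} at time t -/
def lIntAnn (t r0 r1 : ℝ) (f : V → ℝ) : ℝ≥0∞ :=
  ∫⁻ x in {x : E3 | r0 ≤ ‖x‖ ∧ ‖x‖ ≤ r1}, oR (f (stp t x))
/-- integral over {|x| ≥ r₀} at time t -/
def lIntExt (t r0 : ℝ) (f : V → ℝ) : ℝ≥0∞ := ∫⁻ x in {x : E3 | r0 ≤ ‖x‖}, oR (f (stp t x))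
/-- integral over all of ℝ³ -/
def lIntE3 (f : E3 → ℝ) : ℝ≥0∞ := ∫⁻ x, oR (f x)

/-! ## The foliation Σ_τ and the regions -/
/-- the foliation parameter through a point: t in the cylinder {r ≤ R}, 2u+R outside -/
def sigP (R : ℝ) (p : V) : ℝ := if rad p ≤ R then tC p else 2 * uC p + R
def SigmaSet (R τ : ℝ) : Set V := {p | 0 ≤ tC p ∧ sigP R p = τ}
/-- interior region 𝒟_{τ₁}^{τ₂} between Σ_{τ₁} and Σ_{τ₂} -/
def Dint (R τ₁ τ₂ : ℝ) : Set V := {p | 0 ≤ tC p ∧ τ₁ ≤ sigP R p ∧ sigP R p ≤ τ₂}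
/-- 𝒟̄_{τ₁}^{τ₂} = 𝒟_{τ₁}^{τ₂} ∩ {r ≥ R} -/
def DbarInt (R τ₁ τ₂ : ℝ) : Set V := Dint R τ₁ τ₂ ∩ {p | R ≤ rad p}
/-- exterior region 𝒟_{τ₁}^{τ₂} (τ₂ ≤ τ₁ ≤ 0), the Cauchy development of
the annulus {R−τ₁ ≤ |x| ≤ R−τ₂} -/
def Dext (R τ₁ τ₂ : ℝ) : Set V :=
  {p | 0 ≤ tC p ∧ uC p ≤ (τ₁ - R) / 2 ∧ vC p ≤ -((τ₂ - R) / 2)}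
/-- 𝒟_τ : future of Σ_τ (τ ≥ 0), resp. 𝒟_τ^{-∞} (τ < 0) -/
def Dfrom (R τ : ℝ) : Set V :=
  if 0 ≤ τ then {p | 0 ≤ tC p ∧ τ ≤ sigP R p} else {p | 0 ≤ tC p ∧ uC p ≤ (τ - R) / 2}
def DbarFrom (R τ : ℝ) : Set V := Dfrom R τ ∩ {p | R ≤ rad p}
def halfSpace : Set V := {p | 0 ≤ tC p}
def regGe (R : ℝ) : Set V := {p | 0 ≤ tC p ∧ R ≤ rad p}
def regLe (R' : ℝ) : Set V := {p | 0 ≤ tC p ∧ rad p ≤ R'}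

/-- weighted spacetime norm  I^{pw}_{qw}[·](D) = ∫_D u₊^{qw} r₊^{pw} g  (g = squared magnitude) -/
def wI (pw qw : ℝ) (g : V → ℝ) (D : Set V) : ℝ≥0∞ :=
  ∫⁻ x in D, oR (uplus x ^ qw * rplus x ^ pw * g x)

/-- surface integral over Σ_τ with the measures dx (ball part) and r²dv dω (null part) -/
def lIntSigE (R τ : ℝ) (f : V → ℝ) : ℝ≥0∞ :=
  if 0 ≤ τ then lIntBall τ R f + lIntH ((τ - R) / 2) ((τ + R) / 2) (fun p => f p * rad p ^ 2)
  else lIntH ((τ - R) / 2) (-((τ - R) / 2)) (fun p => f p * rad p ^ 2)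
/-- integral over Σ_τ with the measure dv′dω (v′ = v on the null part, r in the cylinder) -/
def lIntSig (R τ : ℝ) (f : V → ℝ) : ℝ≥0∞ :=
  if 0 ≤ τ then (∫⁻ r' in Icc (0 : ℝ) R, sphI f τ r') + lIntH ((τ - R) / 2) ((τ + R) / 2) f
  else lIntH ((τ - R) / 2) (-((τ - R) / 2)) f

/-- the starting value v(u) of H_u (t = 0 in the exterior, r = R in the interior) -/
def vStart (R u : ℝ) : ℝ := if u ≤ -R / 2 then -u else 2 * R + u

/-- exterior region in (u,v,ω) coordinates: double null integral ∬_{𝒟_{τ₁}^{τ₂}} f dv dω du -/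
def lIntExtUV (R τ₁ τ₂ : ℝ) (f : V → ℝ) : ℝ≥0∞ :=
  ∫⁻ u in Icc ((τ₂ - R) / 2) ((τ₁ - R) / 2),
    ∫⁻ v in Icc (-u) (-((τ₂ - R) / 2)), sphI f (u + v) (v - u)

/-! ## Energy fluxes -/
def EphiH (A : V → Fin 4 → ℝ) (φ : V → ℂ) (u v0 : ℝ) : ℝ≥0∞ :=
  lIntH u v0 (fun p => (eDL A φ p + eDslash A φ p) * rad p ^ 2)
def EphiHseg (A : V → Fin 4 → ℝ) (φ : V → ℂ) (u v0 v1 : ℝ) : ℝ≥0∞ :=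
  lIntHseg u v0 v1 (fun p => (eDL A φ p + eDslash A φ p) * rad p ^ 2)
def EphiHb (A : V → Fin 4 → ℝ) (φ : V → ℂ) (v u0 u1 : ℝ) : ℝ≥0∞ :=
  lIntHb v u0 u1 (fun p => (eDLb A φ p + eDslash A φ p) * rad p ^ 2)
/-- energy flux E[φ](Σ_τ) -/
def EphiSig (R : ℝ) (A : V → Fin 4 → ℝ) (φ : V → ℂ) (τ : ℝ) : ℝ≥0∞ :=
  if 0 ≤ τ then lIntBall τ R (eD A φ) + EphiH A φ ((τ - R) / 2) ((τ + R) / 2)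
  else EphiH A φ ((τ - R) / 2) (-((τ - R) / 2))

def EfH (G : V → Fin 4 → Fin 4 → ℝ) (u v0 : ℝ) : ℝ≥0∞ :=
  lIntH u v0 (fun p => (rhoC G p ^ 2 + sigmaSq G p + alphaSq G p) * rad p ^ 2)
def EfHseg (G : V → Fin 4 → Fin 4 → ℝ) (u v0 v1 : ℝ) : ℝ≥0∞ :=
  lIntHseg u v0 v1 (fun p => (rhoC G p ^ 2 + sigmaSq G p + alphaSq G p) * rad p ^ 2)
def EfHb (G : V → Fin 4 → Fin 4 → ℝ) (v u0 u1 : ℝ) : ℝ≥0∞ :=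
  lIntHb v u0 u1 (fun p => (rhoC G p ^ 2 + sigmaSq G p + abarSq G p) * rad p ^ 2)
/-- energy flux E[G](Σ_τ) of a 2-form -/
def EfSig (R : ℝ) (G : V → Fin 4 → Fin 4 → ℝ) (τ : ℝ) : ℝ≥0∞ :=
  if 0 ≤ τ then
    lIntBall τ R (fun p => rhoC G p ^ 2 + sigmaSq G p + (1 / 2) * (alphaSq G p + abarSq G p))
      + EfH G ((τ - R) / 2) ((τ + R) / 2)
  else EfH G ((τ - R) / 2) (-((τ - R) / 2))

/-! ## The commutation vector fields Z = {∂_t, Ω_ij} and Lie derivatives -/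
inductive Gen : Type
  | time : Gen
  | rot : Fin 3 → Fin 3 → Gen
  deriving DecidableEq

instance : Fintype Gen := by
  classical
  exact Fintype.ofSurjective
    (fun x : Option (Fin 3 × Fin 3) => (x.casesOn Gen.time (fun ij => Gen.rot ij.1 ij.2) : Gen))
    (by rintro (_ | ⟨i, j⟩); exacts [⟨none, rfl⟩, ⟨some (i, j), rfl⟩])

/-- the vector field of a generator: ∂_t, resp. Ω_ij = x_i ∂_j − x_j ∂_i -/
def genV : Gen → V → V
  | Gen.time, _ => Pi.single 0 1
  | Gen.rot i j, p => fun μ => (if μ = j.succ then p i.succ else 0) - (if μ = i.succ then p j.succ else 0)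

/-- Lie derivative of a 2-form along X -/
def lie2 (X : V → V) (G : V → Fin 4 → Fin 4 → ℝ) (p : V) (μ ν : Fin 4) : ℝ :=
  fderiv ℝ (fun q => G q μ ν) p (X p)
    + ∑ lam, pd μ (fun q => X q lam) p * G p lam ν
    + ∑ lam, pd ν (fun q => X q lam) p * G p μ lam
/-- Lie derivative of a 1-form along X -/
def lie1 (X : V → V) (J : V → Fin 4 → ℝ) (p : V) (μ : Fin 4) : ℝ :=
  fderiv ℝ (fun q => J q μ) p (X p) + ∑ lam, pd μ (fun q => X q lam) p * J p lam

def lie2Iter : List Gen → (V → Fin 4 → Fin 4 → ℝ) → V → Fin 4 → Fin 4 → ℝ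
  | [], G => G
  | g :: w, G => lie2 (genV g) (lie2Iter w G)
def lie1Iter : List Gen → (V → Fin 4 → ℝ) → V → Fin 4 → ℝ
  | [], J => J
  | g :: w, J => lie1 (genV g) (lie1Iter w J)

/-- covariant derivative D_Z along a generator -/
def covDZ (A : V → Fin 4 → ℝ) (g : Gen) (φ : V → ℂ) (p : V) : ℂ := dirD A (genV g p) φ p
def covDZIter (A : V → Fin 4 → ℝ) : List Gen → (V → ℂ) → V → ℂ
  | [], φ => φ
  | g :: w, φ => covDZ A g (covDZIter A w φ)

/-! ## Charge and the chargeless part -/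
def esingle (j : Fin 3) : E3 := EuclideanSpace.single j 1
/-- total charge q₀ = (1/4π) ∫ div E dx computed at t = 0 -/
def charge (G : V → Fin 4 → Fin 4 → ℝ) : ℝ :=
  (1 / (4 * Real.pi)) *
    ∫ x : E3, ∑ i : Fin 3, fderiv ℝ (fun y => G (stp 0 y) 0 i.succ) x (esingle i)
/-- the 2-form dt ∧ dr -/
def dtdr (p : V) (μ ν : Fin 4) : ℝ :=
  (if μ = 0 then 1 else 0) * (if ν = 0 then 0 else p ν / rad p)
    - (if ν = 0 then 1 else 0) * (if μ = 0 then 0 else p μ / rad p)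
/-- the chargeless part F̄ = F − χ_{{r ≥ t+R}} q₀ r^{-2} dt∧dr -/
def Fbar (R q0 : ℝ) (G : V → Fin 4 → Fin 4 → ℝ) (p : V) (μ ν : Fin 4) : ℝ :=
  G p μ ν - (if tC p + R ≤ rad p then q0 / rad p ^ 2 else 0) * dtdr p μ ν

/-! ## The norms m_k, E₀^k, M_k of the Maxwell data and current -/
def twoSqAll (G : V → Fin 4 → Fin 4 → ℝ) (p : V) : ℝ := ∑ μ, ∑ ν, (G p μ ν) ^ 2
/-- |∇J|² (spatial gradient of a 1-form) -/
def grad3Sq1 (J : V → Fin 4 → ℝ) (p : V) : ℝ :=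
  ∑ i : Fin 3, ∑ μ, (pd i.succ (fun q => J q μ) p) ^ 2
def JdensL (J : V → Fin 4 → ℝ) (p : V) : ℝ := (ap1 J (Lv p) p) ^ 2
def JdensLb (J : V → Fin 4 → ℝ) (p : V) : ℝ := (ap1 J (Lbv p) p) ^ 2
def JdensMix (J : V → Fin 4 → ℝ) (p : V) : ℝ :=
  (Real.sqrt (JslashSq J p) + |ap1 J (Lv p) p|) ^ 2

/-- the quantity m_k measuring the current J -/
def mFn (R γ₀ ε : ℝ) (J : V → Fin 4 → ℝ) (q0 : ℝ) (k : ℕ) : ℝ≥0∞ :=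
  (∑ l ∈ Finset.range (k + 1), ∑ w : Fin l → Gen,
      (wI (1 + γ₀) (1 + ε) (JslashSq (lie1Iter (List.ofFn w) J)) (regGe R)
        + wI (2 + γ₀) 0 (JdensL (lie1Iter (List.ofFn w) J)) (regGe R)
        + wI (1 + ε) (1 + γ₀) (JdensMix (lie1Iter (List.ofFn w) J)) halfSpace
        + wI (1 - ε) (1 + γ₀ + 2 * ε) (JdensLb (lie1Iter (List.ofFn w) J)) halfSpace))
  + (∑ l ∈ Finset.range k, ∑ w : Fin l → Gen,
      wI 0 (1 + γ₀) (grad3Sq1 (lie1Iter (List.ofFn w) J)) (regLe (2 * R)))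
  + oR |q0| * ⨆ (τ : ℝ) (_ : τ ≤ 0), oR (taupl τ ^ (1 + γ₀)) *
      ∫⁻ p in Dfrom R τ, oR (|ap1 J (Lbv p) p| / rad p ^ 2)

/-- weighted initial energy E₀^k[G] of a 2-form -/
def E0F (γ₀ : ℝ) (G : V → Fin 4 → Fin 4 → ℝ) (k : ℕ) : ℝ≥0∞ :=
  ∑ l ∈ Finset.range (k + 1), ∑ w : Fin l → Gen,
    lIntE3 (fun x => (1 + ‖x‖) ^ (1 + γ₀) * twoSqAll (lie2Iter (List.ofFn w) G) (stp 0 x))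

/-- M_k = m_k + E₀^k[F̄] + 1 + |q₀| for the Maxwell field G with current δG -/
def MFn (R γ₀ ε : ℝ) (G : V → Fin 4 → Fin 4 → ℝ) (k : ℕ) : ℝ≥0∞ :=
  mFn R γ₀ ε (fun p μ => divSnd G p μ) (charge G) k
    + E0F γ₀ (Fbar R (charge G) G) k + 1 + oR |charge G|

/-! ## The norms E₀^k[φ], 𝓔_k[φ] of the scalar field -/
def E0phi (γ₀ : ℝ) (A : V → Fin 4 → ℝ) (φ : V → ℂ) (k : ℕ) : ℝ≥0∞ :=
  ∑ l ∈ Finset.range (k + 1), ∑ w : Fin l → Gen, ∑ j : Fin 3,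
    lIntE3 (fun x =>
      (1 + ‖x‖) ^ (1 + γ₀) * ‖covDZIter A (List.ofFn w) (covD A j.succ φ) (stp 0 x)‖ ^ 2)

def calE (γ₀ ε : ℝ) (A : V → Fin 4 → ℝ) (φ : V → ℂ) (k : ℕ) : ℝ≥0∞ :=
  E0phi γ₀ A φ k
    + ∑ l ∈ Finset.range (k + 1), ∑ w : Fin l → Gen,
        (wI (1 + γ₀) (1 + ε) (fun p => ‖covDZIter A (List.ofFn w) (boxA A φ) p‖ ^ 2) halfSpace
          + wI (1 + ε) (1 + γ₀) (fun p => ‖covDZIter A (List.ofFn w) (boxA A φ) p‖ ^ 2) halfSpace)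

/-! ## Mixed L_u²L_v^∞L_ω² and L_v²L_u^∞L_ω² norms on 𝒟̄_τ -/
def mixULV (R τ : ℝ) (f : V → ℝ) : ℝ≥0∞ :=
  if 0 ≤ τ then
    ∫⁻ u in Ici ((τ - R) / 2), ⨆ v ∈ Ici (u + R), sphI (fun p => f p ^ 2) (u + v) (v - u)
  else
    ∫⁻ u in Iic ((τ - R) / 2), ⨆ v ∈ Ici (-u), sphI (fun p => f p ^ 2) (u + v) (v - u)
def mixVLU (R τ : ℝ) (f : V → ℝ) : ℝ≥0∞ :=
  if 0 ≤ τ then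
    ∫⁻ v in Ici ((τ + R) / 2),
      ⨆ u ∈ Icc ((τ - R) / 2) (v - R), sphI (fun p => f p ^ 2) (u + v) (v - u)
  else
    ∫⁻ v in Ici (-((τ - R) / 2)),
      ⨆ u ∈ Icc (-v) ((τ - R) / 2), sphI (fun p => f p ^ 2) (u + v) (v - u)

/-! ## Asymptotic vanishing conditions -/
def vanishNullInf (φ : V → ℂ) : Prop :=
  ∀ u : ℝ, ∀ ω : E3, ‖ω‖ = 1 →
    Filter.Tendsto (fun v => φ (pt (u + v) (v - u) ω)) Filter.atTop (nhds 0)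
def vanishSpatialInf (φ : V → ℂ) : Prop :=
  ∀ ω : E3, ‖ω‖ = 1 → Filter.Tendsto (fun r => φ (pt 0 r ω)) Filter.atTop (nhds 0)

/-! ## Structural properties -/
def AntiSym (G : V → Fin 4 → Fin 4 → ℝ) : Prop := ∀ p μ ν, G p μ ν = -G p ν μ
def Bianchi (G : V → Fin 4 → Fin 4 → ℝ) : Prop :=
  ∀ (p : V) (γ' μ ν : Fin 4),
    pd γ' (fun q => G q μ ν) p + pd μ (fun q => G q ν γ') p + pd ν (fun q => G q γ' μ) p = 0
def Smooth2Form (G : V → Fin 4 → Fin 4 → ℝ) : Prop := ∀ μ ν, ContDiff ℝ (⊤ : ℕ∞) (fun p => G p μ ν)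

/-! ## Initial data (for the Cauchy problem) -/
def pd3 (j : Fin 3) (f : E3 → ℝ) (x : E3) : ℝ := fderiv ℝ f x (esingle j)
def pd3C (j : Fin 3) (f : E3 → ℂ) (x : E3) : ℂ := fderiv ℝ f x (esingle j)
/-- rotation Ω_ij acting on a scalar -/
def rotSc (i j : Fin 3) (f : E3 → ℝ) (x : E3) : ℝ := x i * pd3 j f x - x j * pd3 i f x
def rotScC (i j : Fin 3) (f : E3 → ℂ) (x : E3) : ℂ :=
  (x i : ℂ) * pd3C j f x - (x j : ℂ) * pd3C i f x
/-- rotation Ω_ij acting on a vector field (Lie derivative) -/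
def rotVF (i j : Fin 3) (W : E3 → Fin 3 → ℝ) (x : E3) (k : Fin 3) : ℝ :=
  rotSc i j (fun y => W y k) x - ((if k = j then W x i else 0) - (if k = i then W x j else 0))

abbrev Gen3 : Type := Fin 3 × Fin 3

def rotScIter : List Gen3 → (E3 → ℝ) → E3 → ℝ
  | [], f => f
  | g :: w, f => rotSc g.1 g.2 (rotScIter w f)
def rotScCIter : List Gen3 → (E3 → ℂ) → E3 → ℂ
  | [], f => f
  | g :: w, f => rotScC g.1 g.2 (rotScCIter w f)
def rotVFIter : List Gen3 → (E3 → Fin 3 → ℝ) → E3 → Fin 3 → ℝ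
  | [], W => W
  | g :: w, W => rotVF g.1 g.2 (rotVFIter w W)
def pd3Iter : List (Fin 3) → (E3 → ℝ) → E3 → ℝ
  | [], f => f
  | j :: w, f => pd3 j (pd3Iter w f)
def pd3CIter : List (Fin 3) → (E3 → ℂ) → E3 → ℂ
  | [], f => f
  | j :: w, f => pd3C j (pd3CIter w f)
def pd3VFIter (w : List (Fin 3)) (W : E3 → Fin 3 → ℝ) (x : E3) (k : Fin 3) : ℝ :=
  pd3Iter w (fun y => W y k) x

/-- the weighted Sobolev norm 𝓜 of the Maxwell initial data (E^{df}, H) -/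
def calM (γ₀ : ℝ) (Edf Hd : E3 → Fin 3 → ℝ) : ℝ≥0∞ :=
  ∑ l ∈ Finset.range 3,
    ((∑ w : Fin l → Gen3, lIntE3 (fun x => (1 + ‖x‖) ^ (1 + γ₀) *
        ((∑ k : Fin 3, (rotVFIter (List.ofFn w) Edf x k) ^ 2)
          + ∑ k : Fin 3, (rotVFIter (List.ofFn w) Hd x k) ^ 2)))
      + ∑ w : Fin l → Fin 3, lIntE3 (fun x => (1 + ‖x‖) ^ (1 + γ₀) *
        ((∑ k : Fin 3, (pd3VFIter (List.ofFn w) Edf x k) ^ 2)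
          + ∑ k : Fin 3, (pd3VFIter (List.ofFn w) Hd x k) ^ 2)))

/-- the weighted Sobolev norm 𝓔 of the scalar initial data (φ₀, φ₁) -/
def calEdata (γ₀ : ℝ) (φ₀ φ₁ : E3 → ℂ) : ℝ≥0∞ :=
  ∑ l ∈ Finset.range 3,
    ((∑ w : Fin l → Gen3, lIntE3 (fun x => (1 + ‖x‖) ^ (1 + γ₀) *
        ((∑ j : Fin 3, ‖pd3C j (rotScCIter (List.ofFn w) φ₀) x‖ ^ 2)
          + ‖rotScCIter (List.ofFn w) φ₁ x‖ ^ 2)))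
      + (∑ w : Fin (l + 1) → Fin 3,
          lIntE3 (fun x => (1 + ‖x‖) ^ (1 + γ₀) * ‖pd3CIter (List.ofFn w) φ₀ x‖ ^ 2))
      + (∑ w : Fin l → Fin 3,
          lIntE3 (fun x => (1 + ‖x‖) ^ (1 + γ₀) * ‖pd3CIter (List.ofFn w) φ₁ x‖ ^ 2))
      + lIntE3 (fun x => (1 + ‖x‖) ^ (1 + γ₀) * ‖φ₀ x‖ ^ 2))

/-- the Maxwell–Klein–Gordon equations (for t ≥ 0) -/
def IsMKG (A : V → Fin 4 → ℝ) (φ : V → ℂ) : Prop :=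
  ∀ p : V, 0 ≤ tC p →
    (∀ μ, divSnd (curv A) p μ = Jsf A φ p μ) ∧ boxA A φ p = 0

/-- the solution attains the initial data (E, H, φ₀, φ₁) -/
def InitData (A : V → Fin 4 → ℝ) (φ : V → ℂ) (Ed Hd : E3 → Fin 3 → ℝ)
    (φ₀ φ₁ : E3 → ℂ) : Prop :=
  (∀ (x : E3) (i : Fin 3), curv A (stp 0 x) 0 i.succ = Ed x i)
    ∧ (∀ x : E3, curv A (stp 0 x) 2 3 = Hd x 0 ∧ curv A (stp 0 x) 3 1 = Hd x 1
        ∧ curv A (stp 0 x) 1 2 = Hd x 2)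
    ∧ (∀ x : E3, φ (stp 0 x) = φ₀ x) ∧ (∀ x : E3, covD A 0 φ (stp 0 x) = φ₁ x)

/-- the compatibility (constraint) conditions -/
def Admissible (Ed Hd : E3 → Fin 3 → ℝ) (φ₀ φ₁ : E3 → ℂ) : Prop :=
  (∀ x : E3, (∑ i : Fin 3, pd3 i (fun y => Ed y i) x) = (φ₀ x * (starRingEnd ℂ) (φ₁ x)).im)
    ∧ (∀ x : E3, (∑ i : Fin 3, pd3 i (fun y => Hd y i) x) = 0)

end MKG

namespace MKG

/-! ### Differentiation under the integral sign -/

theorem hasDerivAt_setIntegral_of_isCompact {X : Type*} [TopologicalSpace X] [MeasurableSpace X]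
    [BorelSpace X] [SecondCountableTopology X] [T2Space X] {μ : Measure X}
    [IsFiniteMeasureOnCompacts μ] {K : Set X} (hK : IsCompact K) {a a' : ℝ → X → ℝ}
    (ha : Continuous fun z : ℝ × X => a z.1 z.2) (ha' : Continuous fun z : ℝ × X => a' z.1 z.2)
    (h : ∀ t x, HasDerivAt (fun s => a s x) (a' t x) t) (t : ℝ) :
    HasDerivAt (fun s => ∫ x in K, a s x ∂μ) (∫ x in K, a' t x ∂μ) t := by
  obtain ⟨C, hC⟩ := (((isCompact_closedBall t 1).prod hK).bddAbove_image
    (ha'.norm.continuousOn))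
  have hfin : IsFiniteMeasure (μ.restrict K) := ⟨by simpa using hK.measure_lt_top⟩
  have hsec : ∀ s, Continuous (a s) := fun s => ha.comp (by fun_prop : Continuous fun x => (s, x))
  have hsec' : Continuous (a' t) := ha'.comp (by fun_prop : Continuous fun x => (t, x))
  refine (hasDerivAt_integral_of_dominated_loc_of_deriv_le (bound := fun _ => C)
    (ball_mem_nhds t one_pos) (.of_forall fun s => (hsec s).aestronglyMeasurable)
    ((hsec t).continuousOn.integrableOn_compact hK) hsec'.aestronglyMeasurable ?_
    (integrable_const C) (.of_forall fun x s _ => h s x)).2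
  filter_upwards [ae_restrict_mem hK.measurableSet] with x hx s hs
  exact hC ⟨(s, x), ⟨ball_subset_closedBall hs, hx⟩, rfl⟩

theorem hasDerivAt_intervalIntegral_of_continuous {a a' : ℝ → ℝ → ℝ}
    (ha : Continuous fun z : ℝ × ℝ => a z.1 z.2) (ha' : Continuous fun z : ℝ × ℝ => a' z.1 z.2)
    (h : ∀ t r, HasDerivAt (fun s => a s r) (a' t r) t) (r₁ r₂ t : ℝ) :
    HasDerivAt (fun s => ∫ r in r₁..r₂, a s r) (∫ r in r₁..r₂, a' t r) t := by
  have key : ∀ x y : ℝ, x ≤ y →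
      HasDerivAt (fun s => ∫ r in x..y, a s r) (∫ r in x..y, a' t r) t := by
    intro x y hxy
    simp only [intervalIntegral.integral_of_le hxy, ← integral_Icc_eq_integral_Ioc]
    exact hasDerivAt_setIntegral_of_isCompact isCompact_Icc ha ha' h t
  rcases le_total r₁ r₂ with hr | hr
  · exact key _ _ hr
  · simp only [intervalIntegral.integral_symm r₂ r₁]
    exact (key _ _ hr).neg

theorem hasDerivAt_integral_moving_endpoint {a a' : ℝ → ℝ → ℝ}
    (ha : Continuous fun z : ℝ × ℝ => a z.1 z.2) (ha' : Continuous fun z : ℝ × ℝ => a' z.1 z.2)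
    (h : ∀ t r, HasDerivAt (fun s => a s r) (a' t r) t) {ρ : ℝ → ℝ} {ρ' t : ℝ}
    (hρ : HasDerivAt ρ ρ' t) :
    HasDerivAt (fun s => ∫ r in (0 : ℝ)..ρ s, a s r)
      ((∫ r in (0 : ℝ)..ρ t, a' t r) + ρ' * a t (ρ t)) t := by
  have hpr : Continuous fun z : ℝ × ℝ => ∫ r in (0 : ℝ)..z.2, a' z.1 r :=
    intervalIntegral.continuous_parametric_primitive_of_continuous (f := a') ha'
  have hd := hasStrictFDerivAt_uncurry_coprod (𝕜 := ℝ) (u := (t, ρ t))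
    (f := fun s q => ∫ r in (0 : ℝ)..q, a s r)
    (f₁ := fun s q => ContinuousLinearMap.toSpanSingleton ℝ (∫ r in (0 : ℝ)..q, a' s r))
    (f₂ := fun s q => ContinuousLinearMap.toSpanSingleton ℝ (a s q))
    (.of_forall fun v =>
      (hasDerivAt_intervalIntegral_of_continuous ha ha' h 0 v.2 v.1).hasFDerivAt)
    (.of_forall fun v => by
      have hc : Continuous (a v.1) := ha.comp (by fun_prop : Continuous fun x => (v.1, x))
      exact (intervalIntegral.integral_hasDerivAt_right (hc.intervalIntegrable _ _)
        (hc.stronglyMeasurableAtFilter _ _) hc.continuousAt).hasFDerivAt)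
    (by
      refine Continuous.continuousAt ?_
      exact (ContinuousLinearMap.toSpanSingletonCLE (𝕜 := ℝ) (E := ℝ)).continuous.comp hpr)
    (by
      refine Continuous.continuousAt ?_
      exact (ContinuousLinearMap.toSpanSingletonCLE (𝕜 := ℝ) (E := ℝ)).continuous.comp ha)
  have := hd.hasFDerivAt.comp_hasDerivAt t ((hasDerivAt_id t).prodMk hρ)
  refine this.congr_deriv ?_
  change (1 : ℝ) • (∫ r in (0 : ℝ)..ρ t, a' t r) + ρ' • a t (ρ t) = _
  simp

/-- Divergence theorem for a planar vector field on a region bounded by two moving endpoints. -/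
theorem integral_divergence_moving {a a' b b' : ℝ → ℝ → ℝ}
    (ha : Continuous fun z : ℝ × ℝ => a z.1 z.2) (ha' : Continuous fun z : ℝ × ℝ => a' z.1 z.2)
    (hb : Continuous fun z : ℝ × ℝ => b z.1 z.2) (hb' : Continuous fun z : ℝ × ℝ => b' z.1 z.2)
    (h : ∀ t r, HasDerivAt (fun s => a s r) (a' t r) t)
    (hd : ∀ t r, HasDerivAt (fun s => b t s) (b' t r) r)
    {ρ₁ ρ₂ : ℝ → ℝ} {β₁ β₂ : ℝ} (h₁ : ∀ t, HasDerivAt ρ₁ β₁ t) (h₂ : ∀ t, HasDerivAt ρ₂ β₂ t)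
    (t₀ t₁ : ℝ) :
    (∫ r in ρ₁ t₁..ρ₂ t₁, a t₁ r) - (∫ r in ρ₁ t₀..ρ₂ t₀, a t₀ r)
      = (∫ t in t₀..t₁, ∫ r in ρ₁ t..ρ₂ t, (a' t r + b' t r))
        + (∫ t in t₀..t₁, (β₂ * a t (ρ₂ t) - b t (ρ₂ t)))
        - ∫ t in t₀..t₁, (β₁ * a t (ρ₁ t) - b t (ρ₁ t)) := by
  have c₁ : Continuous ρ₁ := continuous_iff_continuousAt.2 fun t => (h₁ t).continuousAt
  have c₂ : Continuous ρ₂ := continuous_iff_continuousAt.2 fun t => (h₂ t).continuousAt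
  have sec : ∀ {f : ℝ → ℝ → ℝ}, (Continuous fun z : ℝ × ℝ => f z.1 z.2) → ∀ t, Continuous (f t) :=
    fun hf t => hf.comp (by fun_prop : Continuous fun x => (t, x))
  have split : ∀ {f : ℝ → ℝ → ℝ}, (Continuous fun z : ℝ × ℝ => f z.1 z.2) → ∀ t x y,
      ∫ r in x..y, f t r = (∫ r in (0 : ℝ)..y, f t r) - ∫ r in (0 : ℝ)..x, f t r := fun hf t x y =>
    (intervalIntegral.integral_interval_sub_left ((sec hf t).intervalIntegrable _ _)
      ((sec hf t).intervalIntegrable _ _)).symm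
  have hab : Continuous fun z : ℝ × ℝ => a' z.1 z.2 + b' z.1 z.2 := ha'.add hb'
  have cmov : ∀ {f : ℝ → ℝ → ℝ}, (Continuous fun z : ℝ × ℝ => f z.1 z.2) → ∀ {ρ : ℝ → ℝ},
      Continuous ρ → Continuous fun t => ∫ r in (0 : ℝ)..ρ t, f t r := fun {f} hf {ρ} hρ =>
    intervalIntegral.continuous_parametric_intervalIntegral_of_continuous (f := f) hf hρ
  have hderiv : ∀ t, HasDerivAt (fun s => ∫ r in ρ₁ s..ρ₂ s, a s r)
      ((∫ r in ρ₁ t..ρ₂ t, (a' t r + b' t r)) + (β₂ * a t (ρ₂ t) - b t (ρ₂ t))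
        - (β₁ * a t (ρ₁ t) - b t (ρ₁ t))) t := by
    intro t
    have e := (hasDerivAt_integral_moving_endpoint ha ha' h (h₂ t)).sub
      (hasDerivAt_integral_moving_endpoint ha ha' h (h₁ t))
    have hbint : ∫ r in ρ₁ t..ρ₂ t, b' t r = b t (ρ₂ t) - b t (ρ₁ t) :=
      intervalIntegral.integral_eq_sub_of_hasDerivAt (fun r _ => hd t r)
        ((sec hb' t).intervalIntegrable _ _)
    have : (fun s => ∫ r in ρ₁ s..ρ₂ s, a s r) = fun s =>
      (∫ r in (0 : ℝ)..ρ₂ s, a s r) - ∫ r in (0 : ℝ)..ρ₁ s, a s r := funext fun s => split ha s _ _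
    rw [this]
    refine e.congr_deriv ?_
    rw [intervalIntegral.integral_add ((sec ha' t).intervalIntegrable _ _)
      ((sec hb' t).intervalIntegrable _ _), hbint, split ha' t (ρ₁ t) (ρ₂ t)]
    ring
  have k₀ : Continuous fun t => ∫ r in ρ₁ t..ρ₂ t, (a' t r + b' t r) := by
    have : (fun s => ∫ r in ρ₁ s..ρ₂ s, (a' s r + b' s r)) = fun s =>
      (∫ r in (0 : ℝ)..ρ₂ s, (a' s r + b' s r)) - ∫ r in (0 : ℝ)..ρ₁ s, (a' s r + b' s r) :=
        funext fun s => split (f := fun t r => a' t r + b' t r) hab s _ _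
    rw [this]
    exact (cmov (f := fun t r => a' t r + b' t r) hab c₂).sub
      (cmov (f := fun t r => a' t r + b' t r) hab c₁)
  have kb : ∀ {β : ℝ} {ρ : ℝ → ℝ}, Continuous ρ →
      Continuous fun t => β * a t (ρ t) - b t (ρ t) := fun {β ρ} hρ =>
    (continuous_const.mul (ha.comp (by fun_prop : Continuous fun t => (t, ρ t)))).sub
      (hb.comp (by fun_prop : Continuous fun t => (t, ρ t)))
  have k₁ := kb (β := β₁) c₁
  have k₂ := kb (β := β₂) c₂
  have k₀₂ : Continuous fun t => (∫ r in ρ₁ t..ρ₂ t, (a' t r + b' t r))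
      + (β₂ * a t (ρ₂ t) - b t (ρ₂ t)) := k₀.add k₂
  rw [← intervalIntegral.integral_eq_sub_of_hasDerivAt (fun t _ => hderiv t)
    ((k₀₂.sub k₁).intervalIntegrable _ _),
    intervalIntegral.integral_sub (k₀₂.intervalIntegrable _ _) (k₁.intervalIntegrable _ _),
    intervalIntegral.integral_add (k₀.intervalIntegrable _ _) (k₂.intervalIntegrable _ _)]

/-! ### The surface measure of the unit sphere -/

section SphereMeasure

open scoped Pointwise NNReal

/-- The surface measure of the unit sphere of `ℝ³` induced by Lebesgue measure, as a measure on
`ℝ³`. -/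
def sphM : Measure E3 := (volume : Measure E3).toSphere.map Subtype.val

instance : IsFiniteMeasure sphM := by unfold sphM; infer_instance

theorem sphM_apply {s : Set E3} (hs : MeasurableSet s) :
    sphM s = 3 * volume (Ioo (0 : ℝ) 1 • (sphere (0 : E3) 1 ∩ s)) := by
  rw [sphM, Measure.map_apply measurable_subtype_coe hs,
    Measure.toSphere_apply' _ (measurable_subtype_coe hs), Subtype.image_preimage_coe]
  simp

theorem ae_sphM : ∀ᵐ ω ∂sphM, ω ∈ sphere (0 : E3) 1 := by
  rw [ae_iff]
  change sphM (sphere (0 : E3) 1)ᶜ = 0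
  rw [sphM_apply isClosed_sphere.measurableSet.compl]
  simp

theorem sphM_restrict : sphM.restrict (sphere (0 : E3) 1) = sphM :=
  Measure.restrict_eq_self_of_ae_mem ae_sphM

theorem sphM_map (e : E3 ≃ₗᵢ[ℝ] E3) : sphM.map e = sphM := by
  ext s hs
  have he : Measurable e := e.continuous.measurable
  rw [Measure.map_apply he hs, sphM_apply (he hs), sphM_apply hs]
  congr 1
  conv_rhs => rw [← e.measurePreserving.measure_preimage_emb e.toHomeomorph.measurableEmbedding]
  congr 1
  ext x
  simp only [Set.mem_smul, mem_inter_iff, mem_preimage, mem_sphere_zero_iff_norm]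
  constructor
  · rintro ⟨r, hr, y, ⟨hy, hys⟩, rfl⟩
    exact ⟨r, hr, e y, ⟨by simpa using hy, hys⟩, by simp⟩
  · rintro ⟨r, hr, y, ⟨hy, hys⟩, hx⟩
    refine ⟨r, hr, e.symm y, ⟨by simpa using hy, by simpa using hys⟩, ?_⟩
    apply e.injective
    simpa using hx

theorem lintegral_polar {f : E3 → ℝ≥0∞} (hf : Measurable f) :
    ∫⁻ x, f x = ∫⁻ r in Ioi (0 : ℝ), ENNReal.ofReal (r ^ 2) * ∫⁻ ω, f (r • ω) ∂sphM := by
  have h0 : MeasurableSet ({0}ᶜ : Set E3) := (measurableSet_singleton 0).compl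
  have h1 : ∫⁻ x, f x = ∫⁻ x : ({0}ᶜ : Set E3), f x ∂((volume : Measure E3).comap (↑)) := by
    rw [lintegral_subtype_comap h0, MeasureTheory.restrict_compl_singleton]
  have h2 := (volume : Measure E3).measurePreserving_homeomorphUnitSphereProd
  have h3 : ∫⁻ x : ({0}ᶜ : Set E3), f x ∂((volume : Measure E3).comap (↑))
      = ∫⁻ y, f (y.2.1 • y.1.1) ∂((volume : Measure E3).toSphere.prod (.volumeIoiPow 2)) := by
    have := h2.lintegral_comp_emb (Homeomorph.measurableEmbedding _)
      (fun y : sphere (0 : E3) 1 × Ioi (0 : ℝ) => f (y.2.1 • y.1.1))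
    simp only [finrank_euclideanSpace, Fintype.card_fin] at this
    rw [← this]
    refine lintegral_congr fun x => ?_
    congr 1
    simp only [homeomorphUnitSphereProd_apply_snd_coe, homeomorphUnitSphereProd_apply_fst_coe]
    rw [smul_smul, mul_inv_cancel₀ (norm_ne_zero_iff.2 x.2), one_smul]
  have hm : Measurable fun y : sphere (0 : E3) 1 × Ioi (0 : ℝ) => f (y.2.1 • y.1.1) := by
    fun_prop
  rw [h1, h3, lintegral_prod_symm' _ hm, Measure.volumeIoiPow,
    lintegral_withDensity_eq_lintegral_mul _ (by fun_prop) hm.lintegral_prod_left']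
  have h4 := lintegral_subtype_comap (μ := (volume : Measure ℝ)) (measurableSet_Ioi (a := (0 : ℝ)))
    (fun r => ENNReal.ofReal (r ^ 2) * ∫⁻ ω, f (r • ω) ∂sphM)
  rw [← h4]
  refine lintegral_congr fun r => ?_
  simp only [Pi.mul_apply]
  congr 1
  rw [sphM, lintegral_map (by fun_prop) measurable_subtype_coe]

/-! ### Comparison with the Hausdorff measure -/

/-- The part of the sphere on which gnomonic coordinates are used. -/
def gnomonicPatch : Set E3 := sphere (0 : E3) 1 ∩ {ω | 1 / 2 ≤ ω 0}

/-- Gnomonic coordinates. -/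
def gnomonic (ω : E3) : Fin 2 → ℝ := fun i => ω i.succ / ω 0

/-- The affine lift inverse to gnomonic coordinates before normalisation. -/
def gnomonicLift (a : Fin 2 → ℝ) : E3 := !₂[1, a 0, a 1]

/-- The inverse of gnomonic coordinates. -/
def gnomonicInv (a : Fin 2 → ℝ) : E3 := ‖gnomonicLift a‖⁻¹ • gnomonicLift a

theorem one_le_norm_gnomonicLift (a : Fin 2 → ℝ) : 1 ≤ ‖gnomonicLift a‖ := by
  have := PiLp.norm_apply_le (gnomonicLift a) 0
  simpa [gnomonicLift] using this

theorem gnomonicLift_gnomonic {ω : E3} (h : ω 0 ≠ 0) :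
    gnomonicLift (gnomonic ω) = (ω 0)⁻¹ • ω := by
  ext i
  fin_cases i <;> simp [gnomonicLift, gnomonic, h, div_eq_inv_mul]

theorem gnomonicInv_gnomonic {ω : E3} (hω : ω ∈ gnomonicPatch) :
    gnomonicInv (gnomonic ω) = ω := by
  have h0 : 0 < ω 0 := by have := hω.2; simp only [mem_ofPred_eq] at this; linarith
  have h1 : ‖ω‖ = 1 := by simpa using hω.1
  rw [gnomonicInv, gnomonicLift_gnomonic h0.ne', norm_smul, h1, smul_smul]
  simp [abs_of_pos h0, h0.ne']

theorem gnomonic_gnomonicInv (a : Fin 2 → ℝ) : gnomonic (gnomonicInv a) = a := by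
  have h := (zero_lt_one.trans_le (one_le_norm_gnomonicLift a)).ne'
  ext i
  fin_cases i <;> simp [gnomonic, gnomonicInv, gnomonicLift] <;> field_simp

theorem gnomonic_lipschitz : LipschitzOnWith 8 gnomonic gnomonicPatch := by
  refine LipschitzOnWith.of_dist_le_mul fun x hx y hy => ?_
  rw [dist_pi_le_iff (by positivity)]
  intro i
  have hx0 : 1 / 2 ≤ x 0 := hx.2
  have hy0 : 1 / 2 ≤ y 0 := hy.2
  have hx1 : ‖x‖ = 1 := by simpa using hx.1
  have hy1 : ‖y‖ = 1 := by simpa using hy.1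
  have a1 : |x i.succ| ≤ 1 := by simpa [hx1] using PiLp.norm_apply_le x i.succ
  have a2 : |x 0| ≤ 1 := by simpa [hx1] using PiLp.norm_apply_le x 0
  have a3 : |x 0 - y 0| ≤ dist x y := by simpa [dist_eq_norm] using PiLp.norm_apply_le (x - y) 0
  have a4 : |x i.succ - y i.succ| ≤ dist x y := by
    simpa [dist_eq_norm] using PiLp.norm_apply_le (x - y) i.succ
  have hq : (1 : ℝ) / 4 ≤ x 0 * y 0 := by nlinarith
  rw [gnomonic, gnomonic, Real.dist_eq, div_sub_div _ _ (by linarith) (by linarith), abs_div,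
    div_le_iff₀ (by rw [abs_of_pos] <;> linarith), abs_of_pos (by linarith : 0 < x 0 * y 0)]
  have : |x i.succ * y 0 - x 0 * y i.succ| ≤ 2 * dist x y := by
    have e : x i.succ * y 0 - x 0 * y i.succ
      = x 0 * (x i.succ - y i.succ) - x i.succ * (x 0 - y 0) := by ring
    rw [e]
    refine (abs_sub _ _).trans ?_
    rw [abs_mul, abs_mul]
    have := mul_le_mul a2 a4 (abs_nonneg _) zero_le_one
    have := mul_le_mul a1 a3 (abs_nonneg _) zero_le_one
    linarith
  have := mul_le_mul_of_nonneg_left hq (dist_nonneg (x := x) (y := y))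
  norm_num
  linarith

theorem gnomonicInv_lipschitz : LipschitzWith 4 gnomonicInv := by
  refine LipschitzWith.of_dist_le_mul fun a b => ?_
  have ha := one_le_norm_gnomonicLift a
  have hb := one_le_norm_gnomonicLift b
  set x := gnomonicLift a with hx
  set y := gnomonicLift b with hy
  have hxy : ‖x - y‖ ≤ 2 * dist a b := by
    have h0 : |a 0 - b 0| ≤ dist a b := by simpa [Real.dist_eq] using dist_le_pi_dist a b 0
    have h1 : |a 1 - b 1| ≤ dist a b := by simpa [Real.dist_eq] using dist_le_pi_dist a b 1
    rw [EuclideanSpace.norm_eq, Real.sqrt_le_left (by positivity)]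
    simp only [Fin.sum_univ_three, hx, hy, gnomonicLift]
    simp
    nlinarith [abs_le.1 h0, abs_le.1 h1, sq_le_sq' (abs_le.1 h0).1 (abs_le.1 h0).2,
      sq_le_sq' (abs_le.1 h1).1 (abs_le.1 h1).2, dist_nonneg (x := a) (y := b)]
  have e : ‖x‖⁻¹ • x - ‖y‖⁻¹ • y = ‖x‖⁻¹ • (x - y) + (‖x‖⁻¹ * (‖y‖ - ‖x‖) * ‖y‖⁻¹) • y := by
    rw [smul_sub]
    have : ‖x‖⁻¹ * (‖y‖ - ‖x‖) * ‖y‖⁻¹ = ‖x‖⁻¹ - ‖y‖⁻¹ := by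
      have : ‖x‖ ≠ 0 := by linarith
      have : ‖y‖ ≠ 0 := by linarith
      field_simp
    rw [this, sub_smul]
    abel
  have hi : ‖x‖⁻¹ ≤ 1 := inv_le_one_of_one_le₀ ha
  rw [dist_eq_norm]
  change ‖‖x‖⁻¹ • x - ‖y‖⁻¹ • y‖ ≤ _
  rw [e]
  refine (norm_add_le _ _).trans ?_
  have t1 : ‖‖x‖⁻¹ • (x - y)‖ ≤ ‖x - y‖ := by
    rw [norm_smul, norm_inv, norm_norm]
    exact mul_le_of_le_one_left (norm_nonneg _) hi
  have t2 : ‖(‖x‖⁻¹ * (‖y‖ - ‖x‖) * ‖y‖⁻¹) • y‖ ≤ ‖x - y‖ := by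
    rw [norm_smul, norm_mul, norm_mul, norm_inv, norm_norm, norm_inv, norm_norm, mul_assoc,
      inv_mul_cancel₀ (by linarith), mul_one, Real.norm_eq_abs]
    refine (mul_le_of_le_one_left (abs_nonneg _) hi).trans ?_
    rw [norm_sub_rev]
    exact abs_norm_sub_norm_le y x
  norm_num
  linarith

/-- Splitting off the first coordinate of `ℝ³`. -/
def splitFirst (x : E3) : ℝ × (Fin 2 → ℝ) := (x 0, fun i => x i.succ)

theorem measurePreserving_splitFirst : MeasurePreserving splitFirst volume volume := by
  exact (volume_preserving_piFinSuccAbove (fun _ : Fin 3 => ℝ) 0).comp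
    (PiLp.volume_preserving_ofLp (Fin 3))

theorem volume_cone_over {I : Set ℝ} (hI : MeasurableSet I) (hI0 : ∀ z ∈ I, 0 < z)
    {A : Set (Fin 2 → ℝ)} (hA : MeasurableSet A) :
    MeasurableSet {p : ℝ × (Fin 2 → ℝ) | p.1 ∈ I ∧ p.1⁻¹ • p.2 ∈ A} ∧
    (volume : Measure (ℝ × (Fin 2 → ℝ))) {p | p.1 ∈ I ∧ p.1⁻¹ • p.2 ∈ A}
      = ∫⁻ z in I, ENNReal.ofReal (z ^ 2) * volume A := by
  have hm : MeasurableSet {p : ℝ × (Fin 2 → ℝ) | p.1 ∈ I ∧ p.1⁻¹ • p.2 ∈ A} := by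
    apply (measurable_fst hI).inter
    exact (by fun_prop : Measurable fun p : ℝ × (Fin 2 → ℝ) => p.1⁻¹ • p.2) hA
  refine ⟨hm, ?_⟩
  rw [Measure.volume_eq_prod, Measure.prod_apply hm, ← lintegral_indicator hI]
  refine lintegral_congr fun z => ?_
  by_cases hz : z ∈ I
  · rw [indicator_of_mem hz]
    have : Prod.mk z ⁻¹' {p : ℝ × (Fin 2 → ℝ) | p.1 ∈ I ∧ p.1⁻¹ • p.2 ∈ A}
        = (z⁻¹ • ·) ⁻¹' A := by ext y; simp [hz]
    rw [this, Measure.addHaar_preimage_smul _ (inv_ne_zero (hI0 z hz).ne')]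
    simp
  · rw [indicator_of_notMem hz]
    simp [hz]

theorem sphM_le_hausdorff_patch {s : Set E3} (hs : MeasurableSet s) (hsP : s ⊆ gnomonicPatch) :
    sphM s ≤ 192 * μH[2] s ∧ μH[2] s ≤ 1024 * sphM s := by
  have hsS : sphere (0 : E3) 1 ∩ s = s := inter_eq_right.2 fun x hx => (hsP hx).1
  set A := gnomonicInv ⁻¹' s with hA
  have hAm : MeasurableSet A := gnomonicInv_lipschitz.continuous.measurable hs
  have h1 : gnomonicInv '' A = s := by
    refine (image_preimage_subset _ _).antisymm fun x hx => ?_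
    exact ⟨gnomonic x, by simpa [hA, gnomonicInv_gnomonic (hsP hx)] using hx,
      gnomonicInv_gnomonic (hsP hx)⟩
  have h2 : gnomonic '' s = A := by
    rw [← h1, image_image]
    simp [gnomonic_gnomonicInv]
  have hvol : (μH[2] : Measure (Fin 2 → ℝ)) = volume := by
    simpa using hausdorffMeasure_pi_real (ι := Fin 2)
  have k1 : μH[2] s ≤ 16 * volume A := by
    have := gnomonicInv_lipschitz.hausdorffMeasure_image_le (d := 2) zero_le_two A
    rw [h1, hvol] at this
    refine this.trans_eq ?_
    norm_num
  have k2 : volume A ≤ 64 * μH[2] s := by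
    have := (gnomonic_lipschitz.mono hsP).hausdorffMeasure_image_le (d := 2) zero_le_two
    rw [h2, hvol] at this
    refine this.trans_eq ?_
    norm_num
  rw [sphM_apply hs, hsS]
  have up : volume (Ioo (0 : ℝ) 1 • s) ≤ volume A := by
    obtain ⟨hm, hv⟩ := volume_cone_over (I := Ioo 0 1) measurableSet_Ioo (fun z hz => hz.1) hAm
    have sub : Ioo (0 : ℝ) 1 • s ⊆
        splitFirst ⁻¹' {p : ℝ × (Fin 2 → ℝ) | p.1 ∈ Ioo (0 : ℝ) 1 ∧ p.1⁻¹ • p.2 ∈ A} := by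
      rintro _ ⟨r, hr, ω, hω, rfl⟩
      have hω0 : 1 / 2 ≤ ω 0 := (hsP hω).2
      have hω1 : ‖ω‖ = 1 := by simpa using (hsP hω).1
      have hω2 : ω 0 ≤ 1 := by
        simpa [hω1] using (le_abs_self _).trans (PiLp.norm_apply_le ω 0)
      refine ⟨⟨?_, ?_⟩, ?_⟩
      · simp only [splitFirst, PiLp.smul_apply, smul_eq_mul]
        exact mul_pos hr.1 (by linarith)
      · simp only [splitFirst, PiLp.smul_apply, smul_eq_mul]
        have := hr.1; have := hr.2
        nlinarith
      · have : (splitFirst (r • ω)).1⁻¹ • (splitFirst (r • ω)).2 = gnomonic ω := by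
          ext i
          have := hr.1.ne'
          have : ω 0 ≠ 0 := by linarith
          simp [splitFirst, gnomonic]
          field_simp
        rw [this, hA, mem_preimage, gnomonicInv_gnomonic (hsP hω)]
        exact hω
    calc volume (Ioo (0 : ℝ) 1 • s) ≤ _ := measure_mono sub
      _ = _ := measurePreserving_splitFirst.measure_preimage hm.nullMeasurableSet
      _ = _ := hv
      _ ≤ ∫⁻ z in Ioo (0 : ℝ) 1, 1 * volume A := by
        refine setLIntegral_mono' measurableSet_Ioo fun z hz => ?_
        gcongr
        rw [ofReal_le_one]
        have := hz.1; have := hz.2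
        nlinarith
      _ = volume A := by simp
  have low : volume A ≤ 64 * volume (Ioo (0 : ℝ) 1 • s) := by
    obtain ⟨hm, hv⟩ := volume_cone_over (I := Ioo (1 / 4) (1 / 2)) measurableSet_Ioo
      (fun z hz => by linarith [hz.1]) hAm
    have sub : splitFirst ⁻¹' {p : ℝ × (Fin 2 → ℝ) |
        p.1 ∈ Ioo (1 / 4 : ℝ) (1 / 2) ∧ p.1⁻¹ • p.2 ∈ A} ⊆ Ioo (0 : ℝ) 1 • s := by
      rintro x ⟨hz, ha⟩
      have hx0 : 0 < x 0 := by have := hz.1; simp only [splitFirst] at this; linarith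
      have hx1 : x 0 < 1 / 2 := hz.2
      set a := (splitFirst x).1⁻¹ • (splitFirst x).2 with ha'
      have ha0 := one_le_norm_gnomonicLift a
      have hxa : x = x 0 • gnomonicLift a := by
        ext i
        fin_cases i <;> simp [gnomonicLift, ha', splitFirst, hx0.ne']
      have hP := (hsP ha).2
      have hn : ‖gnomonicLift a‖ ≤ 2 := by
        simp only [mem_ofPred_eq, gnomonicInv, PiLp.smul_apply, smul_eq_mul] at hP
        have : gnomonicLift a 0 = 1 := by simp [gnomonicLift]
        rw [this, mul_one, one_div] at hP
        exact (inv_le_inv₀ two_pos (by linarith)).1 hP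
      refine ⟨x 0 * ‖gnomonicLift a‖, ⟨by positivity, by nlinarith⟩, gnomonicInv a, ha, ?_⟩
      change (x 0 * ‖gnomonicLift a‖) • gnomonicInv a = x
      rw [gnomonicInv, smul_smul, mul_assoc, mul_inv_cancel₀ (by linarith), mul_one]
      exact hxa.symm
    have : volume A ≤ 64 * ∫⁻ z in Ioo (1 / 4 : ℝ) (1 / 2), ENNReal.ofReal (z ^ 2) * volume A := by
      calc volume A = 64 * ∫⁻ z in Ioo (1 / 4 : ℝ) (1 / 2), ENNReal.ofReal (1 / 16) * volume A := by
            rw [lintegral_const]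
            simp only [Measure.restrict_apply MeasurableSet.univ, univ_inter, Real.volume_Ioo]
            rw [mul_right_comm, ← ENNReal.ofReal_mul (by norm_num), ← mul_assoc,
              show (64 : ℝ≥0∞) = ENNReal.ofReal 64 by simp, ← ENNReal.ofReal_mul (by norm_num)]
            norm_num
        _ ≤ _ := by
            gcongr 64 * ?_
            refine setLIntegral_mono' measurableSet_Ioo fun z hz => ?_
            gcongr
            nlinarith [hz.1]
    refine this.trans ?_
    gcongr
    rw [← hv, ← measurePreserving_splitFirst.measure_preimage hm.nullMeasurableSet]
    exact measure_mono sub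
  constructor
  · calc _ ≤ 3 * (64 * μH[2] s) := by gcongr; exact up.trans k2
      _ = _ := by rw [← mul_assoc]; norm_num
  · calc _ ≤ 16 * (64 * volume (Ioo (0 : ℝ) 1 • s)) := k1.trans (by gcongr)
      _ = 1024 * volume (Ioo (0 : ℝ) 1 • s) := by rw [← mul_assoc]; norm_num
      _ ≤ _ := by
        gcongr
        exact le_mul_of_one_le_left zero_le (by norm_num)

theorem sphere_measure_le_of_patch {μ ν : Measure E3} (hμ : ∀ e : E3 ≃ₗᵢ[ℝ] E3, μ.map e = μ)
    (hν : ∀ e : E3 ≃ₗᵢ[ℝ] E3, ν.map e = ν) {C : ℝ≥0∞}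
    (h : ∀ s, MeasurableSet s → s ⊆ gnomonicPatch → μ s ≤ C * ν s) :
    μ.restrict (sphere (0 : E3) 1) ≤ (6 * C) • ν.restrict (sphere (0 : E3) 1) := by
  let T : Fin 3 × Bool → (E3 ≃ₗᵢ[ℝ] E3) := fun i =>
    (LinearIsometryEquiv.piLpCongrLeft 2 ℝ ℝ (Equiv.swap 0 i.1)).trans
      (bif i.2 then LinearIsometryEquiv.neg ℝ else LinearIsometryEquiv.refl ℝ E3)
  have inv : ∀ {κ : Measure E3}, (∀ e : E3 ≃ₗᵢ[ℝ] E3, κ.map e = κ) → ∀ (e : E3 ≃ₗᵢ[ℝ] E3)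
      (s : Set E3), κ (e ⁻¹' s) = κ s := fun hκ e s => by
    conv_rhs => rw [← hκ e]
    exact (e.toHomeomorph.toMeasurableEquiv.map_apply s).symm
  rw [Measure.le_iff]
  intro s hs
  rw [Measure.smul_apply, Measure.restrict_apply hs, Measure.restrict_apply hs, smul_eq_mul]
  set s' := s ∩ sphere (0 : E3) 1 with hs'
  have hs'm : MeasurableSet s' := hs.inter isClosed_sphere.measurableSet
  have hPm : MeasurableSet gnomonicPatch := by
    refine isClosed_sphere.measurableSet.inter ?_
    exact measurableSet_le measurable_const (by fun_prop)
  have cover : s' ⊆ ⋃ i, (s' ∩ T i ⁻¹' gnomonicPatch) := by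
    intro x hx
    have hx1 : ‖x‖ = 1 := by simpa using hx.2
    have hex : ∃ k, 1 / 2 ≤ |x k| := by
      by_contra! hcon
      have h2 : ∑ i, x i ^ 2 = 1 := by
        have := EuclideanSpace.norm_sq_eq x
        simpa [hx1] using this.symm
      simp only [Fin.sum_univ_three] at h2
      have q : ∀ k, x k ^ 2 ≤ 1 / 4 := fun k => by
        have := hcon k
        rw [← sq_abs]; nlinarith [abs_nonneg (x k)]
      linarith [q 0, q 1, q 2]
    obtain ⟨k, hk⟩ := hex
    rw [mem_iUnion]
    rcases le_total 0 (x k) with h0 | h0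
    · refine ⟨(k, false), hx, ?_, ?_⟩
      · simp [hx1]
      · rw [abs_of_nonneg h0] at hk
        simpa [T, LinearIsometryEquiv.piLpCongrLeft_apply, Equiv.piCongrLeft'] using hk
    · refine ⟨(k, true), hx, ?_, ?_⟩
      · simp [hx1]
      · rw [abs_of_nonpos h0] at hk
        simpa [T, LinearIsometryEquiv.piLpCongrLeft_apply, Equiv.piCongrLeft'] using hk
  have each : ∀ i, μ (s' ∩ T i ⁻¹' gnomonicPatch) ≤ C * ν s' := by
    intro i
    have e : s' ∩ T i ⁻¹' gnomonicPatch = T i ⁻¹' ((T i).symm ⁻¹' s' ∩ gnomonicPatch) := by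
      ext x; simp
    calc _ = μ ((T i).symm ⁻¹' s' ∩ gnomonicPatch) := by rw [e, inv hμ]
      _ ≤ C * ν ((T i).symm ⁻¹' s' ∩ gnomonicPatch) :=
        h _ (((T i).symm.continuous.measurable hs'm).inter hPm) inter_subset_right
      _ ≤ C * ν ((T i).symm ⁻¹' s') := by gcongr; exact inter_subset_left
      _ = C * ν s' := by rw [inv hν]
  calc μ s' ≤ _ := measure_mono cover
    _ ≤ ∑ i, μ (s' ∩ T i ⁻¹' gnomonicPatch) := measure_iUnion_fintype_le _ _
    _ ≤ ∑ _i : Fin 3 × Bool, C * ν s' := Finset.sum_le_sum fun i _ => each i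
    _ = 6 * C * ν s' := by
      rw [Finset.sum_const]
      simp [mul_assoc]

theorem hausdorff_map (e : E3 ≃ₗᵢ[ℝ] E3) : (μH[2] : Measure E3).map e = μH[2] :=
  e.toIsometryEquiv.map_hausdorffMeasure 2

theorem sphM_le_hausdorff :
    sphM ≤ (1152 : ℝ≥0∞) • (μH[2] : Measure E3).restrict (sphere (0 : E3) 1) := by
  have := sphere_measure_le_of_patch sphM_map hausdorff_map
    fun s hs hP => (sphM_le_hausdorff_patch hs hP).1
  rw [sphM_restrict] at this
  refine this.trans_eq ?_
  norm_num

theorem hausdorff_le_sphM :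
    (μH[2] : Measure E3).restrict (sphere (0 : E3) 1) ≤ (6144 : ℝ≥0∞) • sphM := by
  have := sphere_measure_le_of_patch hausdorff_map sphM_map
    fun s hs hP => (sphM_le_hausdorff_patch hs hP).2
  rw [sphM_restrict] at this
  refine this.trans_eq ?_
  norm_num

end SphereMeasure

/-! ### Algebra of the null frame -/

section Frame

variable {G : V → Fin 4 → Fin 4 → ℝ}

/-- The radial component of the Poynting vector, multiplied by the radius. -/
def poynX (G : V → Fin 4 → Fin 4 → ℝ) (p : V) : ℝ :=
  (G p 0 2 * G p 1 2 - G p 0 3 * G p 3 1) * p 1 + (G p 0 3 * G p 2 3 - G p 0 1 * G p 1 2) * p 2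
    + (G p 0 1 * G p 3 1 - G p 0 2 * G p 2 3) * p 3

theorem rad_sq (p : V) : rad p ^ 2 = p 1 ^ 2 + p 2 ^ 2 + p 3 ^ 2 := by
  rw [rad, Real.sq_sqrt (by positivity)]
  simp [Fin.sum_univ_three]

theorem rad_nonneg (p : V) : 0 ≤ rad p := Real.sqrt_nonneg _

theorem AntiSym.apply_self (hG : AntiSym G) (p : V) (μ : Fin 4) : G p μ μ = 0 := by
  have := hG p μ μ; linarith

theorem exists_direction {p : V} (hp : 0 < rad p) : ∃ a b c : ℝ, a ^ 2 + b ^ 2 + c ^ 2 = 1 ∧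
    p 1 = rad p * a ∧ p 2 = rad p * b ∧ p 3 = rad p * c := by
  refine ⟨p 1 / rad p, p 2 / rad p, p 3 / rad p, ?_, ?_, ?_, ?_⟩ <;> field_simp
  rw [rad_sq]

theorem fSq_eq (hG : AntiSym G) (p : V) : fSq G p = G p 0 1 ^ 2 + G p 0 2 ^ 2 + G p 0 3 ^ 2
    + G p 2 3 ^ 2 + G p 3 1 ^ 2 + G p 1 2 ^ 2 := by
  simp only [fSq, Fin.sum_univ_four, hG.apply_self, hG p 1 0, hG p 2 0, hG p 3 0, hG p 3 2,
    hG p 1 3, hG p 2 1]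
  ring

theorem rhoC_eq (hG : AntiSym G) {p : V} (hp : 0 < rad p) {a b c : ℝ} (ha : p 1 = rad p * a) (hb : p 2 = rad p * b) (hc : p 3 = rad p * c) :
    rhoC G p = G p 0 1 * a + G p 0 2 * b + G p 0 3 * c := by
  have ha' : p 1 / rad p = a := by rw [ha]; field_simp
  have hb' : p 2 / rad p = b := by rw [hb]; field_simp
  have hc' : p 3 / rad p = c := by rw [hc]; field_simp
  simp only [rhoC, ap2, Fin.sum_univ_four, hG.apply_self, hG p 1 0, hG p 2 0, hG p 3 0, hG p 3 2,
    hG p 1 3, hG p 2 1, Lbv, Lv, ha', hb', hc']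
  simp
  ring

theorem Pv_eq {p : V} (hp : 0 < rad p) {a b c : ℝ} (ha : p 1 = rad p * a) (hb : p 2 = rad p * b)
    (hc : p 3 = rad p * c) :
    Pv p 0 = ![0, 1 - a * a, - a * b, - a * c] ∧ Pv p 1 = ![0, - b * a, 1 - b * b, - b * c] ∧
    Pv p 2 = ![0, - c * a, - c * b, 1 - c * c] := by
  have e1 : (Fin.succ 0 : Fin 4) = 1 := rfl
  have e2 : (Fin.succ 1 : Fin 4) = 2 := rfl
  have e3 : (Fin.succ 2 : Fin 4) = 3 := rfl
  refine ⟨?_, ?_, ?_⟩ <;> ext μ <;> fin_cases μ <;>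
    simp [Pv, e1, e2, e3, ha, hb, hc] <;> field_simp

theorem sigmaSq_eq (hG : AntiSym G) {p : V} (hp : 0 < rad p) {a b c : ℝ}
    (h : a ^ 2 + b ^ 2 + c ^ 2 = 1) (ha : p 1 = rad p * a) (hb : p 2 = rad p * b)
    (hc : p 3 = rad p * c) :
    sigmaSq G p = (G p 2 3 * a + G p 3 1 * b + G p 1 2 * c) ^ 2 := by
  obtain ⟨h0, h1, h2⟩ := Pv_eq hp ha hb hc
  have hc2 : c ^ 2 = 1 - a ^ 2 - b ^ 2 := by linarith
  set s := G p 2 3 * a + G p 3 1 * b + G p 1 2 * c with hs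
  have k01 : ap2 G (Pv p 0) (Pv p 1) p = c * s := by
    simp only [ap2, Fin.sum_univ_four, hG.apply_self, hG p 1 0, hG p 2 0, hG p 3 0, hG p 3 2,
      hG p 1 3, hG p 2 1, h0, h1]
    simp
    linear_combination (- G p 1 2) * h
  have k02 : ap2 G (Pv p 0) (Pv p 2) p = - b * s := by
    simp only [ap2, Fin.sum_univ_four, hG.apply_self, hG p 1 0, hG p 2 0, hG p 3 0, hG p 3 2,
      hG p 1 3, hG p 2 1, h0, h2]
    simp
    linear_combination (G p 3 1) * h
  have k12 : ap2 G (Pv p 1) (Pv p 2) p = a * s := by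
    simp only [ap2, Fin.sum_univ_four, hG.apply_self, hG p 1 0, hG p 2 0, hG p 3 0, hG p 3 2,
      hG p 1 3, hG p 2 1, h1, h2]
    simp
    linear_combination (- G p 2 3) * h
  have anti : ∀ X Y : V, ap2 G X Y p = - ap2 G Y X p := by
    intro X Y
    simp only [ap2, Fin.sum_univ_four, hG.apply_self, hG p 1 0, hG p 2 0, hG p 3 0, hG p 3 2,
      hG p 1 3, hG p 2 1]
    ring
  have self : ∀ X : V, ap2 G X X p = 0 := fun X => by have := anti X X; linarith
  simp only [sigmaSq, Fin.sum_univ_three, self, anti (Pv p 1) (Pv p 0), anti (Pv p 2) (Pv p 0),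
    anti (Pv p 2) (Pv p 1), k01, k02, k12]
  linear_combination s ^ 2 * h

theorem alphaSq_eq (hG : AntiSym G) {p : V} (hp : 0 < rad p) :
    alphaSq G p = fSq G p - rhoC G p ^ 2 - sigmaSq G p + 2 * (poynX G p / rad p) ∧
    abarSq G p = fSq G p - rhoC G p ^ 2 - sigmaSq G p - 2 * (poynX G p / rad p) := by
  obtain ⟨a, b, c, h, ha, hb, hc⟩ := exists_direction hp
  obtain ⟨h0, h1, h2⟩ := Pv_eq hp ha hb hc
  have ha' : p 1 / rad p = a := by rw [ha]; field_simp
  have hb' : p 2 / rad p = b := by rw [hb]; field_simp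
  have hc' : p 3 / rad p = c := by rw [hc]; field_simp
  have hS : poynX G p / rad p = (G p 0 2 * G p 1 2 - G p 0 3 * G p 3 1) * a
      + (G p 0 3 * G p 2 3 - G p 0 1 * G p 1 2) * b
      + (G p 0 1 * G p 3 1 - G p 0 2 * G p 2 3) * c := by
    rw [poynX, ha, hb, hc]; field_simp
  have hρ := rhoC_eq hG hp ha hb hc
  have hσ := sigmaSq_eq hG hp h ha hb hc
  have he := fSq_eq hG p
  have key : ∀ (s : ℝ), s ^ 2 = 1 → ∀ j : Fin 3,
      ap2 G ![1, s * a, s * b, s * c] (Pv p j) p = ![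
        G p 0 1 - a * rhoC G p + s * (c * G p 3 1 - b * G p 1 2),
        G p 0 2 - b * rhoC G p + s * (a * G p 1 2 - c * G p 2 3),
        G p 0 3 - c * rhoC G p + s * (b * G p 2 3 - a * G p 3 1)] j := by
    intro s hs j
    rw [hρ]
    fin_cases j
    · simp only [ap2, Fin.sum_univ_four, hG.apply_self, hG p 1 0, hG p 2 0, hG p 3 0, hG p 3 2,
        hG p 1 3, hG p 2 1, h0, Fin.zero_eta]
      simp
      ring
    · simp only [ap2, Fin.sum_univ_four, hG.apply_self, hG p 1 0, hG p 2 0, hG p 3 0, hG p 3 2,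
        hG p 1 3, hG p 2 1, h1, Fin.mk_one]
      simp
      ring
    · simp only [ap2, Fin.sum_univ_four, hG.apply_self, hG p 1 0, hG p 2 0, hG p 3 0, hG p 3 2,
        hG p 1 3, hG p 2 1, h2, Fin.reduceFinMk]
      simp
      ring
  have gen : ∀ s : ℝ, s ^ 2 = 1 → ∑ j : Fin 3, (ap2 G ![1, s * a, s * b, s * c] (Pv p j) p) ^ 2
      = fSq G p - rhoC G p ^ 2 - sigmaSq G p + s * (2 * (poynX G p / rad p)) := by
    intro s hs
    simp only [Fin.sum_univ_three, key s hs, hS, hσ, he, hρ]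
    simp
    generalize G p 0 1 = e1, G p 0 2 = e2, G p 0 3 = e3, G p 2 3 = b1, G p 3 1 = b2, G p 1 2 = b3
    have hs' : s ^ 2 - 1 = 0 := by linarith
    linear_combination (e1 * a + e2 * b + e3 * c) ^ 2 * h
      + ((b * b3 - c * b2) ^ 2 + (c * b1 - a * b3) ^ 2 + (a * b2 - b * b1) ^ 2) * hs
      + (b1 ^ 2 + b2 ^ 2 + b3 ^ 2) * h
  constructor
  · have := gen 1 (by norm_num)
    simp only [one_mul] at this
    rw [alphaSq, ← this, Lv, ha', hb', hc']
  · have := gen (-1) (by norm_num)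
    simp only [neg_one_mul] at this
    rw [abarSq, Lbv, ha', hb', hc', this]
    ring

end Frame

/-! ### Calculus of partial derivatives -/

section PartialDerivatives

variable {f g : V → ℝ} {p : V} (μ : Fin 4)

theorem pd_add (hf : DifferentiableAt ℝ f p) (hg : DifferentiableAt ℝ g p) :
    pd μ (fun q => f q + g q) p = pd μ f p + pd μ g p := by
  simp [pd, fderiv_fun_add hf hg]

theorem pd_sub (hf : DifferentiableAt ℝ f p) (hg : DifferentiableAt ℝ g p) :
    pd μ (fun q => f q - g q) p = pd μ f p - pd μ g p := by
  simp [pd, fderiv_fun_sub hf hg]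

theorem pd_mul (hf : DifferentiableAt ℝ f p) (hg : DifferentiableAt ℝ g p) :
    pd μ (fun q => f q * g q) p = f p * pd μ g p + pd μ f p * g p := by
  simp [pd, fderiv_fun_mul hf hg, mul_comm]

theorem pd_const (c : ℝ) : pd μ (fun _ => c) p = 0 := by
  simp [pd]

theorem pd_coord (ν : Fin 4) : pd μ (fun q => q ν) p = if μ = ν then 1 else 0 := by
  have : fderiv ℝ (fun q : V => q ν) p = ContinuousLinearMap.proj ν :=
    (ContinuousLinearMap.proj (R := ℝ) (φ := fun _ : Fin 4 => ℝ) ν).fderiv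
  simp [pd, this, Pi.single_apply, eq_comm]

theorem pd_neg_fun (f : V → ℝ) (p : V) : pd μ (fun q => - f q) p = - pd μ f p := by
  simp [pd]

end PartialDerivatives

/-! ### The energy current -/

/-- The weight `1 + r²`. -/
def wgt (p : V) : ℝ := 1 + (p 1 ^ 2 + p 2 ^ 2 + p 3 ^ 2)

/-- The radial multiplier, divided by the radius. -/
def mulG (ε : ℝ) (p : V) : ℝ := 2 * wgt p ^ (-(1 / 2) : ℝ) - wgt p ^ (-((1 + ε) / 2))

/-- The derivative of `mulG` with respect to `r²`. -/
def mulG' (ε : ℝ) (p : V) : ℝ :=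
  - wgt p ^ (-(3 / 2) : ℝ) + (1 + ε) / 2 * wgt p ^ (-((3 + ε) / 2))

/-- The time component of the energy current with multipliers `4 ∂_t` and `mulG • x`. -/
def curT (ε : ℝ) (G : V → Fin 4 → Fin 4 → ℝ) (p : V) : ℝ :=
  2 * (G p 0 1 * G p 0 1 + G p 0 2 * G p 0 2 + G p 0 3 * G p 0 3
    + G p 2 3 * G p 2 3 + G p 3 1 * G p 3 1 + G p 1 2 * G p 1 2)
  + mulG ε p * ((G p 0 2 * G p 1 2 - G p 0 3 * G p 3 1) * p 1
    + (G p 0 3 * G p 2 3 - G p 0 1 * G p 1 2) * p 2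
    + (G p 0 1 * G p 3 1 - G p 0 2 * G p 2 3) * p 3)

/-- The spatial components of the energy current with multipliers `4 ∂_t` and `mulG • x`. -/
def curX (ε : ℝ) (G : V → Fin 4 → Fin 4 → ℝ) : Fin 3 → V → ℝ := ![
  fun p => (-4) * (G p 0 2 * G p 1 2 - G p 0 3 * G p 3 1) + mulG ε p *
    (G p 0 1 * (G p 0 1 * p 1 + G p 0 2 * p 2 + G p 0 3 * p 3)
    + G p 2 3 * (G p 2 3 * p 1 + G p 3 1 * p 2 + G p 1 2 * p 3)
    - (1 / 2) * ((G p 0 1 * G p 0 1 + G p 0 2 * G p 0 2 + G p 0 3 * G p 0 3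
    + G p 2 3 * G p 2 3 + G p 3 1 * G p 3 1 + G p 1 2 * G p 1 2) * p 1)),
  fun p => (-4) * (G p 0 3 * G p 2 3 - G p 0 1 * G p 1 2) + mulG ε p *
    (G p 0 2 * (G p 0 1 * p 1 + G p 0 2 * p 2 + G p 0 3 * p 3)
    + G p 3 1 * (G p 2 3 * p 1 + G p 3 1 * p 2 + G p 1 2 * p 3)
    - (1 / 2) * ((G p 0 1 * G p 0 1 + G p 0 2 * G p 0 2 + G p 0 3 * G p 0 3
    + G p 2 3 * G p 2 3 + G p 3 1 * G p 3 1 + G p 1 2 * G p 1 2) * p 2)),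
  fun p => (-4) * (G p 0 1 * G p 3 1 - G p 0 2 * G p 2 3) + mulG ε p *
    (G p 0 3 * (G p 0 1 * p 1 + G p 0 2 * p 2 + G p 0 3 * p 3)
    + G p 1 2 * (G p 2 3 * p 1 + G p 3 1 * p 2 + G p 1 2 * p 3)
    - (1 / 2) * ((G p 0 1 * G p 0 1 + G p 0 2 * G p 0 2 + G p 0 3 * G p 0 3
    + G p 2 3 * G p 2 3 + G p 3 1 * G p 3 1 + G p 1 2 * G p 1 2) * p 3))]

/-- The spacetime divergence of a vector field. -/
def stDiv (P₀ : V → ℝ) (P : Fin 3 → V → ℝ) (p : V) : ℝ :=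
  pd 0 P₀ p + ∑ i : Fin 3, pd i.succ (P i) p

theorem one_le_wgt (p : V) : 1 ≤ wgt p := by
  unfold wgt; nlinarith [sq_nonneg (p 1), sq_nonneg (p 2), sq_nonneg (p 3)]

theorem wgt_pos (p : V) : 0 < wgt p := zero_lt_one.trans_le (one_le_wgt p)

theorem contDiff_wgt : ContDiff ℝ (⊤ : ℕ∞) wgt := by
  unfold wgt; fun_prop

theorem contDiff_mulG (ε : ℝ) : ContDiff ℝ (⊤ : ℕ∞) (mulG ε) := by
  have h : ∀ c : ℝ, ContDiff ℝ (⊤ : ℕ∞) fun p => wgt p ^ c := fun c =>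
    contDiff_wgt.rpow_const_of_ne fun p => (wgt_pos p).ne'
  unfold mulG
  exact (contDiff_const.mul (h _)).sub (h _)

theorem pd_wgt_rpow (c : ℝ) (μ : Fin 4) (p : V) :
    pd μ (fun q => wgt q ^ c) p = c * wgt p ^ (c - 1) * (if μ = 0 then 0 else 2 * p μ) := by
  have hd : DifferentiableAt ℝ wgt p := contDiff_wgt.differentiable (by simp) p
  have h1 : fderiv ℝ (fun q => wgt q ^ c) p = (c * wgt p ^ (c - 1)) • fderiv ℝ wgt p :=
    (hd.hasFDerivAt.rpow_const (Or.inl (wgt_pos p).ne')).fderiv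
  have h2 : pd μ wgt p = if μ = 0 then 0 else 2 * p μ := by
    have e : wgt = fun q : V => 1 + (q 1 * q 1 + q 2 * q 2 + q 3 * q 3) := by
      ext q; simp only [wgt]; ring
    rw [e]
    simp (disch := fun_prop) only [pd_add, pd_mul, pd_const, pd_coord]
    fin_cases μ <;> simp <;> ring
  rw [pd] at h2 ⊢
  rw [h1, ← h2]
  rfl

theorem pd_mulG (ε : ℝ) (μ : Fin 4) (p : V) :
    pd μ (mulG ε) p = if μ = 0 then 0 else 2 * mulG' ε p * p μ := by
  have h : ∀ c : ℝ, DifferentiableAt ℝ (fun p => wgt p ^ c) p := fun c =>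
    (contDiff_wgt.rpow_const_of_ne fun p => (wgt_pos p).ne').differentiable
      (n := ((⊤ : ℕ∞) : WithTop ℕ∞)) (by simp) p
  have e : mulG ε = fun p => 2 * wgt p ^ (-(1 / 2) : ℝ) - wgt p ^ (-((1 + ε) / 2)) := rfl
  rw [e, pd_sub _ ((h _).const_mul _) (h _),
    pd_mul _ (differentiableAt_const _) (h _), pd_const, pd_wgt_rpow, pd_wgt_rpow, mulG',
    show (-(1 / 2) - 1 : ℝ) = -(3 / 2) by norm_num,
    show -((1 + ε) / 2) - 1 = -((3 + ε) / 2) by ring]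
  split_ifs <;> ring

theorem contDiff_curT (ε : ℝ) {G : V → Fin 4 → Fin 4 → ℝ} (hG : Smooth2Form G) :
    ContDiff ℝ (⊤ : ℕ∞) (curT ε G) := by
  have := contDiff_mulG ε
  have h := fun μ ν => hG μ ν
  unfold curT
  fun_prop

theorem contDiff_curX (ε : ℝ) {G : V → Fin 4 → Fin 4 → ℝ} (hG : Smooth2Form G) (i : Fin 3) :
    ContDiff ℝ (⊤ : ℕ∞) (curX ε G i) := by
  have := contDiff_mulG ε
  have h := fun μ ν => hG μ ν
  unfold curX
  fin_cases i <;> simp <;> fun_prop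

theorem stDiv_cur (ε : ℝ) {G : V → Fin 4 → Fin 4 → ℝ} (hG : Smooth2Form G) (hA : AntiSym G)
    (hB : Bianchi G) (p : V) :
    stDiv (curT ε G) (curX ε G) p =
      4 * (G p 0 1 * divSnd G p 1 + G p 0 2 * divSnd G p 2 + G p 0 3 * divSnd G p 3)
      + mulG ε p * (divSnd G p 0 * (G p 0 1 * p 1 + G p 0 2 * p 2 + G p 0 3 * p 3)
        + (divSnd G p 2 * G p 1 2 - divSnd G p 3 * G p 3 1) * p 1
        + (divSnd G p 3 * G p 2 3 - divSnd G p 1 * G p 1 2) * p 2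
        + (divSnd G p 1 * G p 3 1 - divSnd G p 2 * G p 2 3) * p 3)
      - ((1 / 2) * mulG ε p * fSq G p + 2 * mulG' ε p * ((1 / 2) * rad p ^ 2 * fSq G p
        - (G p 0 1 * p 1 + G p 0 2 * p 2 + G p 0 3 * p 3) ^ 2
        - (G p 2 3 * p 1 + G p 3 1 * p 2 + G p 1 2 * p 3) ^ 2)) := by
  have hd : ∀ μ ν, DifferentiableAt ℝ (fun q => G q μ ν) p := fun μ ν =>
    (hG μ ν).differentiable (by simp) p
  have hm : DifferentiableAt ℝ (mulG ε) p := (contDiff_mulG ε).differentiable (by simp) p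
  have h01 := hd 0 1
  have h02 := hd 0 2
  have h03 := hd 0 3
  have h23 := hd 2 3
  have h31 := hd 3 1
  have h12 := hd 1 2
  have e1 : (Fin.succ 0 : Fin 4) = 1 := rfl
  have e2 : (Fin.succ 1 : Fin 4) = 2 := rfl
  have e3 : (Fin.succ 2 : Fin 4) = 3 := rfl
  have anti : ∀ κ μ ν, pd κ (fun q => G q μ ν) p = - pd κ (fun q => G q ν μ) p := by
    intro κ μ ν
    rw [← pd_neg_fun]
    congr 1
    ext q
    exact hA q μ ν
  have diag : ∀ κ μ, pd κ (fun q => G q μ μ) p = 0 := fun κ μ => by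
    have := anti κ μ μ; linarith
  have b0 := hB p 1 2 3
  have b1 := hB p 0 2 3
  have b2 := hB p 0 3 1
  have b3 := hB p 0 1 2
  simp only [anti _ 3 0, anti _ 2 0, anti _ 1 0] at b1 b2 b3
  have j0 : divSnd G p 0 = pd 1 (fun q => G q 0 1) p + pd 2 (fun q => G q 0 2) p
      + pd 3 (fun q => G q 0 3) p := by
    simp [divSnd, Fin.sum_univ_four, eta, diag]
  have j1 : divSnd G p 1 = pd 0 (fun q => G q 0 1) p + pd 2 (fun q => G q 1 2) p
      - pd 3 (fun q => G q 3 1) p := by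
    simp [divSnd, Fin.sum_univ_four, eta, diag, anti _ 1 0, anti _ 1 3]; ring
  have j2 : divSnd G p 2 = pd 0 (fun q => G q 0 2) p + pd 3 (fun q => G q 2 3) p
      - pd 1 (fun q => G q 1 2) p := by
    simp [divSnd, Fin.sum_univ_four, eta, diag, anti _ 2 0, anti _ 2 1]; ring
  have j3 : divSnd G p 3 = pd 0 (fun q => G q 0 3) p + pd 1 (fun q => G q 3 1) p
      - pd 2 (fun q => G q 2 3) p := by
    simp [divSnd, Fin.sum_univ_four, eta, diag, anti _ 3 0, anti _ 3 2]; ring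
  rw [stDiv, Fin.sum_univ_three, e1, e2, e3, fSq_eq hA, rad_sq, j0, j1, j2, j3]
  unfold curT curX
  simp only [Matrix.cons_val_zero, Matrix.cons_val_one, Matrix.cons_val]
  simp (disch := fun_prop) only [pd_add, pd_sub, pd_mul, pd_const, pd_coord, pd_mulG]
  simp only [Fin.reduceEq, if_true, if_false]
  linear_combination
    (mulG ε p * (p 1 * G p 2 3 + p 2 * G p 3 1 + p 3 * G p 1 2)) * b0
    + (4 * G p 2 3 + mulG ε p * (G p 0 3 * p 2 - G p 0 2 * p 3)) * b1
    + (4 * G p 3 1 + mulG ε p * (G p 0 1 * p 3 - G p 0 3 * p 1)) * b2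
    + (4 * G p 1 2 + mulG ε p * (G p 0 2 * p 1 - G p 0 1 * p 2)) * b3

/-! ### Positivity of the bulk and flux densities -/

/-- The density controlled by the energy estimate in the interior of a region. -/
def bulkD (ε : ℝ) (G : V → Fin 4 → Fin 4 → ℝ) (p : V) : ℝ :=
  rplus p ^ (-(1 + ε)) * fSq G p + (rhoC G p ^ 2 + sigmaSq G p) / (1 + rad p)

/-- The density of the source terms of the energy estimate. -/
def srcD (ε : ℝ) (G : V → Fin 4 → Fin 4 → ℝ) (p : V) : ℝ :=
  rplus p ^ (1 + ε) * JdensMix (divSnd G) p + |ap1 (divSnd G) (Lbv p) p| * |rhoC G p|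

theorem wgt_eq (p : V) : wgt p = 1 + rad p ^ 2 := by rw [rad_sq, wgt]

theorem rplus_pos (p : V) : 0 < rplus p := by
  have := rad_nonneg p; unfold rplus; linarith

theorem wgt_le (p : V) : wgt p ≤ rplus p ^ 2 := by
  rw [wgt_eq, rplus]; nlinarith [rad_nonneg p]

theorem mulG_bounds {ε : ℝ} (hε : 0 < ε) (hε1 : ε ≤ 1) (p : V) :
    |mulG ε p * rad p| ≤ 2 ∧
    ε * rplus p ^ (-(1 + ε)) ≤ mulG ε p + 2 * rad p ^ 2 * mulG' ε p ∧
    rplus p ^ (-(1 + ε)) ≤ (1 + rad p)⁻¹ ∧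
    (1 / 2) * (1 + rad p)⁻¹ ≤ mulG ε p - (mulG ε p + 2 * rad p ^ 2 * mulG' ε p) / 2 := by
  have hw := one_le_wgt p
  have hw0 := wgt_pos p
  have hr := rad_nonneg p
  have hrp := rplus_pos p
  set w := wgt p with hwdef
  set h := w ^ (-(1 / 2) : ℝ) with hh
  set η := w ^ (-(ε / 2)) with hη
  have h0 : 0 < h := Real.rpow_pos_of_pos hw0 _
  have η0 : 0 < η := Real.rpow_pos_of_pos hw0 _
  have η1 : η ≤ 1 := Real.rpow_le_one_of_one_le_of_nonpos hw (by linarith)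
  have hsq : h ^ 2 * w = 1 := by
    rw [hh, ← Real.rpow_natCast, ← Real.rpow_mul hw0.le]
    norm_num
    rw [Real.rpow_neg_one, inv_mul_cancel₀ hw0.ne']
  have eW : w ^ (-((1 + ε) / 2)) = h * η := by
    rw [hh, hη, ← Real.rpow_add hw0]; congr 1; ring
  have e3 : w ^ (-(3 / 2) : ℝ) = h * w⁻¹ := by
    rw [hh, ← Real.rpow_neg_one w, ← Real.rpow_add hw0]; congr 1; norm_num
  have e4 : w ^ (-((3 + ε) / 2)) = h * η * w⁻¹ := by
    rw [hh, hη, ← Real.rpow_neg_one w, ← Real.rpow_add hw0, ← Real.rpow_add hw0]; congr 1; ring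
  have eg : mulG ε p = h * (2 - η) := by rw [mulG, ← hwdef, eW]; ring
  have eg' : mulG' ε p = h * w⁻¹ * (-1 + (1 + ε) / 2 * η) := by
    rw [mulG', ← hwdef, e3, e4]; ring
  have hrw : rad p ^ 2 = w - 1 := by rw [hwdef, wgt_eq]; ring
  have ef : mulG ε p + 2 * rad p ^ 2 * mulG' ε p
      = h * (ε * η) + h * w⁻¹ * (2 - (1 + ε) * η) := by
    rw [eg, eg', hrw]; field_simp; ring
  have hle : (1 + rad p)⁻¹ ≤ h := by
    have : 1 ≤ h * (1 + rad p) := by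
      have h1 := wgt_le p
      rw [rplus, ← hwdef] at h1
      have : 1 ≤ (h * (1 + rad p)) ^ 2 := by rw [mul_pow]; nlinarith [sq_nonneg h]
      exact (one_le_sq_iff₀ (by positivity)).1 this
    rw [inv_le_iff_one_le_mul₀ (by positivity)]
    exact this
  have hhr : h * rad p ≤ 1 := by
    have : (h * rad p) ^ 2 ≤ 1 := by rw [mul_pow, hrw]; nlinarith [sq_nonneg h]
    exact (sq_le_one_iff₀ (by positivity)).1 this
  have hhr0 : 0 ≤ h * rad p := by positivity
  have hηε : (1 + ε) * η ≤ 2 := by nlinarith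
  have hwi : w⁻¹ ≤ 1 := inv_le_one_of_one_le₀ hw
  have hwi0 : 0 < w⁻¹ := by positivity
  refine ⟨?_, ?_, ?_, ?_⟩
  · rw [eg, show h * (2 - η) * rad p = (h * rad p) * (2 - η) by ring, abs_of_nonneg
      (mul_nonneg hhr0 (by linarith))]
    nlinarith
  · have hW : rplus p ^ (-(1 + ε)) ≤ h * η := by
      rw [← eW, show -(1 + ε) = ((2 : ℕ) : ℝ) * (-((1 + ε) / 2)) by push_cast; ring,
        Real.rpow_mul hrp.le, Real.rpow_natCast]
      exact Real.rpow_le_rpow_of_nonpos hw0 (wgt_le p) (by linarith)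
    rw [ef]
    have : 0 ≤ h * w⁻¹ * (2 - (1 + ε) * η) := mul_nonneg (by positivity) (by linarith)
    nlinarith
  · rw [← Real.rpow_neg_one]
    exact Real.rpow_le_rpow_of_exponent_le (by unfold rplus; linarith) (by linarith)
  · rw [ef, eg]
    have k : h * w⁻¹ * (2 - (1 + ε) * η) ≤ h * (2 - (1 + ε) * η) := by
      have : h * w⁻¹ ≤ h := mul_le_of_le_one_right h0.le hwi
      exact mul_le_mul_of_nonneg_right this (by linarith)
    nlinarith

/-- The source term in the divergence of the energy current. -/
theorem abs_source_le {e1 e2 e3 b1 b2 b3 j0 j1 j2 j3 a b c f e : ℝ}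
    (h : a ^ 2 + b ^ 2 + c ^ 2 = 1) (hf : |f| ≤ 2)
    (he : e = e1 ^ 2 + e2 ^ 2 + e3 ^ 2 + b1 ^ 2 + b2 ^ 2 + b3 ^ 2) {jw jp : ℝ}
    (hjp : 0 ≤ jp)
    (hjp2 : jp ^ 2 = (j1 - a * jw) ^ 2 + (j2 - b * jw) ^ 2 + (j3 - c * jw) ^ 2) :
    |4 * (e1 * j1 + e2 * j2 + e3 * j3) + f * (j0 * (e1 * a + e2 * b + e3 * c)
      + ((j2 * b3 - j3 * b2) * a + (j3 * b1 - j1 * b3) * b + (j1 * b2 - j2 * b1) * c))|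
    ≤ 3 * (|j0 - jw| * |e1 * a + e2 * b + e3 * c|) + 6 * (√e * (jp + |j0 + jw|)) := by
  set ρ := e1 * a + e2 * b + e3 * c with hρ
  have he0 : 0 ≤ e := by rw [he]; positivity
  have cs : ∀ x y z u v w : ℝ, (x * u + y * v + z * w) ^ 2
      ≤ (x ^ 2 + y ^ 2 + z ^ 2) * (u ^ 2 + v ^ 2 + w ^ 2) := fun x y z u v w => by
    nlinarith [sq_nonneg (x * v - y * u), sq_nonneg (x * w - z * u), sq_nonneg (y * w - z * v)]
  have bound : ∀ x y : ℝ, 0 ≤ y → x ^ 2 ≤ e * y ^ 2 → |x| ≤ √e * y := fun x y hy hx => by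
    refine abs_le_of_sq_le_sq ?_ (by positivity)
    rwa [mul_pow, Real.sq_sqrt he0]
  have k1 : |ρ| ≤ √e := by
    have := bound ρ 1 zero_le_one (by
      have := cs e1 e2 e3 a b c
      rw [h] at this
      rw [hρ, he]; nlinarith [sq_nonneg b1, sq_nonneg b2, sq_nonneg b3])
    simpa using this
  have k2 : |e1 * (j1 - a * jw) + e2 * (j2 - b * jw) + e3 * (j3 - c * jw)| ≤ √e * jp := by
    refine bound _ _ hjp ((cs _ _ _ _ _ _).trans ?_)
    rw [← hjp2]
    refine mul_le_mul_of_nonneg_right ?_ (sq_nonneg _)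
    rw [he]; nlinarith [sq_nonneg b1, sq_nonneg b2, sq_nonneg b3]
  have k3 : |(b2 * c - b3 * b) * (j1 - a * jw) + (b3 * a - b1 * c) * (j2 - b * jw)
      + (b1 * b - b2 * a) * (j3 - c * jw)| ≤ √e * jp := by
    refine bound _ _ hjp ((cs _ _ _ _ _ _).trans ?_)
    rw [← hjp2]
    refine mul_le_mul_of_nonneg_right ?_ (sq_nonneg _)
    have : (b2 * c - b3 * b) ^ 2 + (b3 * a - b1 * c) ^ 2 + (b1 * b - b2 * a) ^ 2
        = (b1 ^ 2 + b2 ^ 2 + b3 ^ 2) * (a ^ 2 + b ^ 2 + c ^ 2)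
          - (b1 * a + b2 * b + b3 * c) ^ 2 := by ring
    rw [this, h, he]
    nlinarith [sq_nonneg e1, sq_nonneg e2, sq_nonneg e3, sq_nonneg (b1 * a + b2 * b + b3 * c)]
  set X := e1 * (j1 - a * jw) + e2 * (j2 - b * jw) + e3 * (j3 - c * jw) with hX
  set Y := (b2 * c - b3 * b) * (j1 - a * jw) + (b3 * a - b1 * c) * (j2 - b * jw)
      + (b1 * b - b2 * a) * (j3 - c * jw) with hY
  have split : 4 * (e1 * j1 + e2 * j2 + e3 * j3) + f * (j0 * ρ
      + ((j2 * b3 - j3 * b2) * a + (j3 * b1 - j1 * b3) * b + (j1 * b2 - j2 * b1) * c))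
      = ρ * ((f / 2 + 2) * (j0 + jw)) + ρ * ((f / 2 - 2) * (j0 - jw)) + 4 * X + f * Y := by
    rw [hX, hY, hρ]
    ring
  have hf' := abs_le.1 hf
  have t1 : |ρ * ((f / 2 + 2) * (j0 + jw))| ≤ √e * (3 * |j0 + jw|) := by
    rw [abs_mul, abs_mul]
    gcongr
    rw [abs_le]; constructor <;> linarith
  have t2 : |ρ * ((f / 2 - 2) * (j0 - jw))| ≤ |ρ| * (3 * |j0 - jw|) := by
    rw [abs_mul, abs_mul]
    gcongr
    rw [abs_le]; constructor <;> linarith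
  have t3 : |4 * X| ≤ 4 * (√e * jp) := by
    rw [abs_mul]; norm_num; exact k2
  have t4 : |f * Y| ≤ 2 * (√e * jp) := by
    rw [abs_mul]; gcongr
  have t5 : 0 ≤ √e * |j0 + jw| := by positivity
  rw [split]
  have a1 := abs_add_le (ρ * ((f / 2 + 2) * (j0 + jw)) + ρ * ((f / 2 - 2) * (j0 - jw)) + 4 * X)
    (f * Y)
  have a2 := abs_add_le (ρ * ((f / 2 + 2) * (j0 + jw)) + ρ * ((f / 2 - 2) * (j0 - jw))) (4 * X)
  have a3 := abs_add_le (ρ * ((f / 2 + 2) * (j0 + jw))) (ρ * ((f / 2 - 2) * (j0 - jw)))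
  linarith

theorem fSq_nonneg (G : V → Fin 4 → Fin 4 → ℝ) (p : V) : 0 ≤ fSq G p := by
  unfold fSq; positivity

theorem sigmaSq_nonneg (G : V → Fin 4 → Fin 4 → ℝ) (p : V) : 0 ≤ sigmaSq G p := by
  unfold sigmaSq; positivity

theorem alphaSq_nonneg (G : V → Fin 4 → Fin 4 → ℝ) (p : V) : 0 ≤ alphaSq G p := by
  unfold alphaSq; positivity

theorem abarSq_nonneg (G : V → Fin 4 → Fin 4 → ℝ) (p : V) : 0 ≤ abarSq G p := by
  unfold abarSq; positivity

theorem rhoC_sq_add_sigmaSq_le {G : V → Fin 4 → Fin 4 → ℝ} (hA : AntiSym G) {p : V}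
    (hp : 0 < rad p) : rhoC G p ^ 2 + sigmaSq G p ≤ fSq G p := by
  have h := alphaSq_eq hA hp
  have := alphaSq_nonneg G p
  have := abarSq_nonneg G p
  linarith [h.1, h.2]

/-- The arithmetic behind the coercivity of the divergence of the energy current. -/
theorem coercivity_arith {ε W y f' g' e q j Z S : ℝ} (hε : 0 < ε) (hε1 : ε ≤ 1) (hwt : 0 < W)
    (m2 : ε * W ≤ f') (m3 : W ≤ y) (m4 : (1 / 2) * y ≤ g') (hq0 : 0 ≤ q) (hq : q ≤ e)
    (hZ : 0 ≤ Z) (hS' : S ≤ 3 * Z + 6 * (√e * j)) :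
    W * e + q * y ≤ (8 / ε) * (- (S - ((1 / 2) * f' * (e - q) + g' * q)))
      + (576 / ε ^ 2) * (W⁻¹ * j ^ 2 + Z) := by
  have he0 : 0 ≤ e := hq0.trans hq
  have hi0 : 0 ≤ y := hwt.le.trans m3
  have hb1 : (1 / 2) * (ε * W) * (e - q) ≤ (1 / 2) * f' * (e - q) :=
    mul_le_mul_of_nonneg_right (by linarith) (by linarith)
  have hb2 : (1 / 2) * y * q ≤ g' * q := mul_le_mul_of_nonneg_right m4 hq0
  have hb3 : (ε / 4) * (W * e + y * q) ≤ (1 / 2) * (ε * W) * (e - q) + (1 / 2) * y * q := by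
    have : W * q ≤ y * q := mul_le_mul_of_nonneg_right m3 hq0
    have : ε * (W * q) ≤ 1 * (y * q) := mul_le_mul hε1 this (by positivity) zero_le_one
    have : 0 ≤ ε * W * (e - q) := mul_nonneg (by positivity) (by linarith)
    have : ε * (y * q) ≤ 1 * (y * q) := mul_le_mul_of_nonneg_right hε1 (by positivity)
    have hWe : 0 ≤ ε * (W * q) := by positivity
    linarith
  have hb4 : 6 * (√e * j) ≤ (ε / 8) * (W * e) + (72 / ε) * (W⁻¹ * j ^ 2) := by
    have hse : √e ^ 2 = e := Real.sq_sqrt he0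
    have key : (ε / 8) * (W * e) + (72 / ε) * (W⁻¹ * j ^ 2) - 6 * (√e * j)
        = (8 * ε * W)⁻¹ * (ε * W * √e - 24 * j) ^ 2 := by
      have : ε * W ≠ 0 := (mul_pos hε hwt).ne'
      clear hS'
      generalize √e = x at *
      subst hse
      field_simp
      ring
    have : 0 ≤ (8 * ε * W)⁻¹ * (ε * W * √e - 24 * j) ^ 2 := by positivity
    linarith
  have hb5 : 0 ≤ y * q := by positivity
  have fin : (ε / 8) * (W * e + q * y) ≤ - (S - ((1 / 2) * f' * (e - q) + g' * q))
      + (72 / ε) * (W⁻¹ * j ^ 2) + 3 * Z := by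
    have : (ε / 8) * (y * q) ≤ (ε / 4) * (y * q) :=
      mul_le_mul_of_nonneg_right (by linarith) hb5
    linarith
  have hZ' : 24 / ε * Z ≤ 576 / ε ^ 2 * Z := by
    refine mul_le_mul_of_nonneg_right ?_ hZ
    rw [div_le_div_iff₀ hε (by positivity)]
    nlinarith
  calc W * e + q * y = (8 / ε) * ((ε / 8) * (W * e + q * y)) := by field_simp
    _ ≤ (8 / ε) * (- (S - ((1 / 2) * f' * (e - q) + g' * q))
      + (72 / ε) * (W⁻¹ * j ^ 2) + 3 * Z) := by gcongr
    _ = (8 / ε) * (- (S - ((1 / 2) * f' * (e - q) + g' * q)))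
      + 576 / ε ^ 2 * (W⁻¹ * j ^ 2) + 24 / ε * Z := by field_simp; ring
    _ ≤ _ := by linarith

set_option maxHeartbeats 800000 in
/-- The coercivity of the divergence of the energy current. -/
theorem bulkD_le {ε : ℝ} (hε : 0 < ε) (hε1 : ε ≤ 1) {G : V → Fin 4 → Fin 4 → ℝ}
    (hG : Smooth2Form G) (hA : AntiSym G) (hB : Bianchi G) {p : V} (hp : 0 < rad p) :
    bulkD ε G p ≤ (8 / ε) * (- stDiv (curT ε G) (curX ε G) p) + (576 / ε ^ 2) * srcD ε G p := by
  obtain ⟨a, b, c, h, ha, hb, hc⟩ := exists_direction hp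
  obtain ⟨h0, h1, h2⟩ := Pv_eq hp ha hb hc
  obtain ⟨m1, m2, m3, m4⟩ := mulG_bounds hε hε1 p
  have hρ := rhoC_eq hA hp ha hb hc
  have hσ := sigmaSq_eq hA hp h ha hb hc
  have hq := rhoC_sq_add_sigmaSq_le hA hp
  have ha' : p 1 / rad p = a := by rw [ha]; field_simp
  have hb' : p 2 / rad p = b := by rw [hb]; field_simp
  have hc' : p 3 / rad p = c := by rw [hc]; field_simp
  set J := divSnd G with hJ
  obtain ⟨jw, hjw⟩ : ∃ jw, jw = J p 1 * a + J p 2 * b + J p 3 * c := ⟨_, rfl⟩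
  have hL : ap1 J (Lv p) p = J p 0 + jw := by
    simp only [ap1, Lv, Fin.sum_univ_four, ha', hb', hc', hjw]; simp; ring
  have hLb : ap1 J (Lbv p) p = J p 0 - jw := by
    simp only [ap1, Lbv, Fin.sum_univ_four, ha', hb', hc', hjw]; simp; ring
  have hsl : JslashSq J p = (J p 1 - a * jw) ^ 2 + (J p 2 - b * jw) ^ 2
      + (J p 3 - c * jw) ^ 2 := by
    simp only [JslashSq, ap1, Fin.sum_univ_three, Fin.sum_univ_four, h0, h1, h2, hjw]
    simp
    ring
  have hsl0 : 0 ≤ JslashSq J p := by unfold JslashSq; positivity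
  have src := abs_source_le (j0 := J p 0) h m1 (fSq_eq hA p) (Real.sqrt_nonneg (JslashSq J p))
    (by rw [Real.sq_sqrt hsl0, hsl])
  have he0 := fSq_nonneg G p
  have hwt : 0 < rplus p ^ (-(1 + ε)) := Real.rpow_pos_of_pos (rplus_pos p) _
  have hwt' : rplus p ^ (1 + ε) = (rplus p ^ (-(1 + ε)))⁻¹ := by
    rw [Real.rpow_neg (rplus_pos p).le, inv_inv]
  rw [stDiv_cur ε hG hA hB, bulkD, srcD, JdensMix, ← hJ, hL, hLb, hwt', div_eq_mul_inv _ (1 + rad p)]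
  have e1 : (G p 0 1 * p 1 + G p 0 2 * p 2 + G p 0 3 * p 3) ^ 2
      + (G p 2 3 * p 1 + G p 3 1 * p 2 + G p 1 2 * p 3) ^ 2
      = rad p ^ 2 * (rhoC G p ^ 2 + sigmaSq G p) := by
    rw [hρ, hσ, ha, hb, hc]; ring
  rw [← hρ] at src
  have e2 : 4 * (G p 0 1 * J p 1 + G p 0 2 * J p 2 + G p 0 3 * J p 3)
      + mulG ε p * (J p 0 * (G p 0 1 * p 1 + G p 0 2 * p 2 + G p 0 3 * p 3)
        + (J p 2 * G p 1 2 - J p 3 * G p 3 1) * p 1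
        + (J p 3 * G p 2 3 - J p 1 * G p 1 2) * p 2
        + (J p 1 * G p 3 1 - J p 2 * G p 2 3) * p 3) =
      4 * (G p 0 1 * J p 1 + G p 0 2 * J p 2 + G p 0 3 * J p 3) +
        mulG ε p * rad p * (J p 0 * rhoC G p
        + ((J p 2 * G p 1 2 - J p 3 * G p 3 1) * a + (J p 3 * G p 2 3 - J p 1 * G p 1 2) * b
          + (J p 1 * G p 3 1 - J p 2 * G p 2 3) * c)) := by
    rw [hρ, ha, hb, hc]; ring
  have e3 : (1 / 2) * mulG ε p * fSq G p + 2 * mulG' ε p * ((1 / 2) * rad p ^ 2 * fSq G p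
        - (G p 0 1 * p 1 + G p 0 2 * p 2 + G p 0 3 * p 3) ^ 2
        - (G p 2 3 * p 1 + G p 3 1 * p 2 + G p 1 2 * p 3) ^ 2)
      = (1 / 2) * (mulG ε p + 2 * rad p ^ 2 * mulG' ε p)
          * (fSq G p - (rhoC G p ^ 2 + sigmaSq G p))
        + (mulG ε p - (mulG ε p + 2 * rad p ^ 2 * mulG' ε p) / 2)
          * (rhoC G p ^ 2 + sigmaSq G p) := by
    linear_combination (- 2 * mulG' ε p) * e1
  rw [e2, e3]
  set S := 4 * (G p 0 1 * J p 1 + G p 0 2 * J p 2 + G p 0 3 * J p 3) +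
        mulG ε p * rad p * (J p 0 * rhoC G p
        + ((J p 2 * G p 1 2 - J p 3 * G p 3 1) * a + (J p 3 * G p 2 3 - J p 1 * G p 1 2) * b
          + (J p 1 * G p 3 1 - J p 2 * G p 2 3) * c)) with hS
  have hS' := (le_abs_self S).trans src
  have hq0 : 0 ≤ rhoC G p ^ 2 + sigmaSq G p := add_nonneg (sq_nonneg _) (sigmaSq_nonneg G p)
  have hi0 : 0 ≤ (1 + rad p)⁻¹ := by have := rad_nonneg p; positivity
  have hZ : 0 ≤ |J p 0 - jw| * |rhoC G p| := by positivity
  exact coercivity_arith hε hε1 hwt m2 m3 m4 hq0 hq hZ hS'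

/-- The arithmetic behind the comparison of the fluxes of the energy current. -/
theorem flux_arith {f q α β : ℝ} (m1 : |f| ≤ 2) (hq0 : 0 ≤ q) (hα0 : 0 ≤ α) (hβ0 : 0 ≤ β) :
    (q + α ≤ 2 * (2 * (q + 1 / 2 * (α + β)) + f * (1 / 4 * (α - β))
        - (-4 * (1 / 4 * (α - β)) - f * (1 / 2 * (q + 1 / 2 * (α + β)) - q))) ∧
      2 * (q + 1 / 2 * (α + β)) + f * (1 / 4 * (α - β))
        - (-4 * (1 / 4 * (α - β)) - f * (1 / 2 * (q + 1 / 2 * (α + β)) - q)) ≤ 3 * (q + α)) ∧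
    (q + β ≤ 2 * (2 * (q + 1 / 2 * (α + β)) + f * (1 / 4 * (α - β))
        + (-4 * (1 / 4 * (α - β)) - f * (1 / 2 * (q + 1 / 2 * (α + β)) - q))) ∧
      2 * (q + 1 / 2 * (α + β)) + f * (1 / 4 * (α - β))
        + (-4 * (1 / 4 * (α - β)) - f * (1 / 2 * (q + 1 / 2 * (α + β)) - q)) ≤ 3 * (q + β)) ∧
    (q + 1 / 2 * (α + β) ≤ 2 * (2 * (q + 1 / 2 * (α + β)) + f * (1 / 4 * (α - β))) ∧
      2 * (q + 1 / 2 * (α + β)) + f * (1 / 4 * (α - β)) ≤ 3 * (q + 1 / 2 * (α + β))) := by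
  obtain ⟨f1, f2⟩ := abs_le.1 m1
  have p1 := mul_nonneg (sub_nonneg.2 f2) hq0
  have p2 := mul_nonneg (sub_nonneg.2 f2) hα0
  have p3 := mul_nonneg (sub_nonneg.2 f2) hβ0
  have p4 := mul_nonneg (sub_nonneg.2 f1) hq0
  have p5 := mul_nonneg (sub_nonneg.2 f1) hα0
  have p6 := mul_nonneg (sub_nonneg.2 f1) hβ0
  ring_nf at p1 p2 p3 p4 p5 p6
  refine ⟨⟨?_, ?_⟩, ⟨?_, ?_⟩, ?_, ?_⟩ <;> ring_nf <;> linarith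

set_option maxHeartbeats 800000 in
/-- The fluxes of the energy current through outgoing and incoming cones and time slices. -/
theorem flux_bounds {ε : ℝ} (hε : 0 < ε) (hε1 : ε ≤ 1) {G : V → Fin 4 → Fin 4 → ℝ}
    (hA : AntiSym G) {p : V} (hp : 0 < rad p) {a b c : ℝ} (ha : p 1 = rad p * a)
    (hb : p 2 = rad p * b) (hc : p 3 = rad p * c) :
    (rhoC G p ^ 2 + sigmaSq G p + alphaSq G p ≤
      2 * (curT ε G p - (a * curX ε G 0 p + b * curX ε G 1 p + c * curX ε G 2 p)) ∧
    curT ε G p - (a * curX ε G 0 p + b * curX ε G 1 p + c * curX ε G 2 p) ≤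
      3 * (rhoC G p ^ 2 + sigmaSq G p + alphaSq G p)) ∧
    (rhoC G p ^ 2 + sigmaSq G p + abarSq G p ≤
      2 * (curT ε G p + (a * curX ε G 0 p + b * curX ε G 1 p + c * curX ε G 2 p)) ∧
    curT ε G p + (a * curX ε G 0 p + b * curX ε G 1 p + c * curX ε G 2 p) ≤
      3 * (rhoC G p ^ 2 + sigmaSq G p + abarSq G p)) ∧
    (rhoC G p ^ 2 + sigmaSq G p + (1 / 2) * (alphaSq G p + abarSq G p) ≤ 2 * curT ε G p ∧
    curT ε G p ≤ 3 * (rhoC G p ^ 2 + sigmaSq G p + (1 / 2) * (alphaSq G p + abarSq G p))) := by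
  have h : a ^ 2 + b ^ 2 + c ^ 2 = 1 := by
    have := rad_sq p
    rw [ha, hb, hc] at this
    have h2 : rad p ^ 2 * (a ^ 2 + b ^ 2 + c ^ 2) = rad p ^ 2 * 1 := by linarith
    exact mul_left_cancel₀ (by positivity) h2
  obtain ⟨m1, -⟩ := mulG_bounds hε hε1 p
  have hρ := rhoC_eq hA hp ha hb hc
  have hσ := sigmaSq_eq hA hp h ha hb hc
  obtain ⟨hα, hβ⟩ := alphaSq_eq hA hp
  have hS : poynX G p / rad p = (G p 0 2 * G p 1 2 - G p 0 3 * G p 3 1) * a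
      + (G p 0 3 * G p 2 3 - G p 0 1 * G p 1 2) * b
      + (G p 0 1 * G p 3 1 - G p 0 2 * G p 2 3) * c := by
    rw [poynX, ha, hb, hc]; field_simp
  have hT : curT ε G p = 2 * fSq G p + (mulG ε p * rad p) * (poynX G p / rad p) := by
    rw [hS, fSq_eq hA, curT, ha, hb, hc]; ring
  have hX : a * curX ε G 0 p + b * curX ε G 1 p + c * curX ε G 2 p
      = - 4 * (poynX G p / rad p)
        - (mulG ε p * rad p) * ((1 / 2) * fSq G p - (rhoC G p ^ 2 + sigmaSq G p)) := by
    rw [hS, fSq_eq hA, hρ, hσ]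
    simp only [curX, Matrix.cons_val_zero, Matrix.cons_val_one, Matrix.cons_val, ha, hb, hc]
    linear_combination (- (1 / 2) * (mulG ε p * rad p) * (G p 0 1 ^ 2 + G p 0 2 ^ 2 + G p 0 3 ^ 2
      + G p 2 3 ^ 2 + G p 3 1 ^ 2 + G p 1 2 ^ 2)) * h
  rw [hT, hX]
  have hα0 := alphaSq_nonneg G p
  have hβ0 := abarSq_nonneg G p
  have hq0 : 0 ≤ rhoC G p ^ 2 + sigmaSq G p := add_nonneg (sq_nonneg _) (sigmaSq_nonneg G p)
  have e1 : fSq G p = rhoC G p ^ 2 + sigmaSq G p + (1 / 2) * (alphaSq G p + abarSq G p) := by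
    linarith
  have e2 : poynX G p / rad p = (1 / 4) * (alphaSq G p - abarSq G p) := by linarith
  rw [e1, e2]
  exact flux_arith m1 hq0 hα0 hβ0

/-! ### Spherical averages -/

theorem integrable_sphM {f : E3 → ℝ} (hf : Continuous f) : Integrable f sphM := by
  have := hf.continuousOn.integrableOn_compact (μ := sphM) (isCompact_sphere (0 : E3) 1)
  rwa [IntegrableOn, sphM_restrict] at this

theorem continuous_integral_sphM {X : Type*} [TopologicalSpace X] [FirstCountableTopology X]
    [LocallyCompactSpace X] {f : X → E3 → ℝ} (hf : Continuous fun z : X × E3 => f z.1 z.2) :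
    Continuous fun x => ∫ ω, f x ω ∂sphM := by
  have := continuous_parametric_integral_of_continuous (μ := sphM) (f := f) hf
    (isCompact_sphere (0 : E3) 1)
  rwa [sphM_restrict] at this

theorem hasDerivAt_integral_sphM {f f' : ℝ → E3 → ℝ}
    (hf : Continuous fun z : ℝ × E3 => f z.1 z.2) (hf' : Continuous fun z : ℝ × E3 => f' z.1 z.2)
    (h : ∀ s ω, HasDerivAt (fun s => f s ω) (f' s ω) s) (s : ℝ) :
    HasDerivAt (fun s => ∫ ω, f s ω ∂sphM) (∫ ω, f' s ω ∂sphM) s := by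
  have := hasDerivAt_setIntegral_of_isCompact (μ := sphM) (isCompact_sphere (0 : E3) 1) hf hf' h s
  rwa [sphM_restrict] at this

@[fun_prop]
theorem continuous_pt {X : Type*} [TopologicalSpace X] {t r : X → ℝ} {ω : X → E3}
    (ht : Continuous t) (hr : Continuous r) (hω : Continuous ω) :
    Continuous fun x => pt (t x) (r x) (ω x) := by
  refine continuous_pi fun i => ?_
  fin_cases i <;> simp [pt] <;> fun_prop

theorem continuous_pd {H : V → ℝ} (hH : ContDiff ℝ 1 H) (μ : Fin 4) : Continuous (pd μ H) :=
  (hH.continuous_fderiv one_ne_zero).clm_apply continuous_const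

theorem hasDerivAt_comp_curve {H : V → ℝ} (hH : ContDiff ℝ 1 H) {γ : ℝ → V} {γ' : V} {s : ℝ}
    (hγ : HasDerivAt γ γ' s) :
    HasDerivAt (fun s => H (γ s)) (∑ μ, γ' μ * pd μ H (γ s)) s := by
  have h := ((hH.differentiable one_ne_zero (γ s)).hasFDerivAt).comp_hasDerivAt s hγ
  refine h.congr_deriv ?_
  have e : γ' = ∑ μ, γ' μ • (Pi.single μ (1 : ℝ) : V) := by
    ext k; simp [Finset.sum_apply, Pi.single_apply]
  conv_lhs => rw [e]
  simp [pd, map_sum]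

/-- The rotation by `θ` in the plane of the `i`-th and `j`-th coordinates. -/
def planeRotLin (i j : Fin 3) (θ : ℝ) : E3 →ₗ[ℝ] E3 where
  toFun x := WithLp.toLp 2 fun k => if k = i then Real.cos θ * x i - Real.sin θ * x j
    else if k = j then Real.sin θ * x i + Real.cos θ * x j else x k
  map_add' x y := by ext k; simp only [PiLp.add_apply]; split_ifs <;> ring
  map_smul' c x := by ext k; simp only [PiLp.smul_apply, smul_eq_mul, RingHom.id_apply]; split_ifs <;> ring

theorem planeRotLin_apply (i j : Fin 3) (θ : ℝ) (x : E3) (k : Fin 3) :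
    planeRotLin i j θ x k = if k = i then Real.cos θ * x i - Real.sin θ * x j
    else if k = j then Real.sin θ * x i + Real.cos θ * x j else x k := rfl

theorem norm_planeRotLin {i j : Fin 3} (hij : i ≠ j) (θ : ℝ) (x : E3) :
    ‖planeRotLin i j θ x‖ = ‖x‖ := by
  rw [EuclideanSpace.norm_eq, EuclideanSpace.norm_eq]
  congr 1
  simp only [Real.norm_eq_abs, sq_abs, planeRotLin_apply, Fin.sum_univ_three]
  have := Real.sin_sq_add_cos_sq θ
  fin_cases i <;> fin_cases j <;> simp at hij ⊢ <;>
    first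
    | linear_combination (x 0 ^ 2 + x 1 ^ 2) * this
    | linear_combination (x 0 ^ 2 + x 2 ^ 2) * this
    | linear_combination (x 1 ^ 2 + x 2 ^ 2) * this

/-- The rotation by `θ` in the plane of the `i`-th and `j`-th coordinates, as an isometry. -/
def planeRot {i j : Fin 3} (hij : i ≠ j) (θ : ℝ) : E3 ≃ₗᵢ[ℝ] E3 :=
  LinearIsometry.toLinearIsometryEquiv ⟨planeRotLin i j θ, norm_planeRotLin hij θ⟩ rfl

theorem integral_sphM_rotation_field {H : V → ℝ} (hH : ContDiff ℝ 1 H) (t r : ℝ) {i j : Fin 3}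
    (hij : i ≠ j) :
    ∫ ω, (pt t r ω i.succ * pd j.succ H (pt t r ω) - pt t r ω j.succ * pd i.succ H (pt t r ω)) ∂sphM
      = 0 := by
  have hc : Continuous fun z : ℝ × E3 => planeRotLin i j z.1 z.2 := by
    refine (PiLp.continuous_toLp 2 _).comp (continuous_pi fun k => ?_)
    dsimp only
    split_ifs <;> fun_prop
  set f : ℝ → E3 → ℝ := fun θ ω => H (pt t r (planeRotLin i j θ ω)) with hf
  set D : ℝ → E3 → V := fun θ ω => fun μ =>
    (if μ = i.succ then r * (- Real.sin θ * ω i - Real.cos θ * ω j) else 0)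
      + (if μ = j.succ then r * (Real.cos θ * ω i - Real.sin θ * ω j) else 0) with hD
  set f' : ℝ → E3 → ℝ := fun θ ω => ∑ μ, D θ ω μ * pd μ H (pt t r (planeRotLin i j θ ω)) with hf'
  have hfc : Continuous fun z : ℝ × E3 => f z.1 z.2 := by
    have := hH.continuous
    simp only [hf]; fun_prop
  have hfc' : Continuous fun z : ℝ × E3 => f' z.1 z.2 := by
    have := continuous_pd hH
    simp only [hf', hD]
    refine continuous_finsetSum _ fun μ _ => ?_
    refine Continuous.mul (Continuous.add ?_ ?_) (by fun_prop) <;> split_ifs <;> fun_prop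
  have hder : ∀ θ ω, HasDerivAt (fun θ => f θ ω) (f' θ ω) θ := by
    intro θ ω
    refine hasDerivAt_comp_curve hH (hasDerivAt_pi.2 fun μ => ?_)
    have c1 : ∀ a : ℝ, HasDerivAt (fun θ => Real.cos θ * a) (- Real.sin θ * a) θ :=
      fun a => (Real.hasDerivAt_cos θ).mul_const a
    have s1 : ∀ a : ℝ, HasDerivAt (fun θ => Real.sin θ * a) (Real.cos θ * a) θ :=
      fun a => (Real.hasDerivAt_sin θ).mul_const a
    have hk : ∀ k : Fin 3, HasDerivAt (fun θ => r * planeRotLin i j θ ω k)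
        ((if k = i then r * (- Real.sin θ * ω i - Real.cos θ * ω j) else 0)
      + (if k = j then r * (Real.cos θ * ω i - Real.sin θ * ω j) else 0)) θ := by
      intro k
      simp only [planeRotLin_apply]
      by_cases h1 : k = i
      · subst h1
        simp only [if_true, if_neg hij, add_zero]
        exact ((c1 _).sub (s1 _)).const_mul r
      · by_cases h2 : k = j
        · subst h2
          simp only [if_true, if_neg h1, zero_add]
          refine (((s1 _).add (c1 _)).const_mul r).congr_deriv (by ring)
        · simp only [if_neg h1, if_neg h2, zero_add]
          exact hasDerivAt_const _ _
    refine Fin.cases ?_ (fun k => ?_) μ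
    · refine (hasDerivAt_const θ t).congr_deriv ?_
      simp [hD, (Fin.succ_ne_zero _).symm]
    · have e : (fun θ => pt t r (planeRotLin i j θ ω) k.succ) = fun θ => r * planeRotLin i j θ ω k := by
        funext θ; fin_cases k <;> rfl
      rw [e]
      refine (hk k).congr_deriv ?_
      simp [hD, Fin.succ_inj]
  have h1 := hasDerivAt_integral_sphM hfc hfc' hder 0
  have h2 : (fun θ => ∫ ω, f θ ω ∂sphM) = fun _ => ∫ ω, H (pt t r ω) ∂sphM := by
    funext θ
    have mp : MeasurePreserving (planeRot hij θ) sphM sphM :=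
      ⟨(planeRot hij θ).continuous.measurable, sphM_map _⟩
    exact mp.integral_comp (planeRot hij θ).toHomeomorph.measurableEmbedding
      (fun ω => H (pt t r ω))
  rw [h2] at h1
  have h3 := h1.unique (hasDerivAt_const _ _)
  rw [← h3]
  refine integral_congr_ae (ae_of_all _ fun ω => ?_)
  have e0 : planeRotLin i j 0 ω = ω := by
    ext k; rw [planeRotLin_apply]; split_ifs with h h' <;> simp [*]
  have e1 : ∀ k : Fin 3, pt t r ω k.succ = r * ω k := by intro k; fin_cases k <;> rfl
  simp only [hf', hD, e0, e1, add_mul, ite_mul, zero_mul, Finset.sum_add_distrib,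
    Finset.sum_ite_eq', Finset.mem_univ, if_true, Real.sin_zero, Real.cos_zero]
  ring

theorem pt_succ (t r : ℝ) (ω : E3) (k : Fin 3) : pt t r ω k.succ = r * ω k := by
  fin_cases k <;> rfl

theorem pt_zero (t r : ℝ) (ω : E3) : pt t r ω 0 = t := rfl

/-- The charge of a current through a sphere. -/
def sA (P₀ : V → ℝ) (t r : ℝ) : ℝ := ∫ ω, r ^ 2 * P₀ (pt t r ω) ∂sphM

/-- The radial flux of a current through a sphere. -/
def sB (P : Fin 3 → V → ℝ) (t r : ℝ) : ℝ := ∫ ω, r ^ 2 * ∑ j, ω j * P j (pt t r ω) ∂sphM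

/-- The radial part of the derivative of `sB`. -/
def sBr (P : Fin 3 → V → ℝ) (t r : ℝ) : ℝ :=
  ∫ ω, (2 * r * ∑ j, ω j * P j (pt t r ω)
    + r ^ 2 * ∑ j, ω j * ∑ i : Fin 3, ω i * pd i.succ (P j) (pt t r ω)) ∂sphM

section Current

variable {P₀ : V → ℝ} {P : Fin 3 → V → ℝ}

theorem continuous_stDiv (hP₀ : ContDiff ℝ 1 P₀) (hP : ∀ i, ContDiff ℝ 1 (P i)) :
    Continuous (stDiv P₀ P) := by
  have h0 := continuous_pd hP₀
  have h1 := fun i => continuous_pd (hP i)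
  unfold stDiv
  fun_prop

theorem continuous_sA (hP₀ : Continuous P₀) : Continuous fun z : ℝ × ℝ => sA P₀ z.1 z.2 :=
  continuous_integral_sphM (X := ℝ × ℝ) (f := fun z ω => z.2 ^ 2 * P₀ (pt z.1 z.2 ω)) (by fun_prop)

theorem continuous_sB (hP : ∀ i, Continuous (P i)) :
    Continuous fun z : ℝ × ℝ => sB P z.1 z.2 :=
  continuous_integral_sphM (X := ℝ × ℝ)
    (f := fun z ω => z.2 ^ 2 * ∑ j, ω j * P j (pt z.1 z.2 ω)) (by fun_prop)

theorem continuous_sBr (hP : ∀ i, ContDiff ℝ 1 (P i)) :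
    Continuous fun z : ℝ × ℝ => sBr P z.1 z.2 := by
  have h0 := fun i => (hP i).continuous
  have h1 := fun i => continuous_pd (hP i)
  exact continuous_integral_sphM (X := ℝ × ℝ) (f := fun z ω => 2 * z.2 * ∑ j, ω j * P j (pt z.1 z.2 ω)
    + z.2 ^ 2 * ∑ j, ω j * ∑ i : Fin 3, ω i * pd i.succ (P j) (pt z.1 z.2 ω)) (by fun_prop)

theorem hasDerivAt_pt_line (c κ : ℝ) (ω : E3) (s : ℝ) :
    HasDerivAt (fun s => pt (c + κ * s) s ω) (fun μ => if μ = 0 then κ else pt 0 1 ω μ) s := by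
  refine hasDerivAt_pi.2 fun μ => ?_
  refine Fin.cases ?_ (fun k => ?_) μ
  · simp only [pt_zero, if_true]
    simpa using ((hasDerivAt_id s).const_mul κ).const_add c
  · simp only [pt_succ, if_neg (Fin.succ_ne_zero k)]
    simpa using (hasDerivAt_id s).mul_const (ω k)

theorem hasDerivAt_pt_time (r : ℝ) (ω : E3) (t : ℝ) :
    HasDerivAt (fun t => pt t r ω) (Pi.single 0 1) t := by
  refine hasDerivAt_pi.2 fun μ => ?_
  refine Fin.cases ?_ (fun k => ?_) μ
  · simp only [pt_zero, Pi.single_eq_same]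
    exact hasDerivAt_id' t
  · simpa [pt_succ] using hasDerivAt_const t (r * ω k)

theorem hasDerivAt_comp_pt_line {H : V → ℝ} (hH : ContDiff ℝ 1 H) (c κ : ℝ) (ω : E3) (s : ℝ) :
    HasDerivAt (fun s => H (pt (c + κ * s) s ω)) (κ * pd 0 H (pt (c + κ * s) s ω)
      + ∑ i : Fin 3, ω i * pd i.succ H (pt (c + κ * s) s ω)) s := by
  refine (hasDerivAt_comp_curve hH (hasDerivAt_pt_line c κ ω s)).congr_deriv ?_
  simp [Fin.sum_univ_succ (n := 3), pt_succ]

theorem hasDerivAt_comp_pt_time {H : V → ℝ} (hH : ContDiff ℝ 1 H) (r : ℝ) (ω : E3) (t : ℝ) :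
    HasDerivAt (fun t => H (pt t r ω)) (pd 0 H (pt t r ω)) t := by
  refine (hasDerivAt_comp_curve hH (hasDerivAt_pt_time r ω t)).congr_deriv ?_
  simp [Pi.single_apply]

theorem hasDerivAt_sA (hP₀ : ContDiff ℝ 1 P₀) (r t : ℝ) :
    HasDerivAt (fun t => sA P₀ t r) (sA (pd 0 P₀) t r) t := by
  have h0 := hP₀.continuous
  have h1 := continuous_pd hP₀ 0
  exact hasDerivAt_integral_sphM (f := fun t ω => r ^ 2 * P₀ (pt t r ω))
    (f' := fun t ω => r ^ 2 * pd 0 P₀ (pt t r ω)) (by fun_prop) (by fun_prop)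
    (fun t ω => (hasDerivAt_comp_pt_time hP₀ r ω t).const_mul _) t

theorem hasDerivAt_sB_time (hP : ∀ i, ContDiff ℝ 1 (P i)) (r t : ℝ) :
    HasDerivAt (fun t => sB P t r) (sB (fun j => pd 0 (P j)) t r) t := by
  have h0 := fun i => (hP i).continuous
  have h1 := fun i => continuous_pd (hP i) 0
  exact hasDerivAt_integral_sphM (f := fun t ω => r ^ 2 * ∑ j, ω j * P j (pt t r ω))
    (f' := fun t ω => r ^ 2 * ∑ j, ω j * pd 0 (P j) (pt t r ω)) (by fun_prop) (by fun_prop)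
    (fun t ω => (HasDerivAt.fun_sum fun j _ =>
      (hasDerivAt_comp_pt_time (hP j) r ω t).const_mul _).const_mul _) t

theorem integrable_sB (hP : ∀ i, Continuous (P i)) (t r : ℝ) :
    Integrable (fun ω : E3 => r ^ 2 * ∑ j, ω j * P j (pt t r ω)) sphM :=
  integrable_sphM (by fun_prop)

theorem hasDerivAt_sB_line (hP : ∀ i, ContDiff ℝ 1 (P i)) (c κ s : ℝ) :
    HasDerivAt (fun s => sB P (c + κ * s) s)
      (κ * sB (fun j => pd 0 (P j)) (c + κ * s) s + sBr P (c + κ * s) s) s := by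
  have h0 := fun i => (hP i).continuous
  have h1 := fun i => continuous_pd (hP i)
  have := hasDerivAt_integral_sphM
    (f := fun s ω => s ^ 2 * ∑ j, ω j * P j (pt (c + κ * s) s ω))
    (f' := fun s ω => κ * (s ^ 2 * ∑ j, ω j * pd 0 (P j) (pt (c + κ * s) s ω))
      + (2 * s * ∑ j, ω j * P j (pt (c + κ * s) s ω)
        + s ^ 2 * ∑ j, ω j * ∑ i : Fin 3, ω i * pd i.succ (P j) (pt (c + κ * s) s ω)))
    (by fun_prop) (by fun_prop) (fun s ω => by
      have h2 := (hasDerivAt_pow 2 s).mul (HasDerivAt.fun_sum (u := Finset.univ) fun j _ =>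
        (hasDerivAt_comp_pt_line (hP j) c κ ω s).const_mul (ω j))
      refine h2.congr_deriv ?_
      simp only [mul_add, Finset.sum_add_distrib, Finset.mul_sum]
      push_cast
      simp only [pow_one]
      have e : ∀ j, s ^ 2 * (ω j * (κ * pd 0 (P j) (pt (c + κ * s) s ω)))
        = κ * (s ^ 2 * (ω j * pd 0 (P j) (pt (c + κ * s) s ω))) := fun j => by ring
      simp only [e]
      ring) s
  refine this.congr_deriv ?_
  rw [integral_add ((integrable_sB (P := fun j => pd 0 (P j)) (fun i => h1 i 0) _ _).const_mul κ)
    (integrable_sphM (by fun_prop)), integral_const_mul]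
  rfl

/-- The averaged form of the divergence in spherical coordinates. -/
theorem sA_pd_add_sBr (hP₀ : ContDiff ℝ 1 P₀) (hP : ∀ i, ContDiff ℝ 1 (P i)) (t r : ℝ) :
    sA (pd 0 P₀) t r + sBr P t r = sA (stDiv P₀ P) t r := by
  have h0 := fun i => (hP i).continuous
  have h1 := fun i => continuous_pd (hP i)
  have h2 := continuous_pd hP₀
  have h3 := continuous_stDiv hP₀ hP
  set K : Fin 3 → Fin 3 → V → ℝ := fun i j p => p i.succ * P j p - p j.succ * P i p with hK
  have hKc : ∀ i j, ContDiff ℝ 1 (K i j) := fun i j => by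
    have := hP i; have := hP j; simp only [hK]; fun_prop
  have hKp : ∀ i j μ, Continuous (pd μ (K i j)) := fun i j => continuous_pd (hKc i j)
  set Q : Fin 3 → Fin 3 → E3 → ℝ := fun i j ω =>
    pt t r ω i.succ * pd j.succ (K i j) (pt t r ω) - pt t r ω j.succ * pd i.succ (K i j) (pt t r ω)
    with hQ
  have hQc : ∀ i j, Integrable (Q i j) sphM := fun i j => by
    have := hKp i j i.succ
    have := hKp i j j.succ
    refine integrable_sphM ?_
    simp only [hQ, pt_succ]
    fun_prop
  have hQ0 : ∀ i j, i ≠ j → ∫ ω, Q i j ω ∂sphM = 0 := fun i j hij =>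
    integral_sphM_rotation_field (hKc i j) t r hij
  have key : ∫ ω, (Q 0 1 ω + Q 0 2 ω + Q 1 2 ω) ∂sphM = 0 := by
    have a1 := integral_add (hQc 0 1) (hQc 0 2)
    have a2 := integral_add ((hQc 0 1).add (hQc 0 2)) (hQc 1 2)
    simp only [Pi.add_apply] at a1 a2
    rw [a2, a1, hQ0 0 1 (by decide), hQ0 0 2 (by decide), hQ0 1 2 (by decide)]
    norm_num
  have e : (fun ω => r ^ 2 * stDiv P₀ P (pt t r ω)) =ᵐ[sphM] fun ω =>
      (r ^ 2 * pd 0 P₀ (pt t r ω) + (2 * r * ∑ j, ω j * P j (pt t r ω)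
        + r ^ 2 * ∑ j, ω j * ∑ i : Fin 3, ω i * pd i.succ (P j) (pt t r ω)))
        + (Q 0 1 ω + Q 0 2 ω + Q 1 2 ω) := by
    filter_upwards [ae_sphM] with ω hω
    have hs : ω 0 ^ 2 + ω 1 ^ 2 + ω 2 ^ 2 = 1 := by
      have h5 := EuclideanSpace.real_norm_sq_eq ω
      rw [mem_sphere_zero_iff_norm.1 hω, Fin.sum_univ_three] at h5
      linarith
    have hd : ∀ i, DifferentiableAt ℝ (P i) (pt t r ω) := fun i =>
      (hP i).differentiable one_ne_zero _
    have hx : ∀ i : Fin 4, DifferentiableAt ℝ (fun q : V => q i) (pt t r ω) := fun i => by fun_prop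
    have hpdK : ∀ i j μ, pd μ (K i j) (pt t r ω) =
        (pt t r ω i.succ * pd μ (P j) (pt t r ω) + (if μ = i.succ then 1 else 0) * P j (pt t r ω))
        - (pt t r ω j.succ * pd μ (P i) (pt t r ω)
          + (if μ = j.succ then 1 else 0) * P i (pt t r ω)) := fun i j μ => by
      simp only [hK]
      rw [pd_sub (p := pt t r ω) (f := fun p => p i.succ * P j p) (g := fun p => p j.succ * P i p)
        (μ := μ) (by fun_prop (disch := exact hd _)) (by fun_prop (disch := exact hd _)),
        pd_mul (μ := μ) (hx _) (hd _), pd_mul (μ := μ) (hx _) (hd _), pd_coord, pd_coord]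
    simp only [hQ, hpdK, pt_succ, stDiv, Fin.sum_univ_three, Fin.succ_inj]
    simp
    linear_combination (r ^ 2 * (pd 1 (P 0) (pt t r ω) + pd 2 (P 1) (pt t r ω)
      + pd 3 (P 2) (pt t r ω))) * (-hs)
  have i1 : Integrable (fun ω : E3 => r ^ 2 * pd 0 P₀ (pt t r ω)) sphM :=
    integrable_sphM (by fun_prop)
  have i2 : Integrable (fun ω : E3 => 2 * r * ∑ j, ω j * P j (pt t r ω)
        + r ^ 2 * ∑ j, ω j * ∑ i : Fin 3, ω i * pd i.succ (P j) (pt t r ω)) sphM :=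
    integrable_sphM (by fun_prop)
  have a1 := integral_add (i1.add i2) (((hQc 0 1).add (hQc 0 2)).add (hQc 1 2))
  have a2 := integral_add i1 i2
  simp only [Pi.add_apply] at a1 a2
  rw [sA, sBr, sA, integral_congr_ae e, a1, a2, key, add_zero]

end Current

/-! ### Energy identities in the interior and exterior regions -/

section Fluxes

variable {P₀ : V → ℝ} {P : Fin 3 → V → ℝ}

/-- The flux of a current through a segment of an outgoing cone. -/
def outFlux (P₀ : V → ℝ) (P : Fin 3 → V → ℝ) (u v₀ v₁ : ℝ) : ℝ :=
  ∫ v in v₀..v₁, (sA P₀ (u + v) (v - u) - sB P (u + v) (v - u))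

/-- The flux of a current through a segment of an incoming cone. -/
def inFlux (P₀ : V → ℝ) (P : Fin 3 → V → ℝ) (v u₀ u₁ : ℝ) : ℝ :=
  ∫ u in u₀..u₁, (sA P₀ (u + v) (v - u) + sB P (u + v) (v - u))

theorem hasDerivAt_sB_radial (hP : ∀ i, ContDiff ℝ 1 (P i)) (t r : ℝ) :
    HasDerivAt (fun s => sB P t s) (sBr P t r) r := by
  simpa using hasDerivAt_sB_line hP t 0 r

theorem continuous₂_comp {f : ℝ → ℝ → ℝ} (hf : Continuous fun z : ℝ × ℝ => f z.1 z.2)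
    {X : Type*} [TopologicalSpace X] {g h : X → ℝ} (hg : Continuous g) (hh : Continuous h) :
    Continuous fun x => f (g x) (h x) :=
  hf.comp (hg.prodMk hh)

theorem sB_zero_radius (t : ℝ) : sB P t 0 = 0 := by simp [sB]

theorem cylinder_identity (hP₀ : ContDiff ℝ 1 P₀) (hP : ∀ i, ContDiff ℝ 1 (P i)) (R τ₁ τ₂ : ℝ) :
    (∫ r in (0 : ℝ)..R, sA P₀ τ₂ r) - (∫ r in (0 : ℝ)..R, sA P₀ τ₁ r)
      = (∫ τ in τ₁..τ₂, ∫ r in (0 : ℝ)..R, sA (stDiv P₀ P) τ r) - ∫ τ in τ₁..τ₂, sB P τ R := by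
  have hPc := fun i => (hP i).continuous
  have := integral_divergence_moving (continuous_sA hP₀.continuous)
    (continuous_sA (continuous_pd hP₀ 0)) (continuous_sB hPc) (continuous_sBr hP)
    (fun t r => hasDerivAt_sA hP₀ r t) (fun t r => hasDerivAt_sB_radial hP t r)
    (ρ₁ := fun _ => 0) (ρ₂ := fun _ => R) (fun t => hasDerivAt_const t _)
    (fun t => hasDerivAt_const t _) τ₁ τ₂
  simp only [sA_pd_add_sBr hP₀ hP, sB_zero_radius, zero_mul, zero_sub,
    intervalIntegral.integral_neg, intervalIntegral.integral_zero, sub_zero] at this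
  rw [this]; ring

theorem outer_identity (hP₀ : ContDiff ℝ 1 P₀) (hP : ∀ i, ContDiff ℝ 1 (P i)) (R τ₁ τ₂ v₀ : ℝ) :
    outFlux P₀ P ((τ₂ - R) / 2) ((τ₂ + R) / 2) v₀ - outFlux P₀ P ((τ₁ - R) / 2) ((τ₁ + R) / 2) v₀
      = (∫ τ in τ₁..τ₂, ∫ r in R..v₀ + R / 2 - τ / 2, sA (stDiv P₀ P) (τ + (r - R)) r)
        - inFlux P₀ P v₀ ((τ₁ - R) / 2) ((τ₂ - R) / 2) + ∫ τ in τ₁..τ₂, sB P τ R := by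
  have hPc := fun i => (hP i).continuous
  have cA := continuous_sA hP₀.continuous
  have cA' := continuous_sA (continuous_pd hP₀ 0)
  have cB := continuous_sB hPc
  have cBt := continuous_sB (P := fun j => pd 0 (P j)) (fun i => continuous_pd (hP i) 0)
  have cBr := continuous_sBr hP
  have hshift : ∀ τ r : ℝ, HasDerivAt (fun τ => τ + (r - R)) 1 τ := fun τ r => by
    simpa using (hasDerivAt_id τ).add_const (r - R)
  have h := integral_divergence_moving
    (a := fun τ r => sA P₀ (τ + (r - R)) r - sB P (τ + (r - R)) r)
    (a' := fun τ r => sA (pd 0 P₀) (τ + (r - R)) r - sB (fun j => pd 0 (P j)) (τ + (r - R)) r)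
    (b := fun τ r => sB P (τ + (r - R)) r)
    (b' := fun τ r => sB (fun j => pd 0 (P j)) (τ + (r - R)) r + sBr P (τ + (r - R)) r)
    ((continuous₂_comp cA (by fun_prop) (by fun_prop)).sub
      (continuous₂_comp cB (by fun_prop) (by fun_prop)))
    ((continuous₂_comp cA' (by fun_prop) (by fun_prop)).sub
      (continuous₂_comp cBt (by fun_prop) (by fun_prop)))
    (continuous₂_comp cB (by fun_prop) (by fun_prop))
    ((continuous₂_comp cBt (by fun_prop) (by fun_prop)).add
      (continuous₂_comp cBr (by fun_prop) (by fun_prop)))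
    (fun τ r => by
      have h1 := (hasDerivAt_sA hP₀ r (τ + (r - R))).comp τ (hshift τ r)
      have h2 := (hasDerivAt_sB_time hP r (τ + (r - R))).comp τ (hshift τ r)
      rw [mul_one] at h1 h2
      exact h1.sub h2)
    (fun τ r => by
      have h1 := hasDerivAt_sB_line hP (τ - R) 1 r
      have e : ∀ s : ℝ, τ - R + 1 * s = τ + (s - R) := fun s => by ring
      simp only [e] at h1
      rwa [one_mul] at h1)
    (ρ₁ := fun _ => R) (ρ₂ := fun τ => v₀ + R / 2 - τ / 2) (β₁ := 0) (β₂ := -(1 / 2))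
    (fun t => hasDerivAt_const t _)
    (fun t => by simpa using ((hasDerivAt_id t).div_const 2).const_sub (v₀ + R / 2)) τ₁ τ₂
  have hd : ∀ t r, sA (pd 0 P₀) t r - sB (fun j => pd 0 (P j)) t r
      + (sB (fun j => pd 0 (P j)) t r + sBr P t r) = sA (stDiv P₀ P) t r := fun t r => by
    rw [← sA_pd_add_sBr hP₀ hP]; ring
  simp only [hd] at h
  have ho : ∀ τ : ℝ, ∫ r in R..v₀ + R / 2 - τ / 2,
      (sA P₀ (τ + (r - R)) r - sB P (τ + (r - R)) r)
      = outFlux P₀ P ((τ - R) / 2) ((τ + R) / 2) v₀ := fun τ => by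
    have := intervalIntegral.integral_comp_sub_right (a := (τ + R) / 2) (b := v₀)
      (fun r => sA P₀ (τ + (r - R)) r - sB P (τ + (r - R)) r) ((τ - R) / 2)
    rw [outFlux]
    convert this.symm using 2
    · ring
    · ring
    · funext v; congr 2 <;> ring
  have hi : ∫ τ in τ₁..τ₂, (-(1 / 2) * (sA P₀ (τ + (v₀ + R / 2 - τ / 2 - R)) (v₀ + R / 2 - τ / 2)
        - sB P (τ + (v₀ + R / 2 - τ / 2 - R)) (v₀ + R / 2 - τ / 2))
        - sB P (τ + (v₀ + R / 2 - τ / 2 - R)) (v₀ + R / 2 - τ / 2))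
      = - inFlux P₀ P v₀ ((τ₁ - R) / 2) ((τ₂ - R) / 2) := by
    have := intervalIntegral.integral_comp_div_sub (a := τ₁) (b := τ₂)
      (fun u => sA P₀ (u + v₀) (v₀ - u) + sB P (u + v₀) (v₀ - u)) (two_ne_zero (α := ℝ)) (R / 2)
    rw [show τ₁ / 2 - R / 2 = (τ₁ - R) / 2 by ring, show τ₂ / 2 - R / 2 = (τ₂ - R) / 2 by ring] at this
    have e2 : inFlux P₀ P v₀ ((τ₁ - R) / 2) ((τ₂ - R) / 2) = (1 / 2) *
      ∫ τ in τ₁..τ₂, (sA P₀ (τ / 2 - R / 2 + v₀) (v₀ - (τ / 2 - R / 2))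
        + sB P (τ / 2 - R / 2 + v₀) (v₀ - (τ / 2 - R / 2))) := by
      rw [this, inFlux, smul_eq_mul]; ring
    rw [e2, ← intervalIntegral.integral_const_mul, ← intervalIntegral.integral_neg]
    refine intervalIntegral.integral_congr fun τ _ => ?_
    rw [show τ + (v₀ + R / 2 - τ / 2 - R) = τ / 2 - R / 2 + v₀ by ring,
      show v₀ + R / 2 - τ / 2 = v₀ - (τ / 2 - R / 2) by ring]
    ring
  have hb : ∫ τ in τ₁..τ₂, (0 * (sA P₀ (τ + (R - R)) R - sB P (τ + (R - R)) R)
      - sB P (τ + (R - R)) R) = - ∫ τ in τ₁..τ₂, sB P τ R := by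
    simp
  rw [ho, ho, hi, hb] at h
  rw [h]; ring

/-- The energy identity in the interior region. -/
theorem interior_identity (hP₀ : ContDiff ℝ 1 P₀) (hP : ∀ i, ContDiff ℝ 1 (P i))
    (R τ₁ τ₂ v₀ : ℝ) :
    (∫ r in (0 : ℝ)..R, sA P₀ τ₂ r) + outFlux P₀ P ((τ₂ - R) / 2) ((τ₂ + R) / 2) v₀
      + inFlux P₀ P v₀ ((τ₁ - R) / 2) ((τ₂ - R) / 2)
      - ((∫ τ in τ₁..τ₂, ∫ r in (0 : ℝ)..R, sA (stDiv P₀ P) τ r)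
        + ∫ τ in τ₁..τ₂, ∫ r in R..v₀ + R / 2 - τ / 2, sA (stDiv P₀ P) (τ + (r - R)) r)
      = (∫ r in (0 : ℝ)..R, sA P₀ τ₁ r) + outFlux P₀ P ((τ₁ - R) / 2) ((τ₁ + R) / 2) v₀ := by
  have h1 := cylinder_identity hP₀ hP R τ₁ τ₂
  have h2 := outer_identity hP₀ hP R τ₁ τ₂ v₀
  linarith

/-- The energy identity in the exterior region. -/
theorem exterior_identity (hP₀ : ContDiff ℝ 1 P₀) (hP : ∀ i, ContDiff ℝ 1 (P i)) (u₁ v₂ : ℝ) :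
    outFlux P₀ P u₁ (-u₁) v₂ + inFlux P₀ P v₂ (-v₂) u₁
      - (∫ t in (0 : ℝ)..v₂ + u₁, ∫ r in t - 2 * u₁..2 * v₂ - t, sA (stDiv P₀ P) t r)
      = ∫ r in -(2 * u₁)..2 * v₂, sA P₀ 0 r := by
  have hPc := fun i => (hP i).continuous
  have cA := continuous_sA hP₀.continuous
  have cB := continuous_sB hPc
  have h := integral_divergence_moving cA
    (continuous_sA (continuous_pd hP₀ 0)) cB (continuous_sBr hP)
    (fun t r => hasDerivAt_sA hP₀ r t) (fun t r => hasDerivAt_sB_radial hP t r)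
    (ρ₁ := fun t => t - 2 * u₁) (ρ₂ := fun t => 2 * v₂ - t) (β₁ := 1) (β₂ := -1)
    (fun t => (hasDerivAt_id' t).sub_const _)
    (fun t => (hasDerivAt_id' t).const_sub _) 0 (v₂ + u₁)
  simp only [sA_pd_add_sBr hP₀ hP] at h
  have e1 : ∫ t in (0 : ℝ)..v₂ + u₁, (-1 * sA P₀ t (2 * v₂ - t) - sB P t (2 * v₂ - t))
      = - inFlux P₀ P v₂ (-v₂) u₁ := by
    have := intervalIntegral.integral_comp_add_right (a := -v₂) (b := u₁)
      (fun t => sA P₀ t (2 * v₂ - t) + sB P t (2 * v₂ - t)) v₂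
    rw [show -v₂ + v₂ = 0 by ring, show u₁ + v₂ = v₂ + u₁ by ring] at this
    have e2 : inFlux P₀ P v₂ (-v₂) u₁
        = ∫ t in (0 : ℝ)..v₂ + u₁, (sA P₀ t (2 * v₂ - t) + sB P t (2 * v₂ - t)) := by
      rw [← this, inFlux]
      refine intervalIntegral.integral_congr fun u _ => ?_
      rw [show 2 * v₂ - (u + v₂) = v₂ - u by ring]
    rw [e2, ← intervalIntegral.integral_neg]
    refine intervalIntegral.integral_congr fun u _ => ?_
    ring
  have e2 : ∫ t in (0 : ℝ)..v₂ + u₁, (1 * sA P₀ t (t - 2 * u₁) - sB P t (t - 2 * u₁))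
      = outFlux P₀ P u₁ (-u₁) v₂ := by
    have := intervalIntegral.integral_comp_add_right (a := -u₁) (b := v₂)
      (fun t => 1 * sA P₀ t (t - 2 * u₁) - sB P t (t - 2 * u₁)) u₁
    rw [show -u₁ + u₁ = 0 by ring] at this
    rw [← this, outFlux]
    refine intervalIntegral.integral_congr fun v _ => ?_
    rw [show v + u₁ - 2 * u₁ = v - u₁ by ring, show v + u₁ = u₁ + v by ring]
    ring
  rw [e1, e2, show v₂ + u₁ - 2 * u₁ = v₂ - u₁ by ring, show 2 * v₂ - (v₂ + u₁) = v₂ - u₁ by ring,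
    intervalIntegral.integral_same, zero_sub (2 * u₁), sub_zero] at h
  linarith

end Fluxes

/-! ### Spacetime integrals in polar coordinates -/

theorem measurePreserving_stp :
    MeasurePreserving (fun z : ℝ × E3 => stp z.1 z.2) volume volume := by
  have h1 := (volume_preserving_piFinSuccAbove (fun _ : Fin 4 => ℝ) 0).symm
  have h2 : MeasurePreserving (Prod.map id (WithLp.ofLp : E3 → Fin 3 → ℝ))
      (volume : Measure (ℝ × E3)) volume :=
    (MeasurePreserving.id _).prod (PiLp.volume_preserving_ofLp (Fin 3))
  have e : (fun z : ℝ × E3 => stp z.1 z.2)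
      = (MeasurableEquiv.piFinSuccAbove (fun _ : Fin 4 => ℝ) 0).symm
        ∘ Prod.map id (WithLp.ofLp : E3 → Fin 3 → ℝ) := by
    funext z
    ext k
    fin_cases k <;> rfl
  rw [e]
  exact h1.comp h2

/-- The measure of spherical coordinates. -/
def polM : Measure (ℝ × E3) :=
  ((volume.restrict (Ioi (0 : ℝ))).withDensity fun r => ENNReal.ofReal (r ^ 2)).prod sphM

instance : SFinite polM := by unfold polM; infer_instance

theorem lintegral_polM {f : ℝ × E3 → ℝ≥0∞} (hf : Measurable f) :
    ∫⁻ z, f z ∂polM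
      = ∫⁻ r in Ioi (0 : ℝ), ENNReal.ofReal (r ^ 2) * ∫⁻ ω, f (r, ω) ∂sphM := by
  rw [polM, lintegral_prod _ hf.aemeasurable, lintegral_withDensity_eq_lintegral_mul _
    (by fun_prop) hf.lintegral_prod_right']
  rfl

theorem lintegral_polM_smul {f : E3 → ℝ≥0∞} (hf : Measurable f) :
    ∫⁻ z, f (z.1 • z.2) ∂polM = ∫⁻ x, f x := by
  rw [lintegral_polar hf, lintegral_polM (by fun_prop)]

theorem stp_smul (t r : ℝ) (ω : E3) : stp t (r • ω) = pt t r ω := by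
  ext k; fin_cases k <;> rfl

/-- Polar coordinates on spacetime adapted to the foliation by the graphs of `s` over the radius. -/
def folC (s : ℝ → ℝ) (z : ℝ × ℝ × E3) : V := pt (z.1 + s z.2.1) z.2.1 z.2.2

theorem continuous_folC {s : ℝ → ℝ} (hs : Continuous s) : Continuous (folC s) := by
  unfold folC; fun_prop

theorem measurePreserving_folC {s : ℝ → ℝ} (hs : Continuous s) :
    MeasurePreserving (folC s) ((volume : Measure ℝ).prod polM) volume := by
  have hm := (continuous_folC hs).measurable
  refine ⟨hm, Measure.ext_of_lintegral _ fun f hf => ?_⟩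
  have hpt : Measurable fun z : ℝ × ℝ × E3 => pt z.1 z.2.1 z.2.2 :=
    Continuous.measurable (by fun_prop)
  rw [lintegral_map hf hm, lintegral_prod_symm' (fun z => f (folC s z)) (hf.comp hm)]
  have h1 : ∀ z : ℝ × E3, ∫⁻ τ, f (folC s (τ, z)) = ∫⁻ τ, f (pt τ z.1 z.2) := fun z =>
    lintegral_add_right_eq_self (fun τ => f (pt τ z.1 z.2)) (s z.1)
  have hst : Measurable fun z : ℝ × E3 => stp z.1 z.2 := measurePreserving_stp.measurable
  calc ∫⁻ z, (∫⁻ τ, f (folC s (τ, z))) ∂polM = ∫⁻ z, (∫⁻ τ : ℝ, f (pt τ z.1 z.2)) ∂polM :=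
        lintegral_congr h1
    _ = ∫⁻ τ : ℝ, (∫⁻ z, f (pt τ z.1 z.2) ∂polM) :=
        lintegral_lintegral_swap (f := fun (z : ℝ × E3) (τ : ℝ) => f (pt τ z.1 z.2))
          ((hf.comp hpt).comp measurable_swap).aemeasurable
    _ = ∫⁻ τ, ∫⁻ x, f (stp τ x) := by
        refine lintegral_congr fun τ => ?_
        rw [← lintegral_polM_smul (f := fun x => f (stp τ x))
          (hf.comp (hst.comp measurable_prodMk_left))]
        simp only [stp_smul]
    _ = ∫⁻ p, f p := by
        rw [← measurePreserving_stp.lintegral_comp hf, Measure.volume_eq_prod,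
          lintegral_prod (fun z : ℝ × E3 => f (stp z.1 z.2)) (hf.comp hst).aemeasurable]

theorem rad_pt {r : ℝ} (hr : 0 ≤ r) (t : ℝ) {ω : E3} (hω : ω ∈ sphere (0 : E3) 1) :
    rad (pt t r ω) = r := by
  have h5 := EuclideanSpace.real_norm_sq_eq ω
  rw [mem_sphere_zero_iff_norm.1 hω] at h5
  rw [rad]
  simp only [pt_succ, mul_pow]
  rw [← Finset.mul_sum, ← h5, one_pow, mul_one, Real.sqrt_sq hr]

theorem continuous_rad : Continuous rad := by unfold rad; fun_prop

theorem continuous_tC : Continuous tC := by unfold tC; fun_prop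

/-- The part of spacetime swept out by the pieces `rad ∈ K τ` of the graphs of `τ + s`. -/
def swept (s : ℝ → ℝ) (K : ℝ → Set ℝ) (t₀ t₁ : ℝ) : Set V :=
  {p | tC p - s (rad p) ∈ Icc t₀ t₁ ∧ rad p ∈ K (tC p - s (rad p))}

theorem measurableSet_swept {s : ℝ → ℝ} {K : ℝ → Set ℝ} (hs : Continuous s)
    (hK : MeasurableSet {z : ℝ × ℝ | z.2 ∈ K z.1}) (t₀ t₁ : ℝ) :
    MeasurableSet (swept s K t₀ t₁) := by
  have h : Continuous fun p => tC p - s (rad p) :=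
    continuous_tC.sub (hs.comp continuous_rad)
  exact (h.measurable measurableSet_Icc).inter ((h.prodMk continuous_rad).measurable hK)

/-- Spacetime integrals over a swept region as iterated integrals. -/
theorem setLIntegral_swept {s : ℝ → ℝ} {K : ℝ → Set ℝ} (hs : Continuous s)
    (hK : MeasurableSet {z : ℝ × ℝ | z.2 ∈ K z.1}) {t₀ t₁ : ℝ}
    (h0 : ∀ τ ∈ Icc t₀ t₁, K τ ⊆ Ici 0) {f : V → ℝ≥0∞} (hf : Measurable f) :
    ∫⁻ p in swept s K t₀ t₁, f p
      = ∫⁻ τ in Icc t₀ t₁, ∫⁻ r in K τ,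
          ENNReal.ofReal (r ^ 2) * ∫⁻ ω, f (pt (τ + s r) r ω) ∂sphM := by
  have hm := measurableSet_swept hs hK t₀ t₁
  have hKm : ∀ τ, MeasurableSet (K τ) := fun τ => measurable_prodMk_left hK
  have hg : Measurable ((swept s K t₀ t₁).indicator f) := hf.indicator hm
  rw [← lintegral_indicator hm, ← (measurePreserving_folC hs).lintegral_comp hg,
    lintegral_prod (fun z => (swept s K t₀ t₁).indicator f (folC s z))
      (hg.comp (continuous_folC hs).measurable).aemeasurable, ← lintegral_indicator measurableSet_Icc]
  refine lintegral_congr fun τ => ?_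
  rw [lintegral_polM (f := fun z => (swept s K t₀ t₁).indicator f (folC s (τ, z)))
    (hg.comp ((continuous_folC hs).measurable.comp measurable_prodMk_left))]
  have hind : ∀ r > 0, ∀ ω ∈ sphere (0 : E3) 1, (swept s K t₀ t₁).indicator f (folC s (τ, r, ω))
      = (Icc t₀ t₁).indicator (fun τ => (K τ).indicator
        (fun r => f (pt (τ + s r) r ω)) r) τ := by
    intro r hr ω hω
    have hmem : pt (τ + s r) r ω ∈ swept s K t₀ t₁ ↔ τ ∈ Icc t₀ t₁ ∧ r ∈ K τ := by
      rw [swept, mem_ofPred_eq, tC, rad_pt (le_of_lt hr) _ hω, pt_zero, add_sub_cancel_right]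
    rw [folC]
    by_cases h : τ ∈ Icc t₀ t₁
    · rw [indicator_of_mem h]
      by_cases h' : r ∈ K τ
      · rw [indicator_of_mem h', indicator_of_mem (hmem.2 ⟨h, h'⟩)]
      · rw [indicator_of_notMem h', indicator_of_notMem fun h2 => h' (hmem.1 h2).2]
    · rw [indicator_of_notMem h, indicator_of_notMem fun h2 => h (hmem.1 h2).1]
  by_cases hτ : τ ∈ Icc t₀ t₁
  · rw [indicator_of_mem hτ, ← lintegral_indicator measurableSet_Ioi,
      ← lintegral_indicator (hKm τ)]
    refine lintegral_congr_ae ?_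
    have hne : ∀ᵐ r : ℝ, r ≠ 0 := by simp [ae_iff, measure_singleton]
    filter_upwards [hne] with r hr0
    by_cases hr : 0 < r
    · rw [indicator_of_mem (mem_Ioi.2 hr)]
      by_cases hri : r ∈ K τ
      · rw [indicator_of_mem hri]
        congr 1
        refine lintegral_congr_ae ?_
        filter_upwards [ae_sphM] with ω hω
        rw [hind r hr ω hω, indicator_of_mem hτ, indicator_of_mem hri]
      · rw [indicator_of_notMem hri]
        have : ∫⁻ ω, (swept s K t₀ t₁).indicator f (folC s (τ, r, ω)) ∂sphM = 0 := by
          rw [← lintegral_zero (μ := sphM)]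
          refine lintegral_congr_ae ?_
          filter_upwards [ae_sphM] with ω hω
          rw [hind r hr ω hω, indicator_of_mem hτ, indicator_of_notMem hri]
        rw [this, mul_zero]
    · have h3 : r ∉ K τ := fun h => hr (lt_of_le_of_ne (h0 τ hτ h) hr0.symm)
      rw [indicator_of_notMem (by simpa using hr), indicator_of_notMem h3]
  · rw [indicator_of_notMem hτ, ← lintegral_zero (μ := volume.restrict (Ioi (0 : ℝ)))]
    refine setLIntegral_congr_fun measurableSet_Ioi fun r hr => ?_
    have : ∫⁻ ω, (swept s K t₀ t₁).indicator f (folC s (τ, r, ω)) ∂sphM = 0 := by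
      rw [← lintegral_zero (μ := sphM)]
      refine lintegral_congr_ae ?_
      filter_upwards [ae_sphM] with ω hω
      rw [hind r hr ω hω, indicator_of_notMem hτ]
    simp only [this, mul_zero]

/-! ### Reducing weighted estimates to divergence identities -/

theorem oR_ne_top {x : ℝ} : oR x ≠ ∞ := ofReal_ne_top

theorem oR_intervalIntegral {g : ℝ → ℝ} (hg : Continuous g) {a b : ℝ} (hab : a ≤ b)
    (h0 : ∀ x ∈ Icc a b, 0 ≤ g x) : oR (∫ x in a..b, g x) = ∫⁻ x in Icc a b, oR (g x) := by
  rw [intervalIntegral.integral_of_le hab, ← integral_Icc_eq_integral_Ioc]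
  exact ofReal_integral_eq_lintegral_ofReal hg.continuousOn.integrableOn_Icc
    ((ae_restrict_iff' measurableSet_Icc).2 (ae_of_all _ h0))

theorem sA_nonneg {N : V → ℝ} (hN : ∀ p, 0 < rad p → 0 ≤ N p) (t : ℝ) {r : ℝ} (hr : 0 ≤ r) :
    0 ≤ sA N t r := by
  refine integral_nonneg_of_ae ?_
  filter_upwards [ae_sphM] with ω hω
  rcases hr.eq_or_lt with rfl | hr
  · simp
  · exact mul_nonneg (sq_nonneg r) (hN _ (by rwa [rad_pt hr.le t hω]))

theorem oR_sA {N : V → ℝ} (hc : Continuous N) (hN : ∀ p, 0 < rad p → 0 ≤ N p) (t : ℝ) {r : ℝ}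
    (hr : 0 ≤ r) : oR (sA N t r) = ENNReal.ofReal (r ^ 2) * ∫⁻ ω, oR (N (pt t r ω)) ∂sphM := by
  rcases hr.eq_or_lt with rfl | hr
  · simp [sA, oR]
  · rw [sA, integral_const_mul, oR, ENNReal.ofReal_mul (sq_nonneg r),
      ofReal_integral_eq_lintegral_ofReal (integrable_sphM (by fun_prop))]
    · rfl
    · filter_upwards [ae_sphM] with ω hω using hN _ (by rwa [rad_pt hr.le t hω])

/-- The integral of a spherical density over a region swept out by moving radii. -/
def sweptInt (s ρ₁ ρ₂ : ℝ → ℝ) (t₀ t₁ : ℝ) (N : V → ℝ) : ℝ :=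
  ∫ τ in t₀..t₁, ∫ r in ρ₁ τ..ρ₂ τ, sA N (τ + s r) r

section Swept

variable {s ρ₁ ρ₂ : ℝ → ℝ} {t₀ t₁ : ℝ}

theorem continuous_sweptInner (hs : Continuous s) (h₁ : Continuous ρ₁) (h₂ : Continuous ρ₂)
    {N : V → ℝ} (hc : Continuous N) :
    Continuous fun τ => ∫ r in ρ₁ τ..ρ₂ τ, sA N (τ + s r) r := by
  have hA : Continuous (Function.uncurry fun τ r => sA N (τ + s r) r) :=
    continuous₂_comp (continuous_sA hc) (by fun_prop) (by fun_prop)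
  have hint : ∀ τ a b, IntervalIntegrable (fun r => sA N (τ + s r) r) volume a b := fun τ a b =>
    (continuous₂_comp (continuous_sA hc) (by fun_prop) (by fun_prop)).intervalIntegrable a b
  have e : (fun τ => ∫ r in ρ₁ τ..ρ₂ τ, sA N (τ + s r) r)
      = fun τ => (∫ r in (0 : ℝ)..ρ₂ τ, sA N (τ + s r) r) - ∫ r in (0 : ℝ)..ρ₁ τ, sA N (τ + s r) r :=
    funext fun τ => (intervalIntegral.integral_interval_sub_left (hint τ _ _) (hint τ _ _)).symm
  rw [e]
  exact (intervalIntegral.continuous_parametric_intervalIntegral_of_continuous hA h₂).sub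
    (intervalIntegral.continuous_parametric_intervalIntegral_of_continuous hA h₁)

theorem sweptInt_sub (hs : Continuous s) (h₁ : Continuous ρ₁) (h₂ : Continuous ρ₂)
    {M N : V → ℝ} (hM : Continuous M) (hN : Continuous N) :
    sweptInt s ρ₁ ρ₂ t₀ t₁ (fun p => M p - N p)
      = sweptInt s ρ₁ ρ₂ t₀ t₁ M - sweptInt s ρ₁ ρ₂ t₀ t₁ N := by
  have hint : ∀ {N : V → ℝ}, Continuous N → ∀ τ a b,
      IntervalIntegrable (fun r => sA N (τ + s r) r) volume a b := fun hc τ a b =>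
    (continuous₂_comp (continuous_sA hc) (by fun_prop) (by fun_prop)).intervalIntegrable a b
  have hsA : ∀ t r, sA (fun p => M p - N p) t r = sA M t r - sA N t r := fun t r => by
    rw [sA, sA, sA, ← integral_sub (integrable_sphM (by fun_prop)) (integrable_sphM (by fun_prop))]
    simp only [mul_sub]
  rw [sweptInt, sweptInt, sweptInt, ← intervalIntegral.integral_sub
    ((continuous_sweptInner hs h₁ h₂ hM).intervalIntegrable _ _)
    ((continuous_sweptInner hs h₁ h₂ hN).intervalIntegrable _ _)]
  refine intervalIntegral.integral_congr fun τ _ => ?_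
  simp only [hsA]
  rw [intervalIntegral.integral_sub (hint hM τ _ _) (hint hN τ _ _)]

theorem measurableSet_moving_Icc (h₁ : Continuous ρ₁) (h₂ : Continuous ρ₂) :
    MeasurableSet {z : ℝ × ℝ | z.2 ∈ Icc (ρ₁ z.1) (ρ₂ z.1)} :=
  ((isClosed_le (by fun_prop) continuous_snd).inter
    (isClosed_le continuous_snd (by fun_prop))).measurableSet

theorem sweptInt_nonneg (ht : t₀ ≤ t₁) (h0 : ∀ τ ∈ Icc t₀ t₁, 0 ≤ ρ₁ τ)
    (h12 : ∀ τ ∈ Icc t₀ t₁, ρ₁ τ ≤ ρ₂ τ) {N : V → ℝ} (hN : ∀ p, 0 ≤ N p) :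
    0 ≤ sweptInt s ρ₁ ρ₂ t₀ t₁ N :=
  intervalIntegral.integral_nonneg ht fun τ hτ =>
    intervalIntegral.integral_nonneg (h12 τ hτ) fun _ hr =>
      sA_nonneg (fun p _ => hN p) _ ((h0 τ hτ).trans hr.1)

theorem lintegral_swept_oR (hs : Continuous s) (h₁ : Continuous ρ₁) (h₂ : Continuous ρ₂)
    (ht : t₀ ≤ t₁) (h0 : ∀ τ ∈ Icc t₀ t₁, 0 ≤ ρ₁ τ) (h12 : ∀ τ ∈ Icc t₀ t₁, ρ₁ τ ≤ ρ₂ τ)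
    {N : V → ℝ} (hc : Continuous N) (hN : ∀ p, 0 ≤ N p) :
    ∫⁻ p in swept s (fun τ => Icc (ρ₁ τ) (ρ₂ τ)) t₀ t₁, oR (N p)
      = oR (sweptInt s ρ₁ ρ₂ t₀ t₁ N) := by
  have hN' : ∀ p, 0 < rad p → 0 ≤ N p := fun p _ => hN p
  rw [setLIntegral_swept (f := fun p => oR (N p)) hs (measurableSet_moving_Icc h₁ h₂)
    (fun τ hτ r hr => (h0 τ hτ).trans hr.1) (ENNReal.measurable_ofReal.comp hc.measurable),
    sweptInt, oR_intervalIntegral (continuous_sweptInner hs h₁ h₂ hc) ht fun τ hτ =>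
      intervalIntegral.integral_nonneg (h12 τ hτ) fun r hr =>
        sA_nonneg hN' _ ((h0 τ hτ).trans hr.1)]
  refine setLIntegral_congr_fun measurableSet_Icc fun τ hτ => ?_
  have hcr : Continuous fun r => sA N (τ + s r) r :=
    continuous₂_comp (continuous_sA hc) (by fun_prop) (by fun_prop)
  rw [oR_intervalIntegral hcr (h12 τ hτ) fun r hr => sA_nonneg hN' _ ((h0 τ hτ).trans hr.1)]
  exact setLIntegral_congr_fun measurableSet_Icc fun r hr =>
    (oR_sA hc hN' _ ((h0 τ hτ).trans hr.1)).symm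

end Swept

theorem ae_rad_pos : ∀ᵐ p : V, 0 < rad p := by
  have h : ∀ᵐ p : V, p 1 ≠ 0 := by
    rw [ae_iff]
    simp only [ne_eq, not_not]
    exact Measure.pi_hyperplane (fun _ : Fin 4 => (volume : Measure ℝ)) 1 0
  filter_upwards [h] with p hp
  refine Real.sqrt_pos.2 (lt_of_lt_of_le (sq_pos_of_ne_zero hp) ?_)
  exact Finset.single_le_sum (f := fun i : Fin 3 => p i.succ ^ 2) (fun i _ => sq_nonneg _)
    (Finset.mem_univ (0 : Fin 3))

/-- A divergence identity with a coercive bulk term yields an energy estimate. -/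
theorem energy_estimate {s ρ₁ ρ₂ : ℝ → ℝ} {t₀ t₁ : ℝ} (hs : Continuous s) (h₁ : Continuous ρ₁)
    (h₂ : Continuous ρ₂) (ht : t₀ ≤ t₁) (h0 : ∀ τ ∈ Icc t₀ t₁, 0 ≤ ρ₁ τ)
    (h12 : ∀ τ ∈ Icc t₀ t₁, ρ₁ τ ≤ ρ₂ τ) {N bulk src : V → ℝ} (hc : Continuous N)
    {c₁ c₂ : ℝ} (hc₁ : 0 ≤ c₁) (hc₂ : 0 ≤ c₂) (hb0 : ∀ p, 0 ≤ bulk p)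
    (hle : ∀ p, 0 < rad p → bulk p ≤ c₁ * N p + c₂ * src p) {X Y : ℝ} (hX : 0 ≤ X) (hY : 0 ≤ Y)
    (hXY : X + sweptInt s ρ₁ ρ₂ t₀ t₁ N = Y) :
    (∫⁻ p in swept s (fun τ => Icc (ρ₁ τ) (ρ₂ τ)) t₀ t₁, oR (bulk p)) + oR c₁ * oR X
      ≤ oR c₁ * oR Y
        + oR c₂ * ∫⁻ p in swept s (fun τ => Icc (ρ₁ τ) (ρ₂ τ)) t₀ t₁, oR (src p) := by
  set S := swept s (fun τ => Icc (ρ₁ τ) (ρ₂ τ)) t₀ t₁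
  have hPc : Continuous fun p => max (N p) 0 := hc.max continuous_const
  have hMc : Continuous fun p => max (-N p) 0 := hc.neg.max continuous_const
  have hsplit : sweptInt s ρ₁ ρ₂ t₀ t₁ N
      = sweptInt s ρ₁ ρ₂ t₀ t₁ (fun p => max (N p) 0)
        - sweptInt s ρ₁ ρ₂ t₀ t₁ (fun p => max (-N p) 0) := by
    rw [← sweptInt_sub hs h₁ h₂ hPc hMc]
    congr 1
    funext p
    rcases le_total 0 (N p) with h | h
    · rw [max_eq_left h, max_eq_right (by linarith)]; ring
    · rw [max_eq_right h, max_eq_left (by linarith)]; ring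
  have eP := lintegral_swept_oR hs h₁ h₂ ht h0 h12 hPc fun p => le_max_right _ _
  have eM := lintegral_swept_oR hs h₁ h₂ ht h0 h12 hMc fun p => le_max_right _ _
  have nP := sweptInt_nonneg (s := s) (N := fun p => max (N p) 0) ht h0 h12
    fun p => le_max_right _ _
  have nM := sweptInt_nonneg (s := s) (N := fun p => max (-N p) 0) ht h0 h12
    fun p => le_max_right _ _
  set a := sweptInt s ρ₁ ρ₂ t₀ t₁ (fun p => max (N p) 0)
  set b := sweptInt s ρ₁ ρ₂ t₀ t₁ (fun p => max (-N p) 0)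
  have hpt : ∀ᵐ p ∂volume.restrict S, oR (bulk p) + oR c₁ * oR (max (-N p) 0)
      ≤ oR c₁ * oR (max (N p) 0) + oR c₂ * oR (src p) := by
    refine ae_restrict_of_ae ?_
    filter_upwards [ae_rad_pos] with p hp
    have h5 : max (N p) 0 - max (-N p) 0 = N p := by
      rcases le_total 0 (N p) with h | h
      · rw [max_eq_left h, max_eq_right (by linarith)]; ring
      · rw [max_eq_right h, max_eq_left (by linarith)]; ring
    simp only [oR]
    rw [← ENNReal.ofReal_mul hc₁, ← ENNReal.ofReal_mul hc₁, ← ENNReal.ofReal_mul hc₂,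
      ← ENNReal.ofReal_add (hb0 p) (mul_nonneg hc₁ (le_max_right _ _))]
    refine le_trans (ENNReal.ofReal_le_ofReal ?_) ENNReal.ofReal_add_le
    have := hle p hp
    rw [← h5] at this
    linarith
  have hi := lintegral_mono_ae hpt
  have mP : Measurable fun p => oR c₁ * oR (max (N p) 0) :=
    (ENNReal.measurable_ofReal.comp hPc.measurable).const_mul _
  have mM : Measurable fun p => oR c₁ * oR (max (-N p) 0) :=
    (ENNReal.measurable_ofReal.comp hMc.measurable).const_mul _
  rw [lintegral_add_right _ mM, lintegral_add_left mP, lintegral_const_mul' _ _ oR_ne_top,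
    lintegral_const_mul' _ _ oR_ne_top, lintegral_const_mul' _ _ oR_ne_top, eP, eM] at hi
  have hsum : oR X + oR a = oR Y + oR b := by
    simp only [oR]
    rw [← ENNReal.ofReal_add hX nP, ← ENNReal.ofReal_add hY nM]
    congr 1
    linarith
  refine (ENNReal.add_le_add_iff_right (a := oR c₁ * oR b)
    (ENNReal.mul_ne_top oR_ne_top oR_ne_top)).1 ?_
  calc _ = ((∫⁻ p in S, oR (bulk p)) + oR c₁ * oR b) + oR c₁ * oR X := by ring
    _ ≤ (oR c₁ * oR a + oR c₂ * ∫⁻ p in S, oR (src p)) + oR c₁ * oR X := by gcongr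
    _ = oR c₁ * (oR X + oR a) + oR c₂ * ∫⁻ p in S, oR (src p) := by ring
    _ = _ := by rw [hsum]; ring

/-! ### Comparison of flux integrals -/

theorem sphLInt_le {f : E3 → ℝ≥0∞} {g : E3 → ℝ} (hg : Continuous g) {c : ℝ} (hc : 0 ≤ c)
    (h0 : ∀ ω ∈ sphere (0 : E3) 1, 0 ≤ g ω)
    (h : ∀ ω ∈ sphere (0 : E3) 1, f ω ≤ oR (c * g ω)) :
    sphLInt f ≤ oR (6144 * c) * oR (∫ ω, g ω ∂sphM) := by
  have e : oR (∫ ω, g ω ∂sphM) = ∫⁻ ω, oR (g ω) ∂sphM := by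
    refine ofReal_integral_eq_lintegral_ofReal (integrable_sphM hg) ?_
    filter_upwards [ae_sphM] with ω hω using h0 ω hω
  have e2 : oR (6144 * c) = (6144 : ℝ≥0∞) * oR c := by
    rw [oR, oR, ENNReal.ofReal_mul (by norm_num)]; norm_num
  rw [e, e2, mul_assoc, ← lintegral_const_mul' _ _ oR_ne_top, sphLInt]
  calc _ ≤ ∫⁻ ω in sphere (0 : E3) 1, oR c * oR (g ω) ∂μH[2] := by
        refine setLIntegral_mono' isClosed_sphere.measurableSet fun ω hω => ?_
        rw [oR, oR, ← ENNReal.ofReal_mul hc]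
        exact h ω hω
    _ ≤ ∫⁻ ω, oR c * oR (g ω) ∂((6144 : ℝ≥0∞) • sphM) := lintegral_mono' hausdorff_le_sphM le_rfl
    _ = _ := by rw [lintegral_smul_measure]; rfl

theorem le_sphLInt {f : E3 → ℝ≥0∞} {g : E3 → ℝ} (hg : Continuous g) {c : ℝ}
    (h0 : ∀ ω ∈ sphere (0 : E3) 1, 0 ≤ g ω)
    (h : ∀ ω ∈ sphere (0 : E3) 1, oR (g ω) ≤ oR c * f ω) :
    oR (∫ ω, g ω ∂sphM) ≤ oR (1152 * c) * sphLInt f := by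
  have e : oR (∫ ω, g ω ∂sphM) = ∫⁻ ω, oR (g ω) ∂sphM := by
    refine ofReal_integral_eq_lintegral_ofReal (integrable_sphM hg) ?_
    filter_upwards [ae_sphM] with ω hω using h0 ω hω
  have e2 : oR (1152 * c) = (1152 : ℝ≥0∞) * oR c := by
    rw [oR, oR, ENNReal.ofReal_mul (by norm_num)]; norm_num
  rw [e, e2, mul_assoc, sphLInt, ← lintegral_const_mul' _ _ oR_ne_top]
  calc _ ≤ ∫⁻ ω, oR (g ω) ∂((1152 : ℝ≥0∞) • μH[2].restrict (sphere (0 : E3) 1)) :=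
        lintegral_mono' sphM_le_hausdorff le_rfl
    _ = 1152 * ∫⁻ ω in sphere (0 : E3) 1, oR (g ω) ∂μH[2] := by
        rw [lintegral_smul_measure]; rfl
    _ ≤ _ := by
        refine mul_le_mul_right ?_ _
        exact setLIntegral_mono' isClosed_sphere.measurableSet fun ω hω => h ω hω

theorem setLIntegral_polar {h : E3 → ℝ≥0∞} (hh : Measurable h) {K : Set ℝ}
    (hK : MeasurableSet K) (hK0 : K ⊆ Ici 0) :
    ∫⁻ x in {x : E3 | ‖x‖ ∈ K}, h x
      = ∫⁻ r in K, ENNReal.ofReal (r ^ 2) * ∫⁻ ω, h (r • ω) ∂sphM := by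
  have hm : MeasurableSet {x : E3 | ‖x‖ ∈ K} := measurable_norm hK
  rw [← lintegral_indicator hm, lintegral_polar (hh.indicator hm),
    ← lintegral_indicator measurableSet_Ioi, ← lintegral_indicator hK]
  refine lintegral_congr_ae ?_
  have hne : ∀ᵐ r : ℝ, r ≠ 0 := by simp [ae_iff, measure_singleton]
  filter_upwards [hne] with r hr0
  by_cases hr : 0 < r
  · have hmem : ∀ ω ∈ sphere (0 : E3) 1, r • ω ∈ {x : E3 | ‖x‖ ∈ K} ↔ r ∈ K := fun ω hω => by
      rw [mem_ofPred_eq, norm_smul, mem_sphere_zero_iff_norm.1 hω, mul_one, Real.norm_of_nonneg hr.le]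
    rw [indicator_of_mem (mem_Ioi.2 hr)]
    by_cases hrK : r ∈ K
    · rw [indicator_of_mem hrK]
      congr 1
      refine lintegral_congr_ae ?_
      filter_upwards [ae_sphM] with ω hω
      rw [indicator_of_mem ((hmem ω hω).2 hrK)]
    · have : ∫⁻ ω, {x : E3 | ‖x‖ ∈ K}.indicator h (r • ω) ∂sphM = 0 := by
        rw [← lintegral_zero (μ := sphM)]
        refine lintegral_congr_ae ?_
        filter_upwards [ae_sphM] with ω hω
        rw [indicator_of_notMem fun hx => hrK ((hmem ω hω).1 hx)]
      rw [indicator_of_notMem hrK, this, mul_zero]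
  · rw [indicator_of_notMem (by simpa using hr),
      indicator_of_notMem fun h => hr (lt_of_le_of_ne (hK0 h) hr0.symm)]

theorem rad_stp (t : ℝ) (x : E3) : rad (stp t x) = ‖x‖ := by
  rw [EuclideanSpace.norm_eq, rad]
  simp only [Real.norm_eq_abs, sq_abs]
  congr 1

theorem continuous_stp (t : ℝ) : Continuous (stp t) := by
  have : stp t = fun x => pt t 1 x := by
    funext x; ext k; fin_cases k <;> simp [stp, pt]
  rw [this]; fun_prop

theorem setLIntegral_stp_eq_oR {N : V → ℝ} (hc : Continuous N) (hN : ∀ p, 0 < rad p → 0 ≤ N p)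
    (t : ℝ) {r₀ r₁ : ℝ} (h0 : 0 ≤ r₀) (h1 : r₀ ≤ r₁) :
    ∫⁻ x in {x : E3 | ‖x‖ ∈ Icc r₀ r₁}, oR (N (stp t x)) = oR (∫ r in r₀..r₁, sA N t r) := by
  have hcr : Continuous fun r => sA N t r :=
    continuous₂_comp (continuous_sA hc) (by fun_prop) (by fun_prop)
  rw [setLIntegral_polar (h := fun x => oR (N (stp t x)))
      (ENNReal.measurable_ofReal.comp (hc.comp (continuous_stp t)).measurable) measurableSet_Icc
      (fun r hr => h0.trans hr.1),
    oR_intervalIntegral hcr h1 fun r hr => sA_nonneg hN _ (h0.trans hr.1)]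
  refine setLIntegral_congr_fun measurableSet_Icc fun r hr => ?_
  simp only [stp_smul]
  exact (oR_sA hc hN _ (h0.trans hr.1)).symm

theorem ae_norm_pos : ∀ᵐ x : E3, 0 < ‖x‖ := by
  have : ∀ᵐ x : E3, x ≠ 0 := by simp [ae_iff, measure_singleton]
  filter_upwards [this] with x hx using norm_pos_iff.2 hx

theorem setLIntegral_stp_le {f g : V → ℝ} {c : ℝ} (hc : 0 ≤ c)
    (h : ∀ p, 0 < rad p → f p ≤ c * g p) (t : ℝ) (S : Set E3) :
    ∫⁻ x in S, oR (f (stp t x)) ≤ oR c * ∫⁻ x in S, oR (g (stp t x)) := by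
  rw [← lintegral_const_mul' _ _ oR_ne_top]
  refine lintegral_mono_ae (ae_restrict_of_ae ?_)
  filter_upwards [ae_norm_pos] with x hx
  rw [oR, oR, oR, ← ENNReal.ofReal_mul hc]
  exact ENNReal.ofReal_le_ofReal (h _ (by rwa [rad_stp]))

/-! ### The energy fluxes and the boundary terms of the divergence identities -/

/-- The density `dens` is equivalent to `N₀ + κ N(∂_r)`. -/
def FluxEquiv (N₀ : V → ℝ) (N : Fin 3 → V → ℝ) (κ : ℝ) (dens : V → ℝ) : Prop :=
  ∀ (p : V) (a : Fin 3 → ℝ), 0 < rad p → (∀ i, p i.succ = rad p * a i) →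
    dens p ≤ 2 * (N₀ p + κ * ∑ j, a j * N j p) ∧ N₀ p + κ * ∑ j, a j * N j p ≤ 3 * dens p

section Flux

variable {N₀ : V → ℝ} {N : Fin 3 → V → ℝ} {κ : ℝ} {dens : V → ℝ}

theorem sA_add_sB (h₀ : Continuous N₀) (h : ∀ i, Continuous (N i)) (κ t r : ℝ) :
    sA N₀ t r + κ * sB N t r
      = ∫ ω, r ^ 2 * (N₀ (pt t r ω) + κ * ∑ j, ω j * N j (pt t r ω)) ∂sphM := by
  rw [sA, sB, ← integral_const_mul, ← integral_add (integrable_sphM (by fun_prop))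
    ((integrable_sB h t r).const_mul κ)]
  congr 1
  funext ω
  ring

theorem flux_sphere (h₀ : Continuous N₀) (h : ∀ i, Continuous (N i))
    (hd : ∀ p, 0 ≤ dens p) (he : FluxEquiv N₀ N κ dens) (t : ℝ) {r : ℝ} (hr : 0 ≤ r) :
    0 ≤ sA N₀ t r + κ * sB N t r ∧
    sphI (fun p => dens p * rad p ^ 2) t r ≤ oR 12288 * oR (sA N₀ t r + κ * sB N t r) ∧
    oR (sA N₀ t r + κ * sB N t r) ≤ oR 3456 * sphI (fun p => dens p * rad p ^ 2) t r := by
  have hcont : Continuous fun ω : E3 =>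
      r ^ 2 * (N₀ (pt t r ω) + κ * ∑ j, ω j * N j (pt t r ω)) := by
    have : Continuous fun ω : E3 => ∑ j, ω j * N j (pt t r ω) :=
      continuous_finsetSum _ fun i _ => Continuous.mul (by fun_prop) ((h i).comp (by fun_prop))
    fun_prop
  have key : ∀ ω ∈ sphere (0 : E3) 1,
      dens (pt t r ω) * rad (pt t r ω) ^ 2
        ≤ 2 * (r ^ 2 * (N₀ (pt t r ω) + κ * ∑ j, ω j * N j (pt t r ω))) ∧
      r ^ 2 * (N₀ (pt t r ω) + κ * ∑ j, ω j * N j (pt t r ω))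
        ≤ 3 * (dens (pt t r ω) * rad (pt t r ω) ^ 2) := by
    intro ω hω
    rcases hr.eq_or_lt with rfl | hr
    · simp [rad_pt le_rfl t hω]
    have h1 := he (pt t r ω) (fun i => ω i) (by rwa [rad_pt hr.le t hω])
      (fun i => by rw [pt_succ, rad_pt hr.le t hω])
    rw [rad_pt hr.le t hω]
    have h2 := mul_le_mul_of_nonneg_left h1.1 (sq_nonneg r)
    have h3 := mul_le_mul_of_nonneg_left h1.2 (sq_nonneg r)
    constructor <;> linarith
  have h0 : ∀ ω ∈ sphere (0 : E3) 1,
      0 ≤ r ^ 2 * (N₀ (pt t r ω) + κ * ∑ j, ω j * N j (pt t r ω)) := fun ω hω => by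
    have := (key ω hω).1
    have := mul_nonneg (hd (pt t r ω)) (sq_nonneg (rad (pt t r ω)))
    linarith
  rw [sA_add_sB h₀ h]
  refine ⟨?_, ?_, ?_⟩
  · refine integral_nonneg_of_ae ?_
    filter_upwards [ae_sphM] with ω hω using h0 ω hω
  · refine (sphLInt_le hcont zero_le_two h0 fun ω hω =>
      ENNReal.ofReal_le_ofReal (key ω hω).1).trans_eq ?_
    norm_num
  · refine (le_sphLInt (f := fun ω => oR (dens (pt t r ω) * rad (pt t r ω) ^ 2)) (c := 3) hcont h0
      fun ω hω => ?_).trans_eq ?_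
    · rw [oR, oR, oR, ← ENNReal.ofReal_mul (by norm_num)]
      exact ENNReal.ofReal_le_ofReal (key ω hω).2
    · norm_num [sphI]

/-- The flux of a current through a family of spheres along a null ray. -/
theorem flux_segment (h₀ : Continuous N₀) (h : ∀ i, Continuous (N i))
    (hd : ∀ p, 0 ≤ dens p) (he : FluxEquiv N₀ N κ dens) {t r : ℝ → ℝ} (ht : Continuous t)
    (hr : Continuous r) {a b : ℝ} (hab : a ≤ b) (hpos : ∀ x ∈ Icc a b, 0 ≤ r x) :
    0 ≤ (∫ x in a..b, (sA N₀ (t x) (r x) + κ * sB N (t x) (r x))) ∧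
    ∫⁻ x in Icc a b, sphI (fun p => dens p * rad p ^ 2) (t x) (r x)
      ≤ oR 12288 * oR (∫ x in a..b, (sA N₀ (t x) (r x) + κ * sB N (t x) (r x))) ∧
    oR (∫ x in a..b, (sA N₀ (t x) (r x) + κ * sB N (t x) (r x)))
      ≤ oR 3456 * ∫⁻ x in Icc a b, sphI (fun p => dens p * rad p ^ 2) (t x) (r x) := by
  have hcA := continuous₂_comp (continuous_sA h₀) ht hr
  have hcB := continuous₂_comp (continuous_sB h) ht hr
  have hs : ∀ x ∈ Icc a b, _ := fun x hx => flux_sphere h₀ h hd he (t x) (hpos x hx)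
  have hcont : Continuous fun x => sA N₀ (t x) (r x) + κ * sB N (t x) (r x) := by fun_prop
  rw [oR_intervalIntegral hcont hab fun x hx => (hs x hx).1, ← lintegral_const_mul' _ _ oR_ne_top,
    ← lintegral_const_mul' _ _ oR_ne_top]
  exact ⟨intervalIntegral.integral_nonneg hab fun x hx => (hs x hx).1,
    setLIntegral_mono' measurableSet_Icc fun x hx => (hs x hx).2.1,
    setLIntegral_mono' measurableSet_Icc fun x hx => (hs x hx).2.2⟩

theorem flux_out (h₀ : Continuous N₀) (h : ∀ i, Continuous (N i))
    (hd : ∀ p, 0 ≤ dens p) (he : FluxEquiv N₀ N (-1) dens) {u v₀ v₁ : ℝ} (huv : u ≤ v₀)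
    (hv : v₀ ≤ v₁) :
    0 ≤ outFlux N₀ N u v₀ v₁ ∧
    lIntHseg u v₀ v₁ (fun p => dens p * rad p ^ 2) ≤ oR 12288 * oR (outFlux N₀ N u v₀ v₁) ∧
    oR (outFlux N₀ N u v₀ v₁)
      ≤ oR 3456 * lIntHseg u v₀ v₁ (fun p => dens p * rad p ^ 2) := by
  have := flux_segment h₀ h hd he (t := fun v => u + v) (r := fun v => v - u) (by fun_prop)
    (by fun_prop) hv fun v hv => by linarith [hv.1]
  simp only [neg_one_mul, ← sub_eq_add_neg] at this
  exact this

theorem flux_in (h₀ : Continuous N₀) (h : ∀ i, Continuous (N i))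
    (hd : ∀ p, 0 ≤ dens p) (he : FluxEquiv N₀ N 1 dens) {v u₀ u₁ : ℝ} (huv : u₁ ≤ v)
    (hu : u₀ ≤ u₁) :
    0 ≤ inFlux N₀ N v u₀ u₁ ∧
    lIntHb v u₀ u₁ (fun p => dens p * rad p ^ 2) ≤ oR 12288 * oR (inFlux N₀ N v u₀ u₁) := by
  have := flux_segment h₀ h hd he (t := fun u => u + v) (r := fun u => v - u) (by fun_prop)
    (by fun_prop) hu fun u hu => by linarith [hu.2]
  simp only [one_mul] at this
  exact ⟨this.1, this.2.1⟩

end Flux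

section Energy

variable {ε : ℝ} {G : V → Fin 4 → Fin 4 → ℝ}

theorem fluxEquiv_out (hε : 0 < ε) (hε1 : ε ≤ 1) (hA : AntiSym G) :
    FluxEquiv (curT ε G) (curX ε G) (-1)
      (fun p => rhoC G p ^ 2 + sigmaSq G p + alphaSq G p) := by
  intro p a hp ha
  have := (flux_bounds hε hε1 hA hp (ha 0) (ha 1) (ha 2)).1
  rw [Fin.sum_univ_three, neg_one_mul, ← sub_eq_add_neg]
  exact this

theorem fluxEquiv_in (hε : 0 < ε) (hε1 : ε ≤ 1) (hA : AntiSym G) :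
    FluxEquiv (curT ε G) (curX ε G) 1
      (fun p => rhoC G p ^ 2 + sigmaSq G p + abarSq G p) := by
  intro p a hp ha
  have := (flux_bounds hε hε1 hA hp (ha 0) (ha 1) (ha 2)).2.1
  rw [Fin.sum_univ_three, one_mul]
  exact this

theorem curT_bounds (hε : 0 < ε) (hε1 : ε ≤ 1) (hA : AntiSym G) {p : V} (hp : 0 < rad p) :
    rhoC G p ^ 2 + sigmaSq G p + (1 / 2) * (alphaSq G p + abarSq G p) ≤ 2 * curT ε G p ∧
    curT ε G p ≤ 3 * (rhoC G p ^ 2 + sigmaSq G p + (1 / 2) * (alphaSq G p + abarSq G p)) := by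
  have h : ∀ x, x = rad p * (x / rad p) := fun x => by field_simp
  exact (flux_bounds hε hε1 hA hp (h (p 1)) (h (p 2)) (h (p 3))).2.2

/-- The energy on a spherical shell of a time slice. -/
theorem energy_shell (hε : 0 < ε) (hε1 : ε ≤ 1) (hG : Smooth2Form G) (hA : AntiSym G) (t : ℝ)
    {r₀ r₁ : ℝ} (h0 : 0 ≤ r₀) (h1 : r₀ ≤ r₁) :
    0 ≤ (∫ r in r₀..r₁, sA (curT ε G) t r) ∧
    ∫⁻ x in {x : E3 | ‖x‖ ∈ Icc r₀ r₁}, oR ((fun p => rhoC G p ^ 2 + sigmaSq G p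
        + (1 / 2) * (alphaSq G p + abarSq G p)) (stp t x))
      ≤ oR 2 * oR (∫ r in r₀..r₁, sA (curT ε G) t r) ∧
    oR (∫ r in r₀..r₁, sA (curT ε G) t r)
      ≤ oR 3 * ∫⁻ x in {x : E3 | ‖x‖ ∈ Icc r₀ r₁}, oR ((fun p => rhoC G p ^ 2 + sigmaSq G p
        + (1 / 2) * (alphaSq G p + abarSq G p)) (stp t x)) := by
  have hc : Continuous (curT ε G) := (contDiff_curT ε hG).continuous
  have hN : ∀ p, 0 < rad p → 0 ≤ curT ε G p := fun p hp => by
    have := (curT_bounds hε hε1 hA hp).1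
    have := sigmaSq_nonneg G p
    have := alphaSq_nonneg G p
    have := abarSq_nonneg G p
    have := sq_nonneg (rhoC G p)
    linarith
  refine ⟨intervalIntegral.integral_nonneg h1 fun r hr => sA_nonneg hN t (h0.trans hr.1), ?_, ?_⟩
  · rw [← setLIntegral_stp_eq_oR hc hN t h0 h1]
    exact setLIntegral_stp_le zero_le_two (fun p hp => (curT_bounds hε hε1 hA hp).1) t _
  · rw [← setLIntegral_stp_eq_oR hc hN t h0 h1]
    exact setLIntegral_stp_le zero_le_three (fun p hp => (curT_bounds hε hε1 hA hp).2) t _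

end Energy

/-! ### Measurability of the frame components -/

section Measurability

variable {G : V → Fin 4 → Fin 4 → ℝ}

theorem measurable_rad : Measurable rad := continuous_rad.measurable

theorem measurable_Lv : Measurable Lv := by
  have := measurable_rad
  refine measurable_pi_iff.2 fun μ => ?_
  fin_cases μ <;> simp [Lv] <;> fun_prop

theorem measurable_Lbv : Measurable Lbv := by
  have := measurable_rad
  refine measurable_pi_iff.2 fun μ => ?_
  fin_cases μ <;> simp [Lbv] <;> fun_prop

theorem measurable_Pv (j : Fin 3) : Measurable fun p => Pv p j := by
  have := measurable_rad
  refine measurable_pi_iff.2 fun μ => ?_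
  by_cases h : μ = 0
  · simp [Pv, h]
  · simp only [Pv, h, if_false]
    fun_prop

theorem measurable_ap2 (hG : ∀ μ ν, Measurable fun p => G p μ ν) {X Y : V → V} (hX : Measurable X)
    (hY : Measurable Y) : Measurable fun p => ap2 G (X p) (Y p) p :=
  Finset.measurable_fun_sum _ fun μ _ => Finset.measurable_fun_sum _ fun ν _ =>
    ((measurable_pi_iff.1 hX μ).mul (measurable_pi_iff.1 hY ν)).mul (hG μ ν)

theorem measurable_ap1 {J : V → Fin 4 → ℝ} (hJ : ∀ μ, Measurable fun p => J p μ) {X : V → V}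
    (hX : Measurable X) : Measurable fun p => ap1 J (X p) p :=
  Finset.measurable_fun_sum _ fun μ _ => (measurable_pi_iff.1 hX μ).mul (hJ μ)

theorem measurable_rhoC (hG : ∀ μ ν, Measurable fun p => G p μ ν) : Measurable (rhoC G) :=
  (measurable_ap2 hG measurable_Lbv measurable_Lv).const_mul _

theorem measurable_bulkD (hG : ∀ μ ν, Measurable fun p => G p μ ν) (ε : ℝ) :
    Measurable (bulkD ε G) := by
  have h1 := measurable_rhoC hG
  have h2 : Measurable (sigmaSq G) :=
    (Finset.measurable_fun_sum _ fun j _ => Finset.measurable_fun_sum _ fun k _ =>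
      (measurable_ap2 hG (measurable_Pv j) (measurable_Pv k)).pow_const 2).const_mul _
  have h3 : Measurable (fSq G) :=
    (Finset.measurable_fun_sum _ fun μ _ => Finset.measurable_fun_sum _ fun ν _ =>
      (hG μ ν).pow_const 2).const_mul _
  have h4 : Measurable rplus := measurable_rad.const_add 1
  have h5 := measurable_rad
  unfold bulkD
  fun_prop

end Measurability

/-! ### The leaves of the foliation -/

theorem sphI_le_of_le {f F : V → ℝ} (h : ∀ p, f p ≤ F p) (t : ℝ) {r : ℝ} (hr : 0 ≤ r) :
    sphI (fun p => f p * rad p ^ 2) t r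
      ≤ 6144 * (ENNReal.ofReal (r ^ 2) * ∫⁻ ω, oR (F (pt t r ω)) ∂sphM) := by
  rw [← lintegral_const_mul' _ _ ofReal_ne_top, sphI, sphLInt]
  calc _ ≤ ∫⁻ ω in sphere (0 : E3) 1, ENNReal.ofReal (r ^ 2) * oR (F (pt t r ω)) ∂μH[2] := by
        refine setLIntegral_mono' isClosed_sphere.measurableSet fun ω hω => ?_
        rw [oR, oR, ← ENNReal.ofReal_mul (sq_nonneg r), rad_pt hr t hω, mul_comm]
        exact ENNReal.ofReal_le_ofReal (mul_le_mul_of_nonneg_left (h _) (sq_nonneg r))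
    _ ≤ ∫⁻ ω, ENNReal.ofReal (r ^ 2) * oR (F (pt t r ω)) ∂((6144 : ℝ≥0∞) • sphM) :=
        lintegral_mono' hausdorff_le_sphM le_rfl
    _ = _ := by rw [lintegral_smul_measure]; rfl

theorem continuous_bend (R : ℝ) : Continuous fun r : ℝ => max (r - R) 0 := by fun_prop

theorem Dint_eq_swept {τ₁ : ℝ} (R : ℝ) (hτ₁ : 0 ≤ τ₁) (τ₂ : ℝ) :
    Dint R τ₁ τ₂ = swept (fun r => max (r - R) 0) (fun _ => Ici 0) τ₁ τ₂ := by
  ext p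
  have hs : sigP R p = tC p - max (rad p - R) 0 := by
    rw [sigP, uC]
    split_ifs with h
    · rw [max_eq_right (by linarith), sub_zero]
    · rw [max_eq_left (by linarith)]; ring
  have h0 : 0 ≤ rad p := Real.sqrt_nonneg _
  have hm : 0 ≤ max (rad p - R) 0 := le_max_right _ _
  rw [Dint, swept, mem_ofPred_eq, mem_ofPred_eq, hs]
  constructor
  · rintro ⟨-, h1, h2⟩
    exact ⟨⟨h1, h2⟩, h0⟩
  · rintro ⟨⟨h1, h2⟩, -⟩
    exact ⟨by linarith, h1, h2⟩

theorem lintegral_lIntSigE_le {R τ₁ τ₂ : ℝ} (hR : 0 ≤ R) (hτ₁ : 0 ≤ τ₁) {f F : V → ℝ}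
    (hF : Measurable F) (h : ∀ p, f p ≤ F p) :
    ∫⁻ τ in Icc τ₁ τ₂, lIntSigE R τ f ≤ oR 6145 * ∫⁻ p in Dint R τ₁ τ₂, oR (F p) := by
  rw [Dint_eq_swept R hτ₁, setLIntegral_swept (K := fun _ => Ici 0) (f := fun p => oR (F p))
    (continuous_bend R) (measurable_snd measurableSet_Ici) (fun τ _ => le_rfl) (ENNReal.measurable_ofReal.comp hF),
    ← lintegral_const_mul' _ _ oR_ne_top]
  refine setLIntegral_mono' measurableSet_Icc fun τ hτ => ?_
  have hτ0 : 0 ≤ τ := hτ₁.trans hτ.1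
  set g : ℝ → ℝ≥0∞ := fun r =>
    ENNReal.ofReal (r ^ 2) * ∫⁻ ω, oR (F (pt (τ + max (r - R) 0) r ω)) ∂sphM
  have hball : lIntBall τ R f ≤ ∫⁻ r in Ici 0, g r := by
    calc lIntBall τ R f ≤ ∫⁻ x in closedBall (0 : E3) R, oR (F (stp τ x)) :=
          lintegral_mono fun x => ENNReal.ofReal_le_ofReal (h _)
      _ ≤ ∫⁻ x in {x : E3 | ‖x‖ ∈ Icc 0 R}, oR (F (stp τ x)) :=
          lintegral_mono_set fun x hx => ⟨norm_nonneg x, mem_closedBall_zero_iff.1 hx⟩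
      _ = ∫⁻ r in Icc 0 R, ENNReal.ofReal (r ^ 2) * ∫⁻ ω, oR (F (stp τ (r • ω))) ∂sphM :=
          setLIntegral_polar (h := fun x => oR (F (stp τ x)))
            (ENNReal.measurable_ofReal.comp (hF.comp (continuous_stp τ).measurable))
            measurableSet_Icc Icc_subset_Ici_self
      _ = ∫⁻ r in Icc 0 R, g r := by
          refine setLIntegral_congr_fun measurableSet_Icc fun r hr => ?_
          simp only [stp_smul, g]
          rw [max_eq_right (by linarith [hr.2]), add_zero]
      _ ≤ _ := lintegral_mono_set Icc_subset_Ici_self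
  have hcone : lIntH ((τ - R) / 2) ((τ + R) / 2) (fun p => f p * rad p ^ 2)
      ≤ 6144 * ∫⁻ r in Ici 0, g r := by
    have hpre : Ici ((τ + R) / 2) = (fun v => v - (τ - R) / 2) ⁻¹' Ici R := by
      ext v; simp only [mem_Ici, mem_preimage]; constructor <;> intro h <;> linarith
    have htr := (measurePreserving_sub_right (volume : Measure ℝ) ((τ - R) / 2)
      ).setLIntegral_comp_preimage_emb
        (MeasurableEquiv.subRight ((τ - R) / 2)).measurableEmbedding g (Ici R)
    rw [lIntH]
    calc _ ≤ ∫⁻ v in Ici ((τ + R) / 2), 6144 * g (v - (τ - R) / 2) := by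
          refine setLIntegral_mono' measurableSet_Ici fun v hv => ?_
          have hv' : (τ + R) / 2 ≤ v := hv
          refine (sphI_le_of_le h _ (by linarith)).trans_eq ?_
          simp only [g]
          rw [max_eq_left (by linarith), show τ + (v - (τ - R) / 2 - R) = (τ - R) / 2 + v by ring]
      _ = 6144 * ∫⁻ r in Ici R, g r := by
          rw [lintegral_const_mul' _ _ (by norm_num), hpre, ← htr]
      _ ≤ _ := by gcongr
  rw [lIntSigE, if_pos hτ0]
  calc _ ≤ (∫⁻ r in Ici 0, g r) + 6144 * ∫⁻ r in Ici 0, g r := add_le_add hball hcone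
    _ = oR 6145 * ∫⁻ r in Ici 0, g r := by
        have : oR 6145 = 1 + 6144 := by rw [oR]; norm_num
        rw [this, add_mul, one_mul]

/-! ### The energy estimates for small exponents -/

theorem sweptInt_neg (s ρ₁ ρ₂ : ℝ → ℝ) (t₀ t₁ : ℝ) (M : V → ℝ) :
    sweptInt s ρ₁ ρ₂ t₀ t₁ (fun p => -M p) = -sweptInt s ρ₁ ρ₂ t₀ t₁ M := by
  simp only [sweptInt, sA, mul_neg, integral_neg, intervalIntegral.integral_neg]

theorem sweptInt_bend {R τ₁ τ₂ v₁ : ℝ} (hR : 0 ≤ R) (hτ : τ₁ ≤ τ₂) (hv : (τ₂ + R) / 2 ≤ v₁)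
    {M : V → ℝ} (hM : Continuous M) :
    sweptInt (fun r => max (r - R) 0) (fun _ => 0) (fun τ => v₁ + R / 2 - τ / 2) τ₁ τ₂ M
      = (∫ τ in τ₁..τ₂, ∫ r in (0 : ℝ)..R, sA M τ r)
        + ∫ τ in τ₁..τ₂, ∫ r in R..v₁ + R / 2 - τ / 2, sA M (τ + (r - R)) r := by
  have hc₁ : Continuous fun τ => ∫ r in (0 : ℝ)..R, sA M τ r := by
    simpa using continuous_sweptInner (s := fun _ => 0) (ρ₁ := fun _ => 0) (ρ₂ := fun _ => R)
      (by fun_prop) (by fun_prop) (by fun_prop) hM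
  have hc₂ : Continuous fun τ => ∫ r in R..v₁ + R / 2 - τ / 2, sA M (τ + (r - R)) r :=
    continuous_sweptInner (s := fun r => r - R) (ρ₁ := fun _ => R)
      (ρ₂ := fun τ => v₁ + R / 2 - τ / 2) (by fun_prop) (by fun_prop) (by fun_prop) hM
  rw [sweptInt, ← intervalIntegral.integral_add (hc₁.intervalIntegrable _ _)
    (hc₂.intervalIntegrable _ _)]
  refine intervalIntegral.integral_congr fun τ hmem => ?_
  rw [uIcc_of_le hτ] at hmem
  have hcont : Continuous fun r => sA M (τ + max (r - R) 0) r :=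
    continuous₂_comp (continuous_sA hM) (by fun_prop) (by fun_prop)
  have hRv : R ≤ v₁ + R / 2 - τ / 2 := by linarith [hmem.2]
  rw [← intervalIntegral.integral_add_adjacent_intervals (hcont.intervalIntegrable 0 R)
    (hcont.intervalIntegrable R _)]
  congr 1 <;> refine intervalIntegral.integral_congr fun r hr => ?_
  · rw [uIcc_of_le hR] at hr
    rw [max_eq_right (by linarith [hr.2]), add_zero]
  · rw [uIcc_of_le hRv] at hr
    rw [max_eq_left (by linarith [hr.1])]

theorem parts_le {I J E : ℝ≥0∞} {c₁ c₂ X Y : ℝ} (hc₁ : 1 ≤ c₁)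
    (h : I + oR c₁ * oR X ≤ oR c₁ * oR Y + oR c₂ * J) (hY : oR Y ≤ oR 3456 * E) :
    I ≤ (oR c₁ * oR 3456 + oR c₂) * (E + J) ∧
      ∀ x ≤ X, oR x ≤ (oR c₁ * oR 3456 + oR c₂) * (E + J) := by
  have hK : oR c₁ * oR Y + oR c₂ * J ≤ (oR c₁ * oR 3456 + oR c₂) * (E + J) := by
    calc _ ≤ oR c₁ * (oR 3456 * (E + J)) + oR c₂ * (E + J) := by
          gcongr
          · exact hY.trans (by gcongr; exact le_self_add)
          · exact le_add_self
      _ = _ := by ring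
  have h1 : 1 ≤ oR c₁ := by rw [oR, ENNReal.one_le_ofReal]; exact hc₁
  refine ⟨le_self_add.trans (h.trans hK), fun x hx => ?_⟩
  calc oR x ≤ 1 * oR X := by rw [one_mul]; exact ENNReal.ofReal_le_ofReal hx
    _ ≤ oR c₁ * oR X := by gcongr
    _ ≤ _ := le_add_self.trans (h.trans hK)

theorem closedBall_eq_shell (R : ℝ) : closedBall (0 : E3) R = {x : E3 | ‖x‖ ∈ Icc 0 R} := by
  ext x
  rw [mem_closedBall_zero_iff, mem_ofPred_eq]
  exact ⟨fun h => ⟨norm_nonneg x, h⟩, fun h => h.2⟩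

section Estimates

variable {ε R τ₁ τ₂ : ℝ} {G : V → Fin 4 → Fin 4 → ℝ}

/-- The constant of the energy estimate for the current `curT`, `curX`. -/
def enK (ε : ℝ) : ℝ≥0∞ := oR (8 / ε) * oR 3456 + oR (576 / ε ^ 2)

theorem bulkD_nonneg (ε : ℝ) (G : V → Fin 4 → Fin 4 → ℝ) (p : V) : 0 ≤ bulkD ε G p := by
  have h0 : 0 ≤ rad p := Real.sqrt_nonneg _
  have h1 := fSq_nonneg G p
  have h2 := sigmaSq_nonneg G p
  have h3 : 0 < rplus p := rplus_pos p
  unfold bulkD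
  positivity

theorem continuous_curT (hG : Smooth2Form G) : Continuous (curT ε G) :=
  (contDiff_curT ε hG).continuous

theorem continuous_curX (hG : Smooth2Form G) (i : Fin 3) : Continuous (curX ε G i) :=
  (contDiff_curX ε hG i).continuous

theorem one_le_eight_div (hε : 0 < ε) (hε1 : ε ≤ 1) : 1 ≤ 8 / ε := by
  rw [le_div_iff₀ hε]; linarith

theorem continuous_neg_stDiv (hG : Smooth2Form G) :
    Continuous fun p => -stDiv (curT ε G) (curX ε G) p :=
  (continuous_stDiv ((contDiff_curT ε hG).of_le (by exact_mod_cast le_top))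
    fun i => (contDiff_curX ε hG i).of_le (by exact_mod_cast le_top)).neg

theorem interior_truncated (hε : 0 < ε) (hε1 : ε ≤ 1) (hG : Smooth2Form G) (hA : AntiSym G)
    (hB : Bianchi G) (hR : 0 ≤ R) (hτ₁ : 0 ≤ τ₁) (hτ : τ₁ ≤ τ₂) {v₁ : ℝ}
    (hv : (τ₂ + R) / 2 ≤ v₁) {B : ℝ≥0∞}
    (hBdef : B = enK ε * (EfSig R G τ₁ + ∫⁻ p in Dint R τ₁ τ₂, oR (srcD ε G p))) :
    (∫⁻ p in swept (fun r => max (r - R) 0) (fun τ => Icc 0 (v₁ + R / 2 - τ / 2)) τ₁ τ₂,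
        oR (bulkD ε G p)) ≤ B ∧
      lIntBall τ₂ R (fun p => rhoC G p ^ 2 + sigmaSq G p + (1 / 2) * (alphaSq G p + abarSq G p))
        ≤ oR 2 * B ∧
      EfHseg G ((τ₂ - R) / 2) ((τ₂ + R) / 2) v₁ ≤ oR 12288 * B ∧
      EfHb G v₁ ((τ₁ - R) / 2) ((τ₂ - R) / 2) ≤ oR 12288 * B := by
  have hTc : ContDiff ℝ 1 (curT ε G) := (contDiff_curT ε hG).of_le (by exact_mod_cast le_top)
  have hXc : ∀ i, ContDiff ℝ 1 (curX ε G i) := fun i =>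
    (contDiff_curX ε hG i).of_le (by exact_mod_cast le_top)
  have hT := continuous_curT (ε := ε) hG
  have hX := continuous_curX (ε := ε) hG
  have hout : ∀ p, 0 ≤ rhoC G p ^ 2 + sigmaSq G p + alphaSq G p := fun p =>
    add_nonneg (add_nonneg (sq_nonneg _) (sigmaSq_nonneg G p)) (alphaSq_nonneg G p)
  have hin : ∀ p, 0 ≤ rhoC G p ^ 2 + sigmaSq G p + abarSq G p := fun p =>
    add_nonneg (add_nonneg (sq_nonneg _) (sigmaSq_nonneg G p)) (abarSq_nonneg G p)
  obtain ⟨b1, b2, -⟩ := energy_shell hε hε1 hG hA τ₂ le_rfl hR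
  obtain ⟨b3, -, b4⟩ := energy_shell hε hε1 hG hA τ₁ le_rfl hR
  obtain ⟨o1, o2, -⟩ := flux_out hT hX hout (fluxEquiv_out hε hε1 hA)
    (u := (τ₂ - R) / 2) (v₀ := (τ₂ + R) / 2) (v₁ := v₁) (by linarith) hv
  obtain ⟨o3, -, o4⟩ := flux_out hT hX hout (fluxEquiv_out hε hε1 hA)
    (u := (τ₁ - R) / 2) (v₀ := (τ₁ + R) / 2) (v₁ := v₁) (by linarith) (by linarith)
  obtain ⟨i1, i2⟩ := flux_in hT hX hin (fluxEquiv_in hε hε1 hA)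
    (v := v₁) (u₀ := (τ₁ - R) / 2) (u₁ := (τ₂ - R) / 2) (by linarith) (by linarith)
  have hid := interior_identity hTc hXc R τ₁ τ₂ v₁
  rw [← sweptInt_bend hR hτ hv (continuous_stDiv hTc hXc), sub_eq_add_neg, ← sweptInt_neg] at hid
  have key := energy_estimate (continuous_bend R) (by fun_prop) (by fun_prop) hτ
    (fun τ _ => le_rfl) (fun τ hτ' => by linarith [hτ'.2]) (continuous_neg_stDiv (ε := ε) hG)
    (by positivity) (by positivity) (bulkD_nonneg ε G) (fun p => bulkD_le hε hε1 hG hA hB)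
    (by positivity) (add_nonneg b3 o3) hid
  have hY : oR ((∫ r in (0 : ℝ)..R, sA (curT ε G) τ₁ r)
      + outFlux (curT ε G) (curX ε G) ((τ₁ - R) / 2) ((τ₁ + R) / 2) v₁)
      ≤ oR 3456 * EfSig R G τ₁ := by
    rw [oR, ENNReal.ofReal_add b3 o3, EfSig, if_pos hτ₁, mul_add, lIntBall, closedBall_eq_shell]
    refine add_le_add (b4.trans ?_) (o4.trans ?_)
    · gcongr
      exact ENNReal.ofReal_le_ofReal (by norm_num)
    · gcongr
      exact lintegral_mono_set Icc_subset_Ici_self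
  obtain ⟨p1, p2⟩ := parts_le (one_le_eight_div hε hε1) key hY
  have hJ : (oR (8 / ε) * oR 3456 + oR (576 / ε ^ 2)) * (EfSig R G τ₁
      + ∫⁻ p in swept (fun r => max (r - R) 0) (fun τ => Icc 0 (v₁ + R / 2 - τ / 2)) τ₁ τ₂,
        oR (srcD ε G p)) ≤ B := by
    rw [hBdef, enK, Dint_eq_swept R hτ₁]
    have hsub : swept (fun r => max (r - R) 0) (fun τ => Icc 0 (v₁ + R / 2 - τ / 2)) τ₁ τ₂
        ⊆ swept (fun r => max (r - R) 0) (fun _ => Ici 0) τ₁ τ₂ := fun p hp => ⟨hp.1, hp.2.1⟩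
    exact mul_le_mul' le_rfl (add_le_add le_rfl (lintegral_mono_set hsub))
  refine ⟨p1.trans hJ, ?_, o2.trans ?_, i2.trans ?_⟩
  · rw [lIntBall, closedBall_eq_shell]
    refine b2.trans ?_
    gcongr
    exact (p2 _ (by linarith)).trans hJ
  · gcongr
    exact (p2 _ (by linarith)).trans hJ
  · gcongr
    exact (p2 _ (by linarith)).trans hJ

theorem iUnion_Icc_add_nat (a : ℝ) : ⋃ n : ℕ, Icc a (a + n) = Ici a := by
  ext x
  simp only [mem_iUnion, mem_Icc, mem_Ici]
  refine ⟨fun ⟨_, h⟩ => h.1, fun h => ?_⟩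
  obtain ⟨n, hn⟩ := exists_nat_ge (x - a)
  exact ⟨n, h, by linarith⟩

theorem interior_bulk (hε : 0 < ε) (hε1 : ε ≤ 1) (hG : Smooth2Form G) (hA : AntiSym G)
    (hB : Bianchi G) (hR : 0 ≤ R) (hτ₁ : 0 ≤ τ₁) (hτ : τ₁ ≤ τ₂) {B : ℝ≥0∞}
    (hBdef : B = enK ε * (EfSig R G τ₁ + ∫⁻ p in Dint R τ₁ τ₂, oR (srcD ε G p))) :
    ∫⁻ p in Dint R τ₁ τ₂, oR (bulkD ε G p) ≤ B := by
  set S : ℕ → Set V := fun n => swept (fun r => max (r - R) 0)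
    (fun τ => Icc 0 (((τ₂ + R) / 2 + n) + R / 2 - τ / 2)) τ₁ τ₂ with hS
  have hmono : Monotone S := fun m n hmn p hp =>
    ⟨hp.1, hp.2.1, hp.2.2.trans (by
      have : (m : ℝ) ≤ n := by exact_mod_cast hmn
      linarith)⟩
  have hU : Dint R τ₁ τ₂ = ⋃ n, S n := by
    rw [Dint_eq_swept R hτ₁]
    ext p
    simp only [mem_iUnion]
    refine ⟨fun hp => ?_, fun ⟨n, hp⟩ => ⟨hp.1, hp.2.1⟩⟩
    obtain ⟨n, hn⟩ := exists_nat_ge (rad p)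
    exact ⟨n, hp.1, hp.2, by have := hp.1.2; linarith⟩
  rw [hU, setLIntegral_iUnion_of_directed _ hmono.directed_le]
  exact iSup_le fun n => (interior_truncated hε hε1 hG hA hB hR hτ₁ hτ
    (by linarith [n.cast_nonneg (α := ℝ)]) hBdef).1

theorem interior_outgoing (hε : 0 < ε) (hε1 : ε ≤ 1) (hG : Smooth2Form G) (hA : AntiSym G)
    (hB : Bianchi G) (hR : 0 ≤ R) (hτ₁ : 0 ≤ τ₁) (hτ : τ₁ ≤ τ₂) {B : ℝ≥0∞}
    (hBdef : B = enK ε * (EfSig R G τ₁ + ∫⁻ p in Dint R τ₁ τ₂, oR (srcD ε G p))) :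
    EfH G ((τ₂ - R) / 2) ((τ₂ + R) / 2) ≤ oR 12288 * B := by
  have hmono : Monotone fun n : ℕ => Icc ((τ₂ + R) / 2) ((τ₂ + R) / 2 + n) := fun m n hmn =>
    Icc_subset_Icc_right (by
      have : (m : ℝ) ≤ n := by exact_mod_cast hmn
      linarith)
  rw [EfH, lIntH, ← iUnion_Icc_add_nat, setLIntegral_iUnion_of_directed _ hmono.directed_le]
  exact iSup_le fun n => (interior_truncated hε hε1 hG hA hB hR hτ₁ hτ
    (by linarith [n.cast_nonneg (α := ℝ)]) hBdef).2.2.1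

theorem Dext_eq_swept (R τ₁ τ₂ : ℝ) :
    Dext R τ₁ τ₂ = swept (fun _ => 0)
      (fun t => Icc (t - 2 * ((τ₁ - R) / 2)) (2 * (-((τ₂ - R) / 2)) - t))
      0 (-((τ₂ - R) / 2) + (τ₁ - R) / 2) := by
  ext p
  simp only [Dext, swept, mem_ofPred_eq, uC, vC, mem_Icc, sub_zero]
  constructor
  · rintro ⟨h1, h2, h3⟩
    exact ⟨⟨h1, by linarith⟩, by linarith, by linarith⟩
  · rintro ⟨⟨h1, -⟩, h2, h3⟩
    exact ⟨h1, by linarith, by linarith⟩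

theorem exterior_estimate (hε : 0 < ε) (hε1 : ε ≤ 1) (hG : Smooth2Form G) (hA : AntiSym G)
    (hB : Bianchi G) (hR : 0 ≤ R) (hτ : τ₂ ≤ τ₁) (hτ₁ : τ₁ ≤ 0) {B : ℝ≥0∞}
    (hBdef : B = enK ε * (lIntAnn 0 (R - τ₁) (R - τ₂) (fun p => rhoC G p ^ 2 + sigmaSq G p
        + (1 / 2) * (alphaSq G p + abarSq G p))
      + ∫⁻ p in Dext R τ₁ τ₂, oR (srcD ε G p))) :
    (∫⁻ p in Dext R τ₁ τ₂, oR (bulkD ε G p)) ≤ B ∧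
      EfHb G (-((τ₂ - R) / 2)) ((τ₂ - R) / 2) ((τ₁ - R) / 2) ≤ oR 12288 * B ∧
      EfHseg G ((τ₁ - R) / 2) (-((τ₁ - R) / 2)) (-((τ₂ - R) / 2)) ≤ oR 12288 * B := by
  have hTc : ContDiff ℝ 1 (curT ε G) := (contDiff_curT ε hG).of_le (by exact_mod_cast le_top)
  have hXc : ∀ i, ContDiff ℝ 1 (curX ε G i) := fun i =>
    (contDiff_curX ε hG i).of_le (by exact_mod_cast le_top)
  have hT := continuous_curT (ε := ε) hG
  have hX := continuous_curX (ε := ε) hG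
  have hout : ∀ p, 0 ≤ rhoC G p ^ 2 + sigmaSq G p + alphaSq G p := fun p =>
    add_nonneg (add_nonneg (sq_nonneg _) (sigmaSq_nonneg G p)) (alphaSq_nonneg G p)
  have hin : ∀ p, 0 ≤ rhoC G p ^ 2 + sigmaSq G p + abarSq G p := fun p =>
    add_nonneg (add_nonneg (sq_nonneg _) (sigmaSq_nonneg G p)) (abarSq_nonneg G p)
  rw [Dext_eq_swept] at hBdef ⊢
  have e1 : R - τ₁ = -(2 * ((τ₁ - R) / 2)) := by ring
  have e2 : R - τ₂ = 2 * (-((τ₂ - R) / 2)) := by ring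
  have e3 : (τ₂ - R) / 2 = -(-((τ₂ - R) / 2)) := by ring
  obtain ⟨b3, -, b4⟩ := energy_shell hε hε1 hG hA 0 (r₀ := -(2 * ((τ₁ - R) / 2)))
    (r₁ := 2 * (-((τ₂ - R) / 2))) (by linarith) (by linarith)
  obtain ⟨o1, o2, -⟩ := flux_out hT hX hout (fluxEquiv_out hε hε1 hA)
    (u := (τ₁ - R) / 2) (v₀ := -((τ₁ - R) / 2)) (v₁ := -((τ₂ - R) / 2)) (by linarith)
    (by linarith)
  obtain ⟨i1, i2⟩ := flux_in hT hX hin (fluxEquiv_in hε hε1 hA)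
    (v := -((τ₂ - R) / 2)) (u₀ := -(-((τ₂ - R) / 2))) (u₁ := (τ₁ - R) / 2) (by linarith)
    (by linarith)
  have hid := exterior_identity hTc hXc ((τ₁ - R) / 2) (-((τ₂ - R) / 2))
  have hsw : (∫ t in (0 : ℝ)..-((τ₂ - R) / 2) + (τ₁ - R) / 2,
      ∫ r in t - 2 * ((τ₁ - R) / 2)..2 * -((τ₂ - R) / 2) - t,
        sA (stDiv (curT ε G) (curX ε G)) t r)
      = sweptInt (fun _ => 0) (fun t => t - 2 * ((τ₁ - R) / 2))
        (fun t => 2 * -((τ₂ - R) / 2) - t) 0 (-((τ₂ - R) / 2) + (τ₁ - R) / 2)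
        (stDiv (curT ε G) (curX ε G)) := by
    simp only [sweptInt, add_zero]
  rw [hsw, sub_eq_add_neg, ← sweptInt_neg] at hid
  have key := energy_estimate (by fun_prop) (by fun_prop) (by fun_prop) (by linarith)
    (fun t ht => by linarith [ht.1]) (fun t ht => by linarith [ht.2])
    (continuous_neg_stDiv (ε := ε) hG)
    (by positivity) (by positivity) (bulkD_nonneg ε G) (fun p => bulkD_le hε hε1 hG hA hB)
    (by positivity) b3 hid
  have hY : oR (∫ r in -(2 * ((τ₁ - R) / 2))..2 * -((τ₂ - R) / 2), sA (curT ε G) 0 r)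
      ≤ oR 3456 * lIntAnn 0 (R - τ₁) (R - τ₂) (fun p => rhoC G p ^ 2 + sigmaSq G p
        + (1 / 2) * (alphaSq G p + abarSq G p)) := by
    rw [e1, e2]
    refine b4.trans (mul_le_mul' (ENNReal.ofReal_le_ofReal (by norm_num)) le_rfl)
  obtain ⟨p1, p2⟩ := parts_le (one_le_eight_div hε hε1) key hY
  rw [← enK, ← hBdef] at p1
  rw [← enK, ← hBdef] at p2
  refine ⟨p1, ?_, o2.trans ?_⟩
  · rw [e3, neg_neg]
    refine i2.trans ?_
    gcongr
    exact p2 _ (by linarith)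
  · gcongr
    exact p2 _ (by linarith)

theorem rplus_one_le (p : V) : 1 ≤ rplus p := by
  have h0 : 0 ≤ rad p := Real.sqrt_nonneg _
  rw [rplus]; linarith

theorem wI_le_bulkD (ε : ℝ) (D : Set V) :
    wI (-(1 + ε)) 0 (fSq G) D ≤ ∫⁻ p in D, oR (bulkD (min ε 1) G p) := by
  refine lintegral_mono fun p => ENNReal.ofReal_le_ofReal ?_
  have h0 : 0 ≤ rad p := Real.sqrt_nonneg _
  have h1 : rplus p ^ (-(1 + ε)) ≤ rplus p ^ (-(1 + min ε 1)) :=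
    Real.rpow_le_rpow_of_exponent_le (rplus_one_le p) (by linarith [min_le_left ε 1])
  have h2 : 0 ≤ (rhoC G p ^ 2 + sigmaSq G p) / (1 + rad p) := by
    have := sigmaSq_nonneg G p
    positivity
  rw [Real.rpow_zero, one_mul, bulkD]
  linarith [mul_le_mul_of_nonneg_right h1 (fSq_nonneg G p)]

theorem lintegral_srcD_le (hG : Smooth2Form G) (ε : ℝ) (D : Set V) :
    ∫⁻ p in D, oR (srcD (min ε 1) G p) ≤ wI (1 + ε) 0 (JdensMix (divSnd G)) D
      + ∫⁻ p in D, oR (|ap1 (divSnd G) (Lbv p) p| * |rhoC G p|) := by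
  have hm : Measurable fun p => oR (|ap1 (divSnd G) (Lbv p) p| * |rhoC G p|) := by
    have h1 := measurable_rhoC fun μ ν => (hG μ ν).continuous.measurable
    have h2 := measurable_ap1 (J := divSnd G) (fun μ => Finset.measurable_fun_sum _ fun ν _ =>
      (continuous_pd ((hG μ ν).of_le (by exact_mod_cast le_top)) ν).measurable.const_mul (eta ν))
      measurable_Lbv
    exact ENNReal.measurable_ofReal.comp (h2.abs.mul h1.abs)
  rw [wI, ← lintegral_add_right _ hm]
  refine lintegral_mono fun p => ?_
  have hJ : 0 ≤ JdensMix (divSnd G) p := sq_nonneg _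
  have h1 : rplus p ^ (1 + min ε 1) ≤ rplus p ^ (1 + ε) :=
    Real.rpow_le_rpow_of_exponent_le (rplus_one_le p) (by linarith [min_le_left ε 1])
  refine (ENNReal.ofReal_le_ofReal ?_).trans ENNReal.ofReal_add_le
  rw [Real.rpow_zero, one_mul, srcD]
  linarith [mul_le_mul_of_nonneg_right h1 hJ]

theorem energy_density_le_bulkD (ε : ℝ) (G : V → Fin 4 → Fin 4 → ℝ) (p : V) :
    (rhoC G p ^ 2 + sigmaSq G p) / (1 + rad p) ≤ bulkD ε G p :=
  le_add_of_nonneg_left (mul_nonneg (Real.rpow_nonneg (rplus_pos p).le _) (fSq_nonneg G p))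

theorem enK_eq (hε : 0 < ε) : enK ε = oR (8 / ε * 3456 + 576 / ε ^ 2) := by
  rw [enK, oR, oR, oR, oR, ENNReal.ofReal_add (by positivity) (by positivity),
    ENNReal.ofReal_mul (by positivity)]

theorem oR_nat_mul (n : ℕ) (x : ℝ) : oR (n * x) = n * oR x := by
  rw [oR, oR, ENNReal.ofReal_mul n.cast_nonneg, ENNReal.ofReal_natCast]

end Estimates

end MKG

open MKG in
/-- **integrated local energy estimates for the Maxwell field.** -/
theorem statement5 (R γ₀ ε : ℝ) (hR : 1 < R) (hγ₀ : 0 < γ₀) (hγ₀' : γ₀ < 1) (hε : 0 < ε) :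
    ∃ C : ℝ, 0 < C ∧
      ∀ G : V → Fin 4 → Fin 4 → ℝ, Smooth2Form G → AntiSym G → Bianchi G →
        ((∀ τ₁ τ₂ v₀ : ℝ, 0 ≤ τ₁ → τ₁ < τ₂ → (τ₂ + R) / 2 ≤ v₀ →
            wI (-(1 + ε)) 0 (fSq G) (Dint R τ₁ τ₂)
              + (∫⁻ τ in Set.Icc τ₁ τ₂,
                  lIntSigE R τ (fun p => (rhoC G p ^ 2 + sigmaSq G p) / (1 + rad p)))
              + EfHb G v₀ ((τ₁ - R) / 2) ((τ₂ - R) / 2)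
              + EfSig R G τ₂
            ≤ oR C *
              (EfSig R G τ₁
                + wI (1 + ε) 0 (JdensMix (divSnd G)) (Dint R τ₁ τ₂)
                + ∫⁻ p in Dint R τ₁ τ₂,
                    oR (|ap1 (divSnd G) (Lbv p) p| * |rhoC G p|)))
          ∧ (∀ τ₁ τ₂ : ℝ, τ₂ ≤ τ₁ → τ₁ ≤ 0 →
            wI (-(1 + ε)) 0 (fSq G) (Dext R τ₁ τ₂)
              + EfHb G (-((τ₂ - R) / 2)) ((τ₂ - R) / 2) ((τ₁ - R) / 2)
              + EfHseg G ((τ₁ - R) / 2) (-((τ₁ - R) / 2)) (-((τ₂ - R) / 2))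
            ≤ oR C *
              (lIntAnn 0 (R - τ₁) (R - τ₂)
                  (fun p => rhoC G p ^ 2 + sigmaSq G p + (1 / 2) * (alphaSq G p + abarSq G p))
                + wI (1 + ε) 0 (JdensMix (divSnd G)) (Dext R τ₁ τ₂)
                + ∫⁻ p in Dext R τ₁ τ₂,
                    oR (|ap1 (divSnd G) (Lbv p) p| * |rhoC G p|)))) := by
  have h0 : 0 < min ε 1 := lt_min hε one_pos
  have h1 : min ε 1 ≤ 1 := min_le_right _ _
  have hR0 : 0 ≤ R := by linarith
  have hn : ∀ n : ℕ, oR n = n := fun n => ENNReal.ofReal_natCast n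
  refine ⟨(30724 : ℕ) * (8 / min ε 1 * 3456 + 576 / min ε 1 ^ 2), by positivity,
    fun G hG hA hB => ⟨fun τ₁ τ₂ v₀ hτ₁ hτ hv => ?_, fun τ₁ τ₂ hτ hτ₁ => ?_⟩⟩
  · have hsrc := lintegral_srcD_le hG ε (Dint R τ₁ τ₂)
    obtain ⟨B, hBdef⟩ : ∃ B, B = enK (min ε 1) *
      (EfSig R G τ₁ + ∫⁻ p in Dint R τ₁ τ₂, oR (srcD (min ε 1) G p)) := ⟨_, rfl⟩
    have hbulk := interior_bulk h0 h1 hG hA hB hR0 hτ₁ hτ.le hBdef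
    have hout := interior_outgoing h0 h1 hG hA hB hR0 hτ₁ hτ.le hBdef
    obtain ⟨-, hball, -, hb⟩ := interior_truncated h0 h1 hG hA hB hR0 hτ₁ hτ.le hv hBdef
    have hleaf := (lintegral_lIntSigE_le hR0 hτ₁ (τ₂ := τ₂)
      (measurable_bulkD (fun μ ν => (hG μ ν).continuous.measurable) (min ε 1))
      (energy_density_le_bulkD (min ε 1) G)).trans (mul_le_mul' le_rfl hbulk)
    rw [EfSig, if_pos (hτ₁.trans hτ.le)]
    calc _ ≤ B + oR 6145 * B + oR 12288 * B + (oR 2 * B + oR 12288 * B) :=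
          add_le_add (add_le_add (add_le_add ((wI_le_bulkD ε _).trans hbulk) hleaf) hb)
            (add_le_add hball hout)
      _ = (30724 : ℕ) * B := by
          have e1 := hn 6145
          have e2 := hn 12288
          have e3 := hn 2
          push_cast at e1 e2 e3 ⊢
          rw [e1, e2, e3]
          ring
      _ ≤ _ := by
          rw [oR_nat_mul, ← enK_eq h0, mul_assoc, hBdef, add_assoc (EfSig R G τ₁)]
          gcongr
  · have hsrc := lintegral_srcD_le hG ε (Dext R τ₁ τ₂)
    obtain ⟨B, hBdef⟩ : ∃ B, B = enK (min ε 1) *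
      (lIntAnn 0 (R - τ₁) (R - τ₂) (fun p => rhoC G p ^ 2 + sigmaSq G p
          + (1 / 2) * (alphaSq G p + abarSq G p))
        + ∫⁻ p in Dext R τ₁ τ₂, oR (srcD (min ε 1) G p)) := ⟨_, rfl⟩
    obtain ⟨hbulk, hb, hout⟩ := exterior_estimate h0 h1 hG hA hB hR0 hτ hτ₁ hBdef
    calc _ ≤ B + oR 12288 * B + oR 12288 * B :=
          add_le_add (add_le_add ((wI_le_bulkD ε _).trans hbulk) hb) hout
      _ = (24577 : ℕ) * B := by
          have e2 := hn 12288
          push_cast at e2 ⊢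
          rw [e2]
          ring
      _ ≤ (30724 : ℕ) * B := by gcongr; norm_num
      _ ≤ _ := by
          rw [oR_nat_mul, ← enK_eq h0, mul_assoc, hBdef, add_assoc (lIntAnn _ _ _ _)]
          gcongr
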